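/- (Existence of global additive kinematic formulas.) Let n ≥ 1 and let G be a closed subgroup of O(n) acting transitively on the unit sphere S^{n−1}; let γ be the Haar probability measure on G. Let φ ∈ Val^G. Then there exist finitely many valuations ψ_1, …, ψ_N, ρ_1, …, ρ_N ∈ Val^G such that for all nonempty compact convex K, L ⊆ ℝⁿ: ∫_G φ(K + gL) dγ(g) = Σ_{i=1}^{N} ψ_i(K) ρ_i(L), where K + gL denotes the Minkowski sum. -/

import Mathlib

open MeasureTheory Pointwise
open scoped NNReal ENNReal

noncomputable section

/-- Euclidean `n`-space `ℝⁿ`. -/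
abbrev Eucl (n : ℕ) : Type := EuclideanSpace ℝ (Fin n)

section Generic

variable {V : Type*} [NormedAddCommGroup V] [NormedSpace ℝ V]

/-- `μ` is a valuation: whenever the union of two convex bodies `K`, `L` is again a convex
body `M` (with intersection the convex body `I`), one has `μ M + μ I = μ K + μ L`. -/
def IsValuation (μ : ConvexBody V → ℝ) : Prop :=
  ∀ K L M I : ConvexBody V,
    (M : Set V) = (K : Set V) ∪ (L : Set V) → (I : Set V) = (K : Set V) ∩ (L : Set V) →
      μ M + μ I = μ K + μ L

/-- The translate `K + x` of a convex body. -/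
def ConvexBody.translate (K : ConvexBody V) (x : V) : ConvexBody V :=
  ⟨(K : Set V) + {x}, K.convex.add (convex_singleton x),
    K.isCompact.add isCompact_singleton, K.nonempty.add (Set.singleton_nonempty x)⟩

/-- Translation invariance of a valuation. -/
def TransInv (μ : ConvexBody V → ℝ) : Prop :=
  ∀ (K : ConvexBody V) (x : V), μ (K.translate x) = μ K

/-- The dilate `t • K` of a convex body. -/
def ConvexBody.dilate (t : ℝ) (K : ConvexBody V) : ConvexBody V :=
  ⟨t • (K : Set V), K.convex.smul t, K.isCompact.smul t, K.nonempty.smul_set⟩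

/-- Homogeneity of degree `k` of a valuation: `μ (t • K) = t ^ k * μ K` for `t > 0`. -/
def Homog (k : ℕ) (μ : ConvexBody V → ℝ) : Prop :=
  ∀ (K : ConvexBody V) (t : ℝ), 0 < t → μ (ConvexBody.dilate t K) = t ^ k * μ K

/-- The reflection `-K` of a convex body. -/
def ConvexBody.reflect (K : ConvexBody V) : ConvexBody V :=
  ⟨-(K : Set V), K.convex.neg, K.isCompact.neg, K.nonempty.neg⟩

/-- Even valuations: `μ (-K) = μ K`. -/
def EvenVal (μ : ConvexBody V → ℝ) : Prop := ∀ K : ConvexBody V, μ K.reflect = μ K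

/-- Odd valuations: `μ (-K) = -μ K`. -/
def OddVal (μ : ConvexBody V → ℝ) : Prop := ∀ K : ConvexBody V, μ K.reflect = -μ K

end Generic

/-- The image of a convex body under the linear map of `ℝⁿ` given by a real `n × n` matrix. -/
def matBody {n : ℕ} (A : Matrix (Fin n) (Fin n) ℝ) (K : ConvexBody (Eucl n)) :
    ConvexBody (Eucl n) :=
  ⟨Matrix.toEuclideanLin A '' (K : Set (Eucl n)),
    K.convex.linear_image (Matrix.toEuclideanLin A),
    K.isCompact.image (Matrix.toEuclideanLin A).continuous_of_finiteDimensional,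
    K.nonempty.image _⟩

/-- The space of real `n × n` matrices, as a (measurable, topological) function space. -/
abbrev Mat (n : ℕ) : Type := Fin n → Fin n → ℝ

/-- `A` is an orthogonal matrix. -/
def IsOrth {n : ℕ} (A : Mat n) : Prop := Matrix.of A ∈ Matrix.orthogonalGroup (Fin n) ℝ

/-- `γ` is the Haar probability measure of the orthogonal group `O(n)`: a probability
measure concentrated on the orthogonal matrices which is invariant under left translation
by orthogonal matrices. -/
def IsHaarOrth {n : ℕ} (γ : Measure (Mat n)) : Prop :=
  IsProbabilityMeasure γ ∧ γ {A : Mat n | ¬ IsOrth A} = 0 ∧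
    ∀ B : Mat n, IsOrth B →
      Measure.map (fun A : Mat n => Matrix.of.symm (Matrix.of B * Matrix.of A)) γ = γ

/-- `G` is a closed subgroup of the orthogonal group `O(n)` (a set of orthogonal matrices
containing the identity, closed under multiplication and inverse, and topologically
closed). -/
def IsClosedSubgroupO {n : ℕ} (G : Set (Matrix (Fin n) (Fin n) ℝ)) : Prop :=
  (∀ A ∈ G, A ∈ Matrix.orthogonalGroup (Fin n) ℝ) ∧ (1 : Matrix (Fin n) (Fin n) ℝ) ∈ G ∧
    (∀ A ∈ G, ∀ B ∈ G, A * B ∈ G) ∧ (∀ A ∈ G, A⁻¹ ∈ G) ∧ IsClosed G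

/-- `G` acts transitively on the unit sphere of `ℝⁿ`. -/
def ActsTransitively {n : ℕ} (G : Set (Matrix (Fin n) (Fin n) ℝ)) : Prop :=
  ∀ u v : Eucl n, ‖u‖ = 1 → ‖v‖ = 1 → ∃ A ∈ G, Matrix.toEuclideanLin A u = v

/-- Invariance of a valuation under the subgroup `G`. -/
def GInv {n : ℕ} (G : Set (Matrix (Fin n) (Fin n) ℝ)) (μ : ConvexBody (Eucl n) → ℝ) : Prop :=
  ∀ A ∈ G, ∀ K : ConvexBody (Eucl n), μ (matBody A K) = μ K

open scoped Classical in
/-- The extension of a valuation on convex bodies to arbitrary sets: on sets which are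
convex bodies it agrees with `φ`, and elsewhere (in particular on `∅`) it is `0`. -/
def extendVal {n : ℕ} (φ : ConvexBody (Eucl n) → ℝ) (S : Set (Eucl n)) : ℝ :=
  if h : ∃ B : ConvexBody (Eucl n), (B : Set (Eucl n)) = S then φ h.choose else 0


section Bodies

variable {V : Type*} [NormedAddCommGroup V] [NormedSpace ℝ V]
variable {F : Type*} [NormedAddCommGroup F] [NormedSpace ℝ F]

theorem ConvexBody.exists_dist_le (K L : ConvexBody V) {x : V} (hx : x ∈ K) :
    ∃ y ∈ L, dist x y ≤ dist K L := by
  obtain ⟨y, hy, h⟩ := L.isCompact.exists_infDist_eq_dist L.nonempty x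
  refine ⟨y, hy, ?_⟩
  rw [← h, ← ConvexBody.hausdorffDist_coe]
  exact Metric.infDist_le_hausdorffDist_of_mem hx ConvexBody.hausdorffEDist_ne_top

theorem ConvexBody.dist_le_of (K L : ConvexBody V) {r : ℝ} (hr : 0 ≤ r)
    (h₁ : ∀ x ∈ K, ∃ y ∈ L, dist x y ≤ r) (h₂ : ∀ x ∈ L, ∃ y ∈ K, dist x y ≤ r) :
    dist K L ≤ r := by
  rw [← ConvexBody.hausdorffDist_coe]
  exact Metric.hausdorffDist_le_of_mem_dist hr h₁ h₂

/-- The convex body `{x}`. -/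
def ConvexBody.point (x : V) : ConvexBody V :=
  ⟨{x}, convex_singleton x, isCompact_singleton, Set.singleton_nonempty x⟩

theorem ConvexBody.coe_point (x : V) : (ConvexBody.point x : Set V) = {x} := rfl

theorem ConvexBody.mem_point {x y : V} : y ∈ ConvexBody.point x ↔ y = x := Iff.rfl

theorem ConvexBody.point_zero : ConvexBody.point (0 : V) = 0 :=
  ConvexBody.ext (by rw [ConvexBody.coe_point, ConvexBody.coe_zero]; rfl)

theorem ConvexBody.translate_eq (K : ConvexBody V) (x : V) :
    K.translate x = K + ConvexBody.point x :=
  ConvexBody.ext (by rw [ConvexBody.coe_add]; rfl)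

theorem ConvexBody.mem_add {K L : ConvexBody V} {x : V} :
    x ∈ K + L ↔ ∃ y ∈ K, ∃ z ∈ L, y + z = x := by
  rw [← SetLike.mem_coe, ConvexBody.coe_add, Set.mem_add]; rfl

theorem ConvexBody.mem_smul {K : ConvexBody V} {t : ℝ} {x : V} :
    x ∈ t • K ↔ ∃ y ∈ K, t • y = x := by
  rw [← SetLike.mem_coe, ConvexBody.coe_smul, Set.mem_smul_set]; rfl

theorem ConvexBody.add_smul_of_nonneg (K : ConvexBody V) {s t : ℝ} (hs : 0 ≤ s) (ht : 0 ≤ t) :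
    (s + t) • K = s • K + t • K :=
  ConvexBody.ext (by
    rw [ConvexBody.coe_add]
    simp only [ConvexBody.coe_smul]
    exact K.convex.add_smul hs ht)

/-- The image of a convex body under a continuous linear map. -/
def ConvexBody.map (T : F →L[ℝ] V) (X : ConvexBody F) : ConvexBody V :=
  ⟨T '' X, X.convex.linear_image T.toLinearMap, X.isCompact.image T.continuous,
    X.nonempty.image T⟩

theorem ConvexBody.mem_map {T : F →L[ℝ] V} {X : ConvexBody F} {y : V} :
    y ∈ X.map T ↔ ∃ x ∈ X, T x = y := Iff.rfl

theorem ConvexBody.map_add (T : F →L[ℝ] V) (X Y : ConvexBody F) :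
    (X + Y).map T = X.map T + Y.map T := by
  apply ConvexBody.ext
  rw [ConvexBody.coe_add]
  change T '' ((X + Y : ConvexBody F) : Set F) = T '' X + T '' Y
  rw [ConvexBody.coe_add, Set.image_add]

theorem ConvexBody.map_smul (T : F →L[ℝ] V) (t : ℝ) (X : ConvexBody F) :
    (t • X).map T = t • X.map T := by
  apply ConvexBody.ext
  rw [ConvexBody.coe_smul]
  change T '' ((t • X : ConvexBody F) : Set F) = t • (T '' X)
  rw [ConvexBody.coe_smul]
  exact image_smul_set T t X

theorem ConvexBody.map_point (T : F →L[ℝ] V) (x : F) :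
    (ConvexBody.point x).map T = ConvexBody.point (T x) :=
  ConvexBody.ext (Set.image_singleton)

theorem ConvexBody.point_add (x y : V) :
    ConvexBody.point (x + y) = ConvexBody.point x + ConvexBody.point y :=
  ConvexBody.ext (by rw [ConvexBody.coe_add]; exact Set.singleton_add_singleton.symm)

theorem ConvexBody.smul_point (t : ℝ) (x : V) :
    t • ConvexBody.point x = ConvexBody.point (t • x) :=
  ConvexBody.ext (by rw [ConvexBody.coe_smul]; exact Set.smul_set_singleton)

theorem ConvexBody.dist_map_le (T : F →L[ℝ] V) (X Y : ConvexBody F) :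
    dist (X.map T) (Y.map T) ≤ ‖T‖ * dist X Y := by
  have key : ∀ X Y : ConvexBody F, ∀ x ∈ X.map T, ∃ y ∈ Y.map T, dist x y ≤ ‖T‖ * dist X Y := by
    rintro X Y _ ⟨x, hx, rfl⟩
    obtain ⟨y, hy, h⟩ := X.exists_dist_le Y hx
    refine ⟨T y, ⟨y, hy, rfl⟩, ?_⟩
    rw [dist_eq_norm, ← _root_.map_sub]
    refine (T.le_opNorm _).trans ?_
    rw [← dist_eq_norm]
    gcongr
  refine ConvexBody.dist_le_of _ _ (by positivity) (key X Y) ?_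
  rw [dist_comm X Y]
  exact key Y X

theorem ConvexBody.dist_add_add_le (K L K' L' : ConvexBody V) :
    dist (K + L) (K' + L') ≤ dist K K' + dist L L' := by
  have key : ∀ K L K' L' : ConvexBody V, ∀ x ∈ K + L, ∃ y ∈ K' + L',
      dist x y ≤ dist K K' + dist L L' := by
    intro K L K' L' x hx
    obtain ⟨a, ha, b, hb, rfl⟩ := ConvexBody.mem_add.1 hx
    obtain ⟨a', ha', h⟩ := K.exists_dist_le K' ha
    obtain ⟨b', hb', h'⟩ := L.exists_dist_le L' hb
    exact ⟨a' + b', ConvexBody.mem_add.2 ⟨a', ha', b', hb', rfl⟩,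
      (_root_.dist_add_add_le _ _ _ _).trans (add_le_add h h')⟩
  refine ConvexBody.dist_le_of _ _ (by positivity) (key _ _ _ _) ?_
  rw [dist_comm K, dist_comm L]
  exact key _ _ _ _

instance ConvexBody.instContinuousAdd : ContinuousAdd (ConvexBody V) := by
  refine ⟨continuous_iff_continuousAt.2 fun p => ?_⟩
  rw [Metric.continuousAt_iff]
  intro ε hε
  refine ⟨ε / 2, by positivity, fun {q} hq => ?_⟩
  rw [Prod.dist_eq, max_lt_iff] at hq
  exact (ConvexBody.dist_add_add_le _ _ _ _).trans_lt (by linarith)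

theorem ConvexBody.dist_smul_le (t : ℝ) (K L : ConvexBody V) :
    dist (t • K) (t • L) ≤ |t| * dist K L := by
  have key : ∀ K L : ConvexBody V, ∀ x ∈ t • K, ∃ y ∈ t • L, dist x y ≤ |t| * dist K L := by
    intro K L x hx
    obtain ⟨a, ha, rfl⟩ := ConvexBody.mem_smul.1 hx
    obtain ⟨b, hb, h⟩ := K.exists_dist_le L ha
    refine ⟨t • b, ConvexBody.mem_smul.2 ⟨b, hb, rfl⟩, ?_⟩
    rw [dist_smul₀, Real.norm_eq_abs]
    gcongr
  refine ConvexBody.dist_le_of _ _ (by positivity) (key _ _) ?_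
  rw [dist_comm K]
  exact key _ _

/-- `K` lies in the closed ball of radius `R` about the origin. -/
def ConvexBody.InBall (K : ConvexBody V) (R : ℝ) : Prop := ∀ x ∈ K, ‖x‖ ≤ R

theorem ConvexBody.exists_inBall (K : ConvexBody V) : ∃ R, 0 < R ∧ K.InBall R := by
  obtain ⟨R, hR⟩ := K.isBounded.exists_norm_le
  exact ⟨max R 1, by positivity, fun x hx => (hR x hx).trans (le_max_left _ _)⟩

theorem ConvexBody.InBall.nonneg {K : ConvexBody V} {R : ℝ} (h : K.InBall R) : 0 ≤ R := by
  obtain ⟨x, hx⟩ := K.nonempty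
  exact (norm_nonneg x).trans (h x hx)

theorem ConvexBody.InBall.mono {K : ConvexBody V} {R R' : ℝ} (h : K.InBall R) (hR : R ≤ R') :
    K.InBall R' := fun x hx => (h x hx).trans hR

theorem ConvexBody.InBall.add {K L : ConvexBody V} {R R' : ℝ} (h : K.InBall R)
    (h' : L.InBall R') : (K + L).InBall (R + R') := by
  intro x hx
  obtain ⟨a, ha, b, hb, rfl⟩ := ConvexBody.mem_add.1 hx
  exact (norm_add_le _ _).trans (add_le_add (h a ha) (h' b hb))

theorem ConvexBody.InBall.smul {K : ConvexBody V} {R t : ℝ} (h : K.InBall R) (ht : 0 ≤ t) :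
    (t • K).InBall (t * R) := by
  intro x hx
  obtain ⟨a, ha, rfl⟩ := ConvexBody.mem_smul.1 hx
  rw [norm_smul, Real.norm_of_nonneg ht]
  exact mul_le_mul_of_nonneg_left (h a ha) ht

theorem ConvexBody.inBall_of_dist {K L : ConvexBody V} {R r : ℝ} (h : K.InBall R)
    (h' : dist L K ≤ r) : L.InBall (R + r) := by
  intro x hx
  obtain ⟨y, hy, hxy⟩ := L.exists_dist_le K hx
  have := norm_le_norm_add_norm_sub' x y
  rw [← dist_eq_norm] at this
  linarith [h y hy]

theorem ConvexBody.dist_smul_smul_le {K : ConvexBody V} {R : ℝ} (h : K.InBall R) (s t : ℝ) :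
    dist (s • K) (t • K) ≤ |s - t| * R := by
  have key : ∀ s t : ℝ, ∀ x ∈ s • K, ∃ y ∈ t • K, dist x y ≤ |s - t| * R := by
    intro s t x hx
    obtain ⟨a, ha, rfl⟩ := ConvexBody.mem_smul.1 hx
    refine ⟨t • a, ConvexBody.mem_smul.2 ⟨a, ha, rfl⟩, ?_⟩
    rw [dist_eq_norm, ← sub_smul, norm_smul, Real.norm_eq_abs]
    exact mul_le_mul_of_nonneg_left (h a ha) (abs_nonneg _)
  refine ConvexBody.dist_le_of _ _ (mul_nonneg (abs_nonneg _) h.nonneg) (key _ _) ?_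
  rw [abs_sub_comm]
  exact key _ _

instance ConvexBody.instContinuousSMul : ContinuousSMul ℝ (ConvexBody V) := by
  refine ⟨continuous_iff_continuousAt.2 fun ⟨t, K⟩ => ?_⟩
  obtain ⟨R, hR, hK⟩ := K.exists_inBall
  rw [ContinuousAt, tendsto_iff_dist_tendsto_zero]
  have hlim : Filter.Tendsto (fun p : ℝ × ConvexBody V => |p.1| * dist p.2 K + |p.1 - t| * R)
      (nhds (t, K)) (nhds 0) := by
    have : Continuous fun p : ℝ × ConvexBody V => |p.1| * dist p.2 K + |p.1 - t| * R := by
      fun_prop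
    simpa using this.tendsto (t, K)
  refine squeeze_zero (fun _ => dist_nonneg) (fun p => ?_) hlim
  exact (dist_triangle _ (p.1 • K) _).trans
    (add_le_add (ConvexBody.dist_smul_le _ _ _) (ConvexBody.dist_smul_smul_le hK _ _))

theorem ConvexBody.continuous_map (T : F →L[ℝ] V) :
    Continuous (fun X : ConvexBody F => X.map T) := by
  refine (LipschitzWith.of_dist_le_mul (K := ‖T‖₊) fun X Y => ?_).continuous
  exact ConvexBody.dist_map_le T X Y

/-- Continuous translation invariant valuations. -/
structure IsVal (φ : ConvexBody V → ℝ) : Prop where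
  val : IsValuation φ
  cont : Continuous φ
  trans : TransInv φ

theorem IsVal.add_point {φ : ConvexBody V → ℝ} (h : IsVal φ) (K : ConvexBody V) (x : V) :
    φ (K + ConvexBody.point x) = φ K := by
  rw [← ConvexBody.translate_eq, h.trans]

theorem IsVal.point_add {φ : ConvexBody V → ℝ} (h : IsVal φ) (K : ConvexBody V) (x : V) :
    φ (ConvexBody.point x + K) = φ K := by
  rw [add_comm, h.add_point]

theorem ConvexBody.coe_add_map (K : ConvexBody V) (T : F →L[ℝ] V) (X : ConvexBody F) :
    ((K + X.map T : ConvexBody V) : Set V) = (K : Set V) + T '' X := by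
  rw [ConvexBody.coe_add]; rfl

theorem IsVal.comp_add_map {φ : ConvexBody V → ℝ} (h : IsVal φ) (K : ConvexBody V)
    (T : F →L[ℝ] V) : IsVal fun X : ConvexBody F => φ (K + X.map T) where
  val := by
    intro X Y M I hM hI
    apply h.val
    · rw [ConvexBody.coe_add_map, ConvexBody.coe_add_map, ConvexBody.coe_add_map, hM,
        Set.image_union, Set.add_union]
    · simp only [ConvexBody.coe_add_map]
      refine Set.Subset.antisymm ?_ ?_
      · rw [hI]
        exact Set.subset_inter (Set.add_subset_add_left (Set.image_mono Set.inter_subset_left))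
          (Set.add_subset_add_left (Set.image_mono Set.inter_subset_right))
      · rintro z ⟨⟨k, hk, _, ⟨x, hx, rfl⟩, rfl⟩, ⟨k', hk', _, ⟨y, hy, rfl⟩, hz⟩⟩
        simp only at hz
        have hpre : IsPreconnected (segment ℝ x y) := (convex_segment x y).isPreconnected
        have hsub : segment ℝ x y ⊆ (X : Set F) ∪ Y := by
          rw [← hM]
          refine M.convex.segment_subset ?_ ?_
          · rw [hM]; exact Or.inl hx
          · rw [hM]; exact Or.inr hy
        obtain ⟨w, ⟨a, b, ha, hb, hab, rfl⟩, hw⟩ := isPreconnected_closed_iff.1 hpre X Y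
          X.isClosed Y.isClosed hsub ⟨x, left_mem_segment ℝ x y, hx⟩
          ⟨y, right_mem_segment ℝ x y, hy⟩
        refine ⟨a • k + b • k', K.convex hk hk' ha hb hab, T (a • x + b • y),
          ⟨_, by rw [hI]; exact hw, rfl⟩, ?_⟩
        have : k + T x = a • (k + T x) + b • (k' + T y) := by
          rw [hz, ← add_smul, hab, one_smul]
        simp only [_root_.map_add, _root_.map_smul]
        rw [this, smul_add, smul_add]
        abel
  cont := h.cont.comp (continuous_const.add (ConvexBody.continuous_map T))
  trans := by
    intro X x
    simp only [ConvexBody.translate_eq, ConvexBody.map_add, ConvexBody.map_point, ← add_assoc,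
      h.add_point]

theorem ConvexBody.map_id (X : ConvexBody V) : X.map (ContinuousLinearMap.id ℝ V) = X :=
  ConvexBody.ext (Set.image_id _)

theorem IsVal.comp_add {φ : ConvexBody V → ℝ} (h : IsVal φ) (K : ConvexBody V) :
    IsVal fun X => φ (K + X) := by
  simpa only [ConvexBody.map_id] using h.comp_add_map K (ContinuousLinearMap.id ℝ V)

theorem IsVal.comp_map {φ : ConvexBody V → ℝ} (h : IsVal φ) (T : F →L[ℝ] V) :
    IsVal fun X : ConvexBody F => φ (X.map T) := by
  simpa only [zero_add] using h.comp_add_map 0 T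

theorem IsVal.zero : IsVal (0 : ConvexBody V → ℝ) :=
  ⟨fun _ _ _ _ _ _ => by simp, continuous_const, fun _ _ => rfl⟩

theorem IsVal.const (c : ℝ) : IsVal (fun _ : ConvexBody V => c) :=
  ⟨fun _ _ _ _ _ _ => rfl, continuous_const, fun _ _ => rfl⟩

theorem IsVal.add {φ ψ : ConvexBody V → ℝ} (h : IsVal φ) (h' : IsVal ψ) : IsVal (φ + ψ) where
  val K L M I hM hI := by
    have := h.val K L M I hM hI
    have := h'.val K L M I hM hI
    simp only [Pi.add_apply]; linarith
  cont := h.cont.add h'.cont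
  trans K x := by simp only [Pi.add_apply, h.trans K x, h'.trans K x]

theorem IsVal.smul {φ : ConvexBody V → ℝ} (h : IsVal φ) (c : ℝ) : IsVal (c • φ) where
  val K L M I hM hI := by
    have := h.val K L M I hM hI
    simp only [Pi.smul_apply, smul_eq_mul, ← mul_add, this]
  cont := h.cont.const_smul c
  trans K x := by simp only [Pi.smul_apply, h.trans K x]

/-- The difference operator `φ ↦ φ (· + L) - φ`. -/
def diffOp (L : ConvexBody V) (φ : ConvexBody V → ℝ) : ConvexBody V → ℝ :=
  fun K => φ (K + L) - φ K

theorem IsVal.diffOp {φ : ConvexBody V → ℝ} (h : IsVal φ) (L : ConvexBody V) :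
    IsVal (diffOp L φ) := by
  have : _root_.diffOp L φ = (fun X => φ (L + X)) + (-1 : ℝ) • φ := by
    funext K
    simp [_root_.diffOp, add_comm, sub_eq_add_neg]
  rw [this]
  exact (h.comp_add L).add (h.smul _)

/-- The intersection of a convex body with a closed convex set which it meets. -/
def ConvexBody.cut (K : ConvexBody V) (C : Set V) (hC : Convex ℝ C) (hc : IsClosed C)
    (hne : ((K : Set V) ∩ C).Nonempty) : ConvexBody V :=
  ⟨(K : Set V) ∩ C, K.convex.inter hC, K.isCompact.inter_right hc, hne⟩

theorem IsVal.eq_of_union {φ : ConvexBody V → ℝ} (h : IsVal φ) {A B M I : ConvexBody V}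
    (hM : (M : Set V) = (A : Set V) ∪ B) (hI : (I : Set V) = (A : Set V) ∩ B) : φ M = φ A + φ B - φ I := by
  linarith [h.val A B M I hM hI]

end Bodies

section Growth

variable {V : Type*} [NormedAddCommGroup V] [NormedSpace ℝ V]

theorem IsVal.exists_cut {φ : ConvexBody V → ℝ} (h : IsVal φ) (K : ConvexBody V)
    (l : V →L[ℝ] ℝ) (c : ℝ) (h₁ : ∃ x ∈ K, l x ≤ c) (h₂ : ∃ x ∈ K, c ≤ l x) :
    ∃ A B I : ConvexBody V, (A : Set V) = (K : Set V) ∩ {x | l x ≤ c} ∧ (B : Set V) = (K : Set V) ∩ {x | c ≤ l x} ∧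
      (I : Set V) = (K : Set V) ∩ {x | l x = c} ∧ φ K = φ A + φ B - φ I := by
  obtain ⟨x, hx, hxc⟩ := h₁
  obtain ⟨y, hy, hyc⟩ := h₂
  obtain ⟨z, hz, hzc⟩ := K.convex.isPreconnected.intermediate_value hx hy
    l.continuous.continuousOn ⟨hxc, hyc⟩
  have hle : Convex ℝ {x | l x ≤ c} := convex_halfSpace_le l.toLinearMap.isLinear c
  have hge : Convex ℝ {x | c ≤ l x} := convex_halfSpace_ge l.toLinearMap.isLinear c
  have heq : Convex ℝ {x | l x = c} := convex_hyperplane l.toLinearMap.isLinear c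
  refine ⟨K.cut _ hle (isClosed_le l.continuous continuous_const) ⟨x, hx, hxc⟩,
    K.cut _ hge (isClosed_le continuous_const l.continuous) ⟨y, hy, hyc⟩,
    K.cut _ heq (isClosed_eq l.continuous continuous_const) ⟨z, hz, hzc⟩, rfl, rfl, rfl,
    h.eq_of_union ?_ ?_⟩
  · ext w
    change w ∈ K ↔ (w ∈ K ∧ l w ≤ c) ∨ (w ∈ K ∧ c ≤ l w)
    rw [← and_or_left]
    exact (and_iff_left (le_total _ _)).symm
  · ext w
    change (w ∈ K ∧ l w = c) ↔ (w ∈ K ∧ l w ≤ c) ∧ (w ∈ K ∧ c ≤ l w)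
    rw [← and_and_left, le_antisymm_iff]

theorem IsVal.abs_le_of_slab {φ : ConvexBody V → ℝ} (h : IsVal φ) (P : ConvexBody V → Prop)
    (hP : ∀ K L : ConvexBody V, (K : Set V) ⊆ L → P L → P K) (l : V →L[ℝ] ℝ) {B ε : ℝ}
    (hε : 0 ≤ ε)
    (hB : ∀ K, P K → (∃ c, ∀ x ∈ K, c ≤ l x ∧ l x ≤ c + ε) → |φ K| ≤ B) (N : ℕ) :
    ∀ K, P K → (∃ c, ∀ x ∈ K, c ≤ l x ∧ l x ≤ c + N * ε) → |φ K| ≤ (2 * N + 1) * B := by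
  induction N with
  | zero =>
    rintro K hK ⟨c, hc⟩
    have := hB K hK ⟨c, fun x hx => ⟨(hc x hx).1, by have := (hc x hx).2; simp at this; linarith⟩⟩
    simpa using this
  | succ N ih =>
    rintro K hK ⟨c, hc⟩
    have hB0 : 0 ≤ B := by
      obtain ⟨x, hx⟩ := K.nonempty
      refine (abs_nonneg _).trans (hB (ConvexBody.point x) (hP _ K ?_ hK) ⟨l x, ?_⟩)
      · rw [ConvexBody.coe_point]; simpa using hx
      · intro y hy
        rw [ConvexBody.mem_point] at hy
        subst hy
        exact ⟨le_rfl, by linarith⟩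
    push_cast at hc ⊢
    by_cases h₁ : ∃ x ∈ K, l x ≤ c + N * ε
    · by_cases h₂ : ∃ x ∈ K, c + N * ε ≤ l x
      · obtain ⟨A, D, I, hA, hD, hI, he⟩ := h.exists_cut K l _ h₁ h₂
        have hA' : ∀ x ∈ A, x ∈ K ∧ l x ≤ c + N * ε := fun x hx => by
          rw [← SetLike.mem_coe, hA] at hx; exact hx
        have hD' : ∀ x ∈ D, x ∈ K ∧ c + N * ε ≤ l x := fun x hx => by
          rw [← SetLike.mem_coe, hD] at hx; exact hx
        have hI' : ∀ x ∈ I, x ∈ K ∧ l x = c + N * ε := fun x hx => by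
          rw [← SetLike.mem_coe, hI] at hx; exact hx
        have b₁ := ih A (hP _ K (fun x hx => (hA' x hx).1) hK)
          ⟨c, fun x hx => ⟨(hc x (hA' x hx).1).1, (hA' x hx).2⟩⟩
        have b₂ := hB D (hP _ K (fun x hx => (hD' x hx).1) hK)
          ⟨c + N * ε, fun x hx => ⟨(hD' x hx).2, by have := (hc x (hD' x hx).1).2; linarith⟩⟩
        have b₃ := hB I (hP _ K (fun x hx => (hI' x hx).1) hK)
          ⟨c + N * ε, fun x hx => ⟨(hI' x hx).2.ge, by rw [(hI' x hx).2]; linarith⟩⟩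
        rw [he]
        rw [abs_le] at *
        constructor <;> linarith [b₁.1, b₁.2, b₂.1, b₂.2, b₃.1, b₃.2]
      · push Not at h₂
        have := ih K hK ⟨c, fun x hx => ⟨(hc x hx).1, (h₂ x hx).le⟩⟩
        linarith
    · push Not at h₁
      have := hB K hK ⟨c + N * ε, fun x hx => ⟨(h₁ x hx).le, by have := (hc x hx).2; linarith⟩⟩
      nlinarith [mul_nonneg (Nat.cast_nonneg (α := ℝ) N) hB0]

theorem IsVal.exists_growth {n : ℕ} {φ : ConvexBody (Eucl n) → ℝ} (h : IsVal φ) :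
    ∃ C, 0 ≤ C ∧ ∀ (R : ℝ) (K : ConvexBody (Eucl n)), 0 ≤ R → K.InBall R →
      |φ K| ≤ C * (1 + R) ^ n := by
  obtain ⟨δ, hδ, hφ⟩ := Metric.continuous_iff.1 h.cont 0 1 one_pos
  set ε : ℝ := δ / 2 / (n + 1) with hε
  have hε0 : 0 < ε := by positivity
  set B : ℝ := |φ 0| + 1 with hB
  have small : ∀ K : ConvexBody (Eucl n),
      (∀ i : Fin n, ∃ c, ∀ x ∈ K, c ≤ x i ∧ x i ≤ c + ε) → |φ K| ≤ B := by
    intro K hK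
    obtain ⟨x, hx⟩ := K.nonempty
    rw [← h.add_point K (-x)]
    have hin : (K + ConvexBody.point (-x)).InBall (n * ε) := by
      intro y hy
      obtain ⟨a, ha, b, hb, rfl⟩ := ConvexBody.mem_add.1 hy
      rw [ConvexBody.mem_point] at hb
      subst hb
      rw [← (EuclideanSpace.basisFun (Fin n) ℝ).sum_repr (a + -x)]
      refine (norm_sum_le _ _).trans ?_
      refine (Finset.sum_le_card_nsmul _ _ ε fun i _ => ?_).trans (by simp)
      rw [norm_smul, OrthonormalBasis.norm_eq_one, mul_one]
      obtain ⟨c, hc⟩ := hK i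
      have h1 := hc a ha
      have h2 := hc x hx
      simp only [EuclideanSpace.basisFun_repr, PiLp.add_apply, PiLp.neg_apply, Real.norm_eq_abs]
      rw [abs_le]
      constructor <;> linarith [h1.1, h1.2, h2.1, h2.2]
    have hd : dist (K + ConvexBody.point (-x)) 0 < δ := by
      have h1 : (n : ℝ) * ε ≤ δ / 2 := by
        rw [hε, mul_div_assoc', div_le_iff₀ (by positivity)]
        nlinarith
      refine lt_of_le_of_lt (b := δ / 2) (ConvexBody.dist_le_of _ _ (by positivity) ?_ ?_)
        (by linarith)
      · intro y hy
        exact ⟨0, ConvexBody.mem_point.2 rfl, by rw [dist_zero_right]; linarith [hin y hy]⟩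
      · intro y hy
        have : y = 0 := hy
        subst this
        refine ⟨0, ConvexBody.mem_add.2 ⟨x, hx, -x, ConvexBody.mem_point.2 rfl, by simp⟩, ?_⟩
        simp; positivity
    have := hφ _ hd
    rw [Real.dist_eq] at this
    have h2 := abs_sub_abs_le_abs_sub (φ (K + ConvexBody.point (-x))) (φ 0)
    linarith
  have main : ∀ (R : ℝ) (N : ℕ), 2 * R ≤ N * ε → ∀ s : Finset (Fin n),
      ∀ K : ConvexBody (Eucl n), (K.InBall R ∧
      ∀ i ∉ s, ∃ c, ∀ x ∈ K, c ≤ x i ∧ x i ≤ c + ε) → |φ K| ≤ (2 * N + 1) ^ s.card * B := by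
    intro R N hN s
    induction s using Finset.induction_on with
    | empty =>
      intro K hK
      simpa using small K fun i => hK.2 i (Finset.notMem_empty i)
    | insert i s hi ih =>
      intro K hK
      rw [Finset.card_insert_of_notMem hi, pow_succ', mul_assoc]
      refine h.abs_le_of_slab (fun K : ConvexBody (Eucl n) => K.InBall R ∧
        ∀ j ∉ insert i s, ∃ c, ∀ x ∈ K, c ≤ x j ∧ x j ≤ c + ε) ?_
        (EuclideanSpace.proj i) hε0.le ?_ N K hK ⟨-R, ?_⟩
      · intro K L hKL hL
        refine ⟨fun x hx => hL.1 x (hKL hx), fun j hj => ?_⟩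
        obtain ⟨c, hc⟩ := hL.2 j hj
        exact ⟨c, fun x hx => hc x (hKL hx)⟩
      · intro K hK hc
        refine ih K ⟨hK.1, fun j hj => ?_⟩
        by_cases hji : j = i
        · subst hji; exact hc
        · exact hK.2 j (by simp [hji, hj])
      · intro x hx
        have h1 := (PiLp.norm_apply_le x i).trans (hK.1 x hx)
        rw [Real.norm_eq_abs, abs_le] at h1
        change -R ≤ x i ∧ x i ≤ -R + N * ε
        constructor <;> linarith
  refine ⟨(4 / ε + 3) ^ n * B, by positivity, fun R K hR hK => ?_⟩
  have hN := Nat.le_ceil (2 * R / ε)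
  have hN' := (Nat.ceil_lt_add_one (a := 2 * R / ε) (by positivity)).le
  have := main R ⌈2 * R / ε⌉₊ ((div_le_iff₀ hε0).1 hN) Finset.univ K
    ⟨hK, fun i hi => absurd (Finset.mem_univ i) hi⟩
  rw [Finset.card_univ, Fintype.card_fin] at this
  refine this.trans ?_
  rw [mul_right_comm, ← mul_pow]
  have h3 : 2 * (⌈2 * R / ε⌉₊ : ℝ) + 1 ≤ (4 / ε + 3) * (1 + R) := by
    have e1 : 2 * R / ε = 2 / ε * R := by ring
    have e2 : 4 / ε = 2 * (2 / ε) := by ring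
    have : 0 < 2 / ε := by positivity
    rw [e2]
    nlinarith
  gcongr

end Growth

section Polynomiality

open Polynomial in
theorem Polynomial.exists_eval_add_one_sub_eval (Q : ℝ[X]) :
    ∃ P : ℝ[X], ∀ t, P.eval (t + 1) - P.eval t = Q.eval t := by
  induction Q using Polynomial.induction_on' with
  | add p q hp hq =>
    obtain ⟨P, hP⟩ := hp
    obtain ⟨P', hP'⟩ := hq
    refine ⟨P + P', fun t => ?_⟩
    rw [eval_add, eval_add, eval_add, ← hP, ← hP']
    ring
  | monomial k a =>
    refine ⟨C (a / (k + 1)) * (Polynomial.bernoulli (k + 1)).map (algebraMap ℚ ℝ), fun t => ?_⟩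
    have h := congrArg (fun p : ℚ[X] => (p.map (algebraMap ℚ ℝ)).eval t)
      (Polynomial.bernoulli_comp_one_add_X (k + 1))
    simp only [map_comp, Polynomial.map_add, eval_comp, eval_add, Polynomial.map_one, map_X,
      eval_one, eval_X, Polynomial.map_pow, eval_pow,
      add_tsub_cancel_right, nsmul_eq_mul, Polynomial.map_mul, eval_mul,
      Polynomial.map_natCast, eval_natCast] at h
    simp only [eval_mul, eval_C]
    rw [eval_monomial, add_comm t 1, h]
    have : (k : ℝ) + 1 ≠ 0 := by positivity
    push_cast
    field_simp
    ring

/-- `q` agrees with a polynomial on `[0, ∞)`. -/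
def PolyOn (q : ℝ → ℝ) : Prop := ∃ p : Polynomial ℝ, ∀ t, 0 ≤ t → q t = p.eval t

theorem PolyOn.congr {q q' : ℝ → ℝ} (h : PolyOn q) (hq : ∀ t, 0 ≤ t → q' t = q t) :
    PolyOn q' := by
  obtain ⟨p, hp⟩ := h
  exact ⟨p, fun t ht => by rw [hq t ht, hp t ht]⟩

theorem PolyOn.add {q q' : ℝ → ℝ} (h : PolyOn q) (h' : PolyOn q') : PolyOn (q + q') := by
  obtain ⟨p, hp⟩ := h
  obtain ⟨p', hp'⟩ := h'
  exact ⟨p + p', fun t ht => by simp [hp t ht, hp' t ht]⟩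

theorem PolyOn.sub {q q' : ℝ → ℝ} (h : PolyOn q) (h' : PolyOn q') : PolyOn (q - q') := by
  obtain ⟨p, hp⟩ := h
  obtain ⟨p', hp'⟩ := h'
  exact ⟨p - p', fun t ht => by simp [hp t ht, hp' t ht]⟩

theorem PolyOn.const (c : ℝ) : PolyOn fun _ => c := ⟨Polynomial.C c, fun t _ => by simp⟩

theorem Polynomial.eval_eq_of_bounded {p : Polynomial ℝ} {B : ℝ}
    (h : ∀ t, 0 ≤ t → |p.eval t| ≤ B) (t : ℝ) : p.eval t = p.eval 0 := by
  by_cases hd : 0 < p.degree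
  · have := (p.abs_tendsto_atTop hd).eventually_gt_atTop B
    obtain ⟨x, hx, hx0⟩ := (this.and (Filter.eventually_ge_atTop 0)).exists
    exact absurd (h x hx0) (not_le.2 hx)
  · rw [Polynomial.eq_C_of_degree_le_zero (not_lt.1 hd)]
    simp

theorem PolyOn.of_differences {q : ℝ → ℝ} (hq : Continuous q)
    (h : ∀ s, 0 ≤ s → PolyOn fun t => q (t + s) - q t) : PolyOn q := by
  obtain ⟨Q, hQ⟩ := h 1 zero_le_one
  obtain ⟨P, hP⟩ := Q.exists_eval_add_one_sub_eval
  set r : ℝ → ℝ := fun t => q t - P.eval t with hr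
  have hrc : Continuous r := hq.sub P.continuous
  have hper : ∀ t, 0 ≤ t → r (t + 1) = r t := fun t ht => by
    have h1 := hQ t ht
    have h2 := hP t
    simp only [hr]
    linarith
  obtain ⟨B, hB⟩ := (isCompact_Icc (a := (0 : ℝ)) (b := 1)).exists_bound_of_continuousOn
    hrc.continuousOn
  have hbd : ∀ t, 0 ≤ t → |r t| ≤ B := by
    have : ∀ (k : ℕ) (t : ℝ), 0 ≤ t → t ≤ 1 + k → |r t| ≤ B := by
      intro k
      induction k with
      | zero => intro t h0 h1; exact hB t ⟨h0, by simpa using h1⟩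
      | succ k ih =>
        intro t h0 h1
        push_cast at h1
        by_cases ht : t ≤ 1
        · exact hB t ⟨h0, ht⟩
        · rw [← sub_add_cancel t 1, hper _ (by linarith)]
          exact ih _ (by linarith) (by linarith)
    intro t ht
    obtain ⟨k, hk⟩ := exists_nat_ge t
    exact this k t ht (by linarith)
  have hconst : ∀ s, 0 ≤ s → r s = r 0 := by
    intro s hs
    obtain ⟨D, hD⟩ := h s hs
    set p : Polynomial ℝ := D - (P.comp (Polynomial.X + Polynomial.C s) - P) with hp
    have hpr : ∀ t, 0 ≤ t → p.eval t = r (t + s) - r t := fun t ht => by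
      simp only [hp, hr, Polynomial.eval_sub, Polynomial.eval_comp, Polynomial.eval_add,
        Polynomial.eval_X, Polynomial.eval_C, ← hD t ht]
      ring
    have hpc := Polynomial.eval_eq_of_bounded (p := p) (B := B + B) fun t ht => by
      rw [hpr t ht]
      exact (abs_sub _ _).trans (add_le_add (hbd _ (by linarith)) (hbd _ ht))
    have hk : ∀ k : ℕ, r (k * s) = r 0 + k * p.eval 0 := by
      intro k
      induction k with
      | zero => simp
      | succ k ih =>
        have h0 : (0 : ℝ) ≤ k * s := by positivity
        have := hpr _ h0
        rw [hpc] at this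
        push_cast
        rw [add_mul, one_mul, add_mul, one_mul]
        linarith
    have hz : p.eval 0 = 0 := by
      by_contra hne
      obtain ⟨k, hk'⟩ := exists_nat_gt ((B + B) / |p.eval 0|)
      rw [div_lt_iff₀ (abs_pos.2 hne)] at hk'
      have h1 : (k : ℝ) * p.eval 0 = r (k * s) - r 0 := by rw [hk]; ring
      have h2 : |(k : ℝ) * p.eval 0| ≤ B + B := by
        rw [h1]
        exact (abs_sub _ _).trans (add_le_add (hbd _ (by positivity)) (hbd _ le_rfl))
      rw [abs_mul, Nat.abs_cast] at h2
      linarith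
    simpa [hz] using hk 1
  refine ⟨P + Polynomial.C (r 0), fun t ht => ?_⟩
  rw [Polynomial.eval_add, Polynomial.eval_C, ← hconst t ht]
  simp [hr]

end Polynomiality

section Chains

variable {m : ℕ}

/-- The simplex of vectors supported on `[i, l)`, nonincreasing there, with entries
in `[0, s]`. -/
def chainSet (m i l : ℕ) (s : ℝ) : Set (Fin m → ℝ) :=
  {x | (∀ k : Fin m, (k : ℕ) < i ∨ l ≤ k → x k = 0) ∧ (∀ k, 0 ≤ x k) ∧ (∀ k, x k ≤ s) ∧
    ∀ j k : Fin m, i ≤ j → j ≤ k → (k : ℕ) < l → x k ≤ x j}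

theorem convex_chainSet (i l : ℕ) (s : ℝ) : Convex ℝ (chainSet m i l s) := by
  intro x hx y hy a b ha hb hab
  obtain ⟨h1, h2, h3, h4⟩ := hx
  obtain ⟨g1, g2, g3, g4⟩ := hy
  refine ⟨fun k hk => ?_, fun k => ?_, fun k => ?_, fun j k hj hjk hk => ?_⟩ <;>
    simp only [Pi.add_apply, Pi.smul_apply, smul_eq_mul]
  · rw [h1 k hk, g1 k hk]; ring
  · exact add_nonneg (mul_nonneg ha (h2 k)) (mul_nonneg hb (g2 k))
  · calc a * x k + b * y k ≤ a * s + b * s :=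
        add_le_add (mul_le_mul_of_nonneg_left (h3 k) ha) (mul_le_mul_of_nonneg_left (g3 k) hb)
      _ = s := by rw [← add_mul, hab, one_mul]
  · exact add_le_add (mul_le_mul_of_nonneg_left (h4 j k hj hjk hk) ha)
      (mul_le_mul_of_nonneg_left (g4 j k hj hjk hk) hb)

theorem isClosed_chainSet (i l : ℕ) (s : ℝ) : IsClosed (chainSet m i l s) := by
  simp only [chainSet, Set.ofPred_and, Set.ofPred_forall]
  refine IsClosed.inter ?_ (IsClosed.inter ?_ (IsClosed.inter ?_ ?_))
  · exact isClosed_iInter fun k => isClosed_iInter fun _ =>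
      isClosed_eq (continuous_apply k) continuous_const
  · exact isClosed_iInter fun k => isClosed_le continuous_const (continuous_apply k)
  · exact isClosed_iInter fun k => isClosed_le (continuous_apply k) continuous_const
  · exact isClosed_iInter fun j => isClosed_iInter fun k => isClosed_iInter fun _ =>
      isClosed_iInter fun _ => isClosed_iInter fun _ =>
        isClosed_le (continuous_apply k) (continuous_apply j)

theorem isCompact_chainSet (i l : ℕ) (s : ℝ) : IsCompact (chainSet m i l s) :=
  (isCompact_Icc (a := (0 : Fin m → ℝ)) (b := fun _ => s)).of_isClosed_subset
    (isClosed_chainSet i l s) fun _ hx => ⟨hx.2.1, hx.2.2.1⟩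

/-- The chain simplex as a convex body. -/
def chainBody (m i l : ℕ) : ConvexBody (Fin m → ℝ) :=
  ⟨chainSet m i l 1, convex_chainSet i l 1, isCompact_chainSet i l 1,
    ⟨0, fun _ _ => rfl, fun _ => le_rfl, fun _ => zero_le_one, fun _ _ _ _ _ => le_rfl⟩⟩

theorem coe_smul_chainBody (i l : ℕ) {t : ℝ} (ht : 0 ≤ t) :
    ((t • chainBody m i l : ConvexBody (Fin m → ℝ)) : Set (Fin m → ℝ)) = chainSet m i l t := by
  rw [ConvexBody.coe_smul]
  ext x
  constructor
  · rintro ⟨y, ⟨h1, h2, h3, h4⟩, rfl⟩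
    refine ⟨fun k hk => ?_, fun k => ?_, fun k => ?_, fun j k hj hjk hk => ?_⟩ <;>
      simp only [Pi.smul_apply, smul_eq_mul]
    · rw [h1 k hk, mul_zero]
    · exact mul_nonneg ht (h2 k)
    · exact mul_le_of_le_one_right ht (h3 k)
    · exact mul_le_mul_of_nonneg_left (h4 j k hj hjk hk) ht
  · rintro ⟨h1, h2, h3, h4⟩
    rcases ht.eq_or_lt with rfl | ht
    · have : x = 0 := funext fun k => le_antisymm (h3 k) (h2 k)
      subst this
      exact ⟨0, ⟨fun _ _ => rfl, fun _ => le_rfl, fun _ => zero_le_one,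
        fun _ _ _ _ _ => le_rfl⟩, smul_zero _⟩
    · refine ⟨t⁻¹ • x, ⟨fun k hk => ?_, fun k => ?_, fun k => ?_, fun j k hj hjk hk => ?_⟩,
        smul_inv_smul₀ ht.ne' x⟩ <;> simp only [Pi.smul_apply, smul_eq_mul]
      · rw [h1 k hk, mul_zero]
      · exact mul_nonneg (inv_nonneg.2 ht.le) (h2 k)
      · rw [inv_mul_le_iff₀ ht, mul_one]; exact h3 k
      · exact mul_le_mul_of_nonneg_left (h4 j k hj hjk hk) (inv_nonneg.2 ht.le)

/-- The indicator vector of `[i, l)`. -/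
def chainInd (m i l : ℕ) : Fin m → ℝ := fun k => if i ≤ k ∧ (k : ℕ) < l then 1 else 0

theorem chainSet_decomp {i j l : ℕ} (hij : i ≤ j) (hjl : j ≤ l) {s t : ℝ}
    (hs : 0 ≤ s) (ht : 0 ≤ t) :
    {x | x ∈ chainSet m i m (t + s) ∧ (∀ k : Fin m, i ≤ k → (k : ℕ) < l → t ≤ x k) ∧
      ∀ k : Fin m, j ≤ k → x k ≤ t} =
    {t • chainInd m i l} + (chainSet m i j s + chainSet m l m t) := by
  ext x
  rw [Set.singleton_add, Set.mem_image]
  constructor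
  · rintro ⟨⟨h1, h2, h3, h4⟩, h5, h6⟩
    refine ⟨_, ⟨fun k => if i ≤ k ∧ (k : ℕ) < j then x k - t else 0, ?_,
      fun k => if l ≤ k then x k else 0, ?_, rfl⟩, ?_⟩
    · refine ⟨fun k hk => if_neg (by omega), fun k => ?_, fun k => ?_, fun a b ha hab hb => ?_⟩
      · dsimp only
        split_ifs with h
        · exact sub_nonneg.2 (h5 k h.1 (by omega))
        · exact le_rfl
      · dsimp only
        split_ifs with h
        · linarith [h3 k]
        · exact hs
      · have hab' : (a : ℕ) ≤ b := hab
        dsimp only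
        rw [if_pos (by omega), if_pos (by omega)]
        linarith [h4 a b ha hab b.2]
    · refine ⟨fun k hk => if_neg (by omega), fun k => ?_, fun k => ?_, fun a b ha hab hb => ?_⟩
      · dsimp only
        split_ifs with h
        · exact h2 k
        · exact le_rfl
      · dsimp only
        split_ifs with h
        · exact h6 k (by omega)
        · exact ht
      · have hab' : (a : ℕ) ≤ b := hab
        dsimp only
        rw [if_pos (by omega), if_pos (by omega)]
        exact h4 a b (by omega) hab b.2
    · funext k
      simp only [Pi.add_apply, Pi.smul_apply, smul_eq_mul, chainInd]
      by_cases c1 : (k : ℕ) < i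
      · rw [if_neg (by omega), if_neg (by omega), if_neg (by omega), h1 k (Or.inl c1)]; ring
      · by_cases c2 : (k : ℕ) < j
        · rw [if_pos (by omega), if_pos (by omega), if_neg (by omega)]; ring
        · by_cases c3 : (k : ℕ) < l
          · rw [if_pos (by omega), if_neg (by omega), if_neg (by omega)]
            linarith [h5 k (by omega) c3, h6 k (by omega)]
          · rw [if_neg (by omega), if_neg (by omega), if_pos (by omega)]; ring
  · rintro ⟨_, ⟨y, ⟨h1, h2, h3, h4⟩, z, ⟨g1, g2, g3, g4⟩, rfl⟩, rfl⟩
    have val : ∀ k : Fin m, (t • chainInd m i l + (y + z)) k =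
        t * (if i ≤ k ∧ (k : ℕ) < l then 1 else 0) + (y k + z k) := fun k => rfl
    refine ⟨⟨fun k hk => ?_, fun k => ?_, fun k => ?_, fun a b ha hab hb => ?_⟩,
      fun k hk hk' => ?_, fun k hk => ?_⟩
    · simp only [val]
      rw [if_neg (by omega), h1 k (by omega), g1 k (by omega)]; ring
    · simp only [val]
      have := h2 k
      have := g2 k
      split_ifs <;> linarith
    · simp only [val]
      have := h3 k
      have := g3 k
      split_ifs with h
      · rw [g1 k (by omega)]; linarith
      · by_cases c : (k : ℕ) < i
        · rw [h1 k (by omega), g1 k (by omega)]; linarith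
        · rw [h1 k (by omega)]; linarith
    · have hab' : (a : ℕ) ≤ b := hab
      simp only [val]
      by_cases c1 : (b : ℕ) < j
      · rw [if_pos (by omega), if_pos (by omega), g1 a (by omega), g1 b (by omega)]
        linarith [h4 a b ha hab c1]
      · rw [h1 b (by omega)]
        have := h2 a
        by_cases c2 : (b : ℕ) < l
        · rw [if_pos (by omega), if_pos (by omega), g1 a (by omega), g1 b (by omega)]
          linarith
        · rw [if_neg (by omega)]
          by_cases c3 : (a : ℕ) < l
          · rw [if_pos (by omega), g1 a (by omega)]
            linarith [g3 b]
          · rw [if_neg (by omega)]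
            linarith [g4 a b (by omega) hab b.2]
    · simp only [val]
      rw [if_pos (by omega)]
      linarith [h2 k, g2 k]
    · simp only [val]
      rw [h1 k (by omega)]
      split_ifs with h
      · rw [g1 k (by omega)]; linarith
      · linarith [g3 k]

end Chains

section ChainPolynomial

variable {m : ℕ}

theorem IsVal.eq_of_coe_decomp {μ : ConvexBody (Fin m → ℝ) → ℝ} (h : IsVal μ) {i j l : ℕ}
    {s t : ℝ} (hs : 0 ≤ s) (ht : 0 ≤ t) {M : ConvexBody (Fin m → ℝ)}
    (hM : (M : Set (Fin m → ℝ)) =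
      {t • chainInd m i l} + (chainSet m i j s + chainSet m l m t)) :
    μ M = μ (s • chainBody m i j + t • chainBody m l m) := by
  have : M = ConvexBody.point (t • chainInd m i l) +
      (s • chainBody m i j + t • chainBody m l m) := by
    apply ConvexBody.ext
    rw [hM, ConvexBody.coe_add, ConvexBody.coe_add, coe_smul_chainBody _ _ hs,
      coe_smul_chainBody _ _ ht]
    rfl
  rw [this, h.point_add]

/-- The part of a chain simplex where the coordinates in `[i, j)` are at least `t`. -/
def chainUpper (m i j : ℕ) (s t : ℝ) : Set (Fin m → ℝ) :=
  {x | x ∈ chainSet m i m (t + s) ∧ ∀ k : Fin m, i ≤ k → (k : ℕ) < j → t ≤ x k}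

theorem IsVal.chainUpper_step {μ : ConvexBody (Fin m → ℝ) → ℝ} (h : IsVal μ) {i j : ℕ}
    (hij : i ≤ j) (hjm : j < m) {s t : ℝ} (hs : 0 ≤ s) (ht : 0 ≤ t)
    {M : ConvexBody (Fin m → ℝ)} (hM : (M : Set (Fin m → ℝ)) = chainUpper m i j s t) :
    ∃ B : ConvexBody (Fin m → ℝ), (B : Set (Fin m → ℝ)) = chainUpper m i (j + 1) s t ∧
      μ M = μ (s • chainBody m i j + t • chainBody m j m) + μ B -
        μ (s • chainBody m i j + t • chainBody m (j + 1) m) := by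
  let J : Fin m := ⟨j, hjm⟩
  have hmem : t • chainInd m i m ∈ M := by
    rw [← SetLike.mem_coe, hM]
    refine ⟨⟨fun k hk => ?_, fun k => ?_, fun k => ?_, fun a b ha hab hb => ?_⟩,
      fun k hk hk' => ?_⟩ <;> simp only [chainInd, Pi.smul_apply, smul_eq_mul]
    · rw [if_neg (by omega), mul_zero]
    · split_ifs <;> simp [ht]
    · split_ifs <;> linarith
    · have hab' : (a : ℕ) ≤ b := hab
      rw [if_pos (by omega), if_pos (by omega)]
    · rw [if_pos (by omega), mul_one]
  have hJ : (ContinuousLinearMap.proj J : (Fin m → ℝ) →L[ℝ] ℝ) (t • chainInd m i m) = t := by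
    have : chainInd m i m J = 1 := if_pos ⟨hij, hjm⟩
    simp [this]
  obtain ⟨A, B, I, hA, hB, hI, he⟩ := h.exists_cut M (ContinuousLinearMap.proj J) t
    ⟨_, hmem, hJ.le⟩ ⟨_, hmem, hJ.ge⟩
  refine ⟨B, ?_, ?_⟩
  · rw [hB, hM]
    ext x
    constructor
    · rintro ⟨⟨h1, h2⟩, h3⟩
      refine ⟨h1, fun k hk hk' => ?_⟩
      by_cases hkj : (k : ℕ) < j
      · exact h2 k hk hkj
      · have : k = J := Fin.ext (by change (k : ℕ) = j; omega)
        subst this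
        exact h3
    · rintro ⟨h1, h2⟩
      exact ⟨⟨h1, fun k hk hk' => h2 k hk (by omega)⟩, h2 J hij (Nat.lt_succ_self j)⟩
  · rw [he, h.eq_of_coe_decomp (i := i) (j := j) (l := j) hs ht (M := A),
      h.eq_of_coe_decomp (i := i) (j := j) (l := j + 1) hs ht (M := I)]
    · rw [← chainSet_decomp hij (Nat.le_succ j) hs ht, hI, hM]
      ext x
      constructor
      · rintro ⟨⟨h1, h2⟩, h3⟩
        have h3' : x J = t := h3
        refine ⟨h1, fun k hk hk' => ?_, fun k hk => ?_⟩
        · by_cases hkj : (k : ℕ) < j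
          · exact h2 k hk hkj
          · have : k = J := Fin.ext (by change (k : ℕ) = j; omega)
            rw [this, h3']
        · rw [← h3']
          exact h1.2.2.2 J k hij hk k.2
      · rintro ⟨h1, h2, h3⟩
        exact ⟨⟨h1, fun k hk hk' => h2 k hk (by omega)⟩,
          le_antisymm (h3 J le_rfl) (h2 J hij (Nat.lt_succ_self j))⟩
    · rw [← chainSet_decomp hij le_rfl hs ht, hA, hM]
      ext x
      constructor
      · rintro ⟨⟨h1, h2⟩, h3⟩
        have h3' : x J ≤ t := h3
        exact ⟨h1, h2, fun k hk => (h1.2.2.2 J k hij hk k.2).trans h3'⟩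
      · rintro ⟨h1, h2, h3⟩
        exact ⟨⟨h1, h2⟩, h3 J le_rfl⟩

theorem smul_chainBody_eq_zero {i j : ℕ} (hij : j ≤ i) {s : ℝ} (hs : 0 ≤ s) :
    s • chainBody m i j = 0 := by
  apply ConvexBody.ext
  rw [coe_smul_chainBody _ _ hs, ConvexBody.coe_zero]
  ext x
  constructor
  · rintro ⟨h1, -⟩
    exact funext fun k => h1 k (by omega)
  · intro hx
    have : x = 0 := hx
    subst this
    exact ⟨fun _ _ => rfl, fun _ => le_rfl, fun _ => hs, fun _ _ _ _ _ => le_rfl⟩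

theorem polyOn_chainBody (i : ℕ) (hi : i ≤ m) : ∀ μ : ConvexBody (Fin m → ℝ) → ℝ, IsVal μ →
    PolyOn fun t => μ (t • chainBody m i m) := by
  induction hd : m - i using Nat.strong_induction_on generalizing i with
  | _ d ih =>
  intro μ hμ
  rcases hi.eq_or_lt with rfl | him
  · exact (PolyOn.const (μ 0)).congr fun t ht => by rw [smul_chainBody_eq_zero le_rfl ht]
  have ih' : ∀ j, i < j → j ≤ m → ∀ μ : ConvexBody (Fin m → ℝ) → ℝ, IsVal μ →
      PolyOn fun t => μ (t • chainBody m j m) := fun j hij hjm =>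
    ih (m - j) (by omega) j hjm rfl
  refine PolyOn.of_differences
    (hμ.cont.comp (continuous_id.smul continuous_const)) fun s hs => ?_
  have upper : ∀ e j, j + e = m → i < j → ∃ p : Polynomial ℝ, ∀ t, 0 ≤ t →
      ∀ M : ConvexBody (Fin m → ℝ), (M : Set (Fin m → ℝ)) = chainUpper m i j s t →
        μ M = p.eval t := by
    intro e
    induction e with
    | zero =>
      intro j hj hij
      obtain rfl : j = m := by omega
      obtain ⟨p, hp⟩ := ih' j hij le_rfl _ (hμ.comp_add (s • chainBody j i j))
      refine ⟨p, fun t ht M hM => ?_⟩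
      rw [← hp t ht]
      refine hμ.eq_of_coe_decomp (i := i) (l := j) hs ht ?_
      rw [hM, ← chainSet_decomp hij.le le_rfl hs ht]
      ext x
      exact ⟨fun hx => ⟨hx.1, hx.2, fun k hk => absurd k.2 (by omega)⟩,
        fun hx => ⟨hx.1, hx.2.1⟩⟩
    | succ e ihe =>
      intro j hj hij
      obtain ⟨p, hp⟩ := ihe (j + 1) (by omega) (by omega)
      obtain ⟨p₁, hp₁⟩ := ih' j hij (by omega) _ (hμ.comp_add (s • chainBody m i j))
      obtain ⟨p₂, hp₂⟩ := ih' (j + 1) (by omega) (by omega) _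
        (hμ.comp_add (s • chainBody m i j))
      refine ⟨p₁ + p - p₂, fun t ht M hM => ?_⟩
      obtain ⟨B, hB, he⟩ := hμ.chainUpper_step hij.le (by omega) hs ht hM
      rw [he, hp t ht B hB, Polynomial.eval_sub, Polynomial.eval_add, ← hp₁ t ht, ← hp₂ t ht]
  obtain ⟨p, hp⟩ := upper (m - (i + 1)) (i + 1) (by omega) (by omega)
  obtain ⟨p₂, hp₂⟩ := ih' (i + 1) (by omega) (by omega) μ hμ
  refine ⟨p - p₂, fun t ht => ?_⟩
  obtain ⟨B, hB, he⟩ := hμ.chainUpper_step le_rfl him hs ht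
    (M := (t + s) • chainBody m i m) (by
      rw [coe_smul_chainBody _ _ (by linarith)]
      ext x
      exact ⟨fun hx => ⟨hx, fun k hk hk' => absurd hk' (by omega)⟩, fun hx => hx.1⟩)
  rw [smul_chainBody_eq_zero le_rfl hs, zero_add, zero_add] at he
  dsimp only
  rw [he, hp t ht B hB, Polynomial.eval_sub, ← hp₂ t ht]
  ring

end ChainPolynomial

section Polytopes

variable {V : Type*} [NormedAddCommGroup V] [NormedSpace ℝ V]

/-- The linear map sending the `k`-th unit vector to the `k`-th edge vector of the polygonal
chain `v`. -/
def edgeMap {m : ℕ} (v : Fin (m + 1) → V) : (Fin m → ℝ) →L[ℝ] V :=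
  LinearMap.toContinuousLinearMap (∑ k : Fin m,
    (LinearMap.proj k : (Fin m → ℝ) →ₗ[ℝ] ℝ).smulRight (v k.succ - v k.castSucc))

theorem edgeMap_apply {m : ℕ} (v : Fin (m + 1) → V) (x : Fin m → ℝ) :
    edgeMap v x = ∑ k, x k • (v k.succ - v k.castSucc) := by
  simp [edgeMap]

theorem edge_sum_mem {C : Set V} (hC : Convex ℝ C) : ∀ {m : ℕ} (v : Fin (m + 1) → V)
    (_ : ∀ i, v i ∈ C) (x : Fin m → ℝ) (a : ℝ) (_ : ∀ k, x k ≤ a) (_ : ∀ k, 0 ≤ x k)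
    (_ : ∀ j k, j ≤ k → x k ≤ x j) (_ : 0 ≤ a),
    a • v 0 + ∑ k, x k • (v k.succ - v k.castSucc) ∈ a • C := by
  intro m
  induction m with
  | zero =>
    intro v hv x a _ _ _ _
    simpa using Set.smul_mem_smul_set (hv 0)
  | succ m ih =>
    intro v hv x a hxa hx hanti ha
    have h := ih (fun i => v i.succ) (fun i => hv _) (fun k => x k.succ) (x 0)
      (fun k => hanti 0 k.succ (Fin.zero_le _)) (fun k => hx _)
      (fun j k hjk => hanti _ _ (Fin.succ_le_succ_iff.2 hjk)) (hx 0)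
    have hsplit : a • C = (a - x 0) • C + x 0 • C := by
      rw [← hC.add_smul (sub_nonneg.2 (hxa 0)) (hx 0), sub_add_cancel]
    rw [hsplit]
    refine Set.mem_add.2 ⟨(a - x 0) • v 0, Set.smul_mem_smul_set (hv 0), _, h, ?_⟩
    rw [Fin.sum_univ_succ]
    simp only [Fin.succ_zero_eq_one, Fin.castSucc_zero, Fin.succ_castSucc]
    module

theorem edge_sum_ind : ∀ {m : ℕ} (v : Fin (m + 1) → V) (i : Fin (m + 1)),
    v 0 + ∑ k : Fin m, (if (k : ℕ) < i then (1 : ℝ) else 0) • (v k.succ - v k.castSucc) = v i := by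
  intro m
  induction m with
  | zero =>
    intro v i
    obtain rfl : i = 0 := Fin.ext (by omega)
    simp
  | succ m ih =>
    intro v i
    refine Fin.cases ?_ (fun i => ?_) i
    · simp
    · have h := ih (fun i => v i.succ) i
      rw [← h, Fin.sum_univ_succ]
      simp only [Fin.succ_zero_eq_one, Fin.castSucc_zero, Fin.succ_castSucc, Fin.val_succ,
        Nat.add_lt_add_iff_right, Fin.val_zero, Nat.succ_pos, if_true]
      module

/-- The polytope spanned by `v`. -/
def polytope {m : ℕ} (v : Fin (m + 1) → V) : ConvexBody V :=
  ConvexBody.point (v 0) + (chainBody m 0 m).map (edgeMap v)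

theorem polytope_subset {C : Set V} (hC : Convex ℝ C) {m : ℕ} (v : Fin (m + 1) → V)
    (hv : ∀ i, v i ∈ C) : ∀ x ∈ polytope v, x ∈ C := by
  intro x hx
  obtain ⟨a, ha, b, ⟨y, hy, rfl⟩, rfl⟩ := ConvexBody.mem_add.1 hx
  rw [ConvexBody.mem_point] at ha
  subst ha
  obtain ⟨-, h2, h3, h4⟩ := hy
  have := edge_sum_mem hC v hv y 1 h3 h2 (fun j k hjk => h4 j k (Nat.zero_le _) hjk k.2)
    zero_le_one
  rw [one_smul, one_smul, ← edgeMap_apply] at this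
  exact this

theorem mem_polytope {m : ℕ} (v : Fin (m + 1) → V) (i : Fin (m + 1)) : v i ∈ polytope v := by
  refine ConvexBody.mem_add.2 ⟨v 0, ConvexBody.mem_point.2 rfl, edgeMap v (chainInd m 0 i),
    ⟨_, ⟨fun k hk => ?_, fun k => ?_, fun k => ?_, fun a b ha hab hb => ?_⟩, rfl⟩, ?_⟩
  · exact absurd hk (by omega)
  · simp only [chainInd]; split_ifs <;> norm_num
  · simp only [chainInd]; split_ifs <;> norm_num
  · have hab' : (a : ℕ) ≤ b := hab
    simp only [chainInd]
    split_ifs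
    · exact le_rfl
    · omega
    · norm_num
    · exact le_rfl
  · rw [edgeMap_apply, ← edge_sum_ind v i]
    simp [chainInd]

theorem ConvexBody.exists_polytope (K : ConvexBody V) {ε : ℝ} (hε : 0 < ε) :
    ∃ (m : ℕ) (v : Fin (m + 1) → V), dist (polytope v) K ≤ ε ∧ ∀ i, v i ∈ K := by
  obtain ⟨t, htK, htf, hcov⟩ := K.isCompact.finite_cover_balls hε
  obtain ⟨x₀, hx₀⟩ := K.nonempty
  have hne : t.Nonempty := by
    obtain ⟨y, hy, -⟩ := Set.mem_iUnion₂.1 (hcov hx₀)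
    exact ⟨y, hy⟩
  obtain ⟨m, f, hf⟩ := htf.fin_param
  have hm : m ≠ 0 := by
    rintro rfl
    obtain ⟨y, hy⟩ := hne
    rw [← hf.2] at hy
    obtain ⟨i, -⟩ := hy
    exact i.elim0
  obtain ⟨m, rfl⟩ := Nat.exists_eq_succ_of_ne_zero hm
  have hfK : ∀ i, f i ∈ K := fun i => htK (by rw [← hf.2]; exact ⟨i, rfl⟩)
  refine ⟨m, f, ConvexBody.dist_le_of _ _ hε.le ?_ ?_, hfK⟩
  · intro x hx
    exact ⟨x, polytope_subset K.convex f hfK x hx, by simpa using hε.le⟩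
  · intro x hx
    obtain ⟨y, hy, hxy⟩ := Set.mem_iUnion₂.1 (hcov hx)
    rw [← hf.2] at hy
    obtain ⟨i, rfl⟩ := hy
    exact ⟨f i, mem_polytope f i, (Metric.mem_ball.1 hxy).le⟩

theorem IsVal.polyOn_polytope {φ : ConvexBody V → ℝ} (h : IsVal φ) {m : ℕ}
    (v : Fin (m + 1) → V) : PolyOn fun t => φ (t • polytope v) := by
  refine (polyOn_chainBody 0 (Nat.zero_le _) _ (h.comp_map (edgeMap v))).congr fun t _ => ?_
  rw [polytope, smul_add, ConvexBody.smul_point, h.point_add, ConvexBody.map_smul]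

end Polytopes

section DegreeInduction

open Asymptotics Filter

theorem Polynomial.degree_lt_of_isLittleO {p : Polynomial ℝ} {d : ℕ}
    (h : (fun t => p.eval t) =o[atTop] fun t : ℝ => t ^ d) : p.degree < d := by
  by_contra hd
  rw [not_lt] at hd
  have h1 : (fun t : ℝ => t ^ d) =O[atTop] fun t => p.eval t := by
    have := Polynomial.isBigO_atTop_of_degree_le (Polynomial.X ^ d : Polynomial ℝ) p
      (by rwa [Polynomial.degree_X_pow])
    simpa using this
  have h2 := h1.trans_isLittleO h
  exact isLittleO_irrefl
    ((eventually_gt_atTop (0 : ℝ)).mono fun t ht => (pow_pos ht d).ne').frequently h2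

/-- The Lagrange basis polynomials for the nodes `0, …, d`. -/
def nodePoly (d j : ℕ) : Polynomial ℝ :=
  Lagrange.basis (Finset.range (d + 1)) (fun i : ℕ => (i : ℝ)) j

theorem nodes_injOn (d : ℕ) :
    Set.InjOn (fun i : ℕ => (i : ℝ)) (Finset.range (d + 1) : Set ℕ) :=
  fun _ _ _ _ h => Nat.cast_injective h

theorem Polynomial.eval_eq_sum_nodePoly {p : Polynomial ℝ} {d : ℕ} (hp : p.degree < (d + 1 : ℕ))
    (t : ℝ) : p.eval t = ∑ j ∈ Finset.range (d + 1), (nodePoly d j).eval t * p.eval (j : ℝ) := by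
  have := Lagrange.eq_interpolate (f := p) (nodes_injOn d) (by rwa [Finset.card_range])
  conv_lhs => rw [this, Lagrange.interpolate_apply]
  rw [Polynomial.eval_finsetSum]
  exact Finset.sum_congr rfl fun j _ => by
    rw [Polynomial.eval_mul, Polynomial.eval_C, mul_comm]; rfl

theorem degree_nodePoly_le {d j : ℕ} (hj : j ∈ Finset.range (d + 1)) :
    (nodePoly d j).degree ≤ d := by
  rw [nodePoly, Lagrange.degree_basis (nodes_injOn d) hj, Finset.card_range]
  simp

variable {V : Type*} [NormedAddCommGroup V] [NormedSpace ℝ V]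

/-- `t ↦ φ (t • K)` is polynomial of degree at most `d` on `[0, ∞)` for all `K`. -/
def WDeg (d : ℕ) (φ : ConvexBody V → ℝ) : Prop :=
  ∀ (K : ConvexBody V) (t : ℝ), 0 ≤ t →
    φ (t • K) = ∑ j ∈ Finset.range (d + 1), (nodePoly d j).eval t * φ ((j : ℝ) • K)

theorem ConvexBody.zero_smul' (K : ConvexBody V) : (0 : ℝ) • K = 0 := by
  apply ConvexBody.ext
  rw [ConvexBody.coe_smul, ConvexBody.coe_zero]
  exact Set.zero_smul_set K.nonempty

theorem sum_nodePoly_of_polynomial {φ : ConvexBody V → ℝ} {K : ConvexBody V} {d : ℕ}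
    {p : Polynomial ℝ} (hp : ∀ t, 0 ≤ t → φ (t • K) = p.eval t) (hd : p.degree < (d + 1 : ℕ))
    (t : ℝ) (ht : 0 ≤ t) :
    φ (t • K) = ∑ j ∈ Finset.range (d + 1), (nodePoly d j).eval t * φ ((j : ℝ) • K) := by
  rw [hp t ht, Polynomial.eval_eq_sum_nodePoly hd]
  exact Finset.sum_congr rfl fun j _ => by rw [hp j (Nat.cast_nonneg j)]

theorem WDeg.exists_polynomial {φ : ConvexBody V → ℝ} {d : ℕ} (h : WDeg d φ)
    (K : ConvexBody V) : ∃ p : Polynomial ℝ, ∀ t, 0 ≤ t → φ (t • K) = p.eval t := by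
  refine ⟨∑ j ∈ Finset.range (d + 1), nodePoly d j * Polynomial.C (φ ((j : ℝ) • K)),
    fun t ht => ?_⟩
  rw [h K t ht, Polynomial.eval_finsetSum]
  simp

theorem IsVal.wDeg {n : ℕ} {φ : ConvexBody (Eucl n) → ℝ} (h : IsVal φ) : WDeg n φ := by
  intro K t ht
  have hclosed : IsClosed {K : ConvexBody (Eucl n) | φ (t • K) =
      ∑ j ∈ Finset.range (n + 1), (nodePoly n j).eval t * φ ((j : ℝ) • K)} := by
    have hc := h.cont
    refine isClosed_eq (hc.comp (continuous_const_smul t)) (continuous_finsetSum _ fun j _ => ?_)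
    exact continuous_const.mul (hc.comp (continuous_const_smul _))
  refine (closure_minimal (s := {K | ∃ (m : ℕ) (v : Fin (m + 1) → Eucl n), K = polytope v})
    ?_ hclosed) (Metric.mem_closure_iff.2 fun ε hε => ?_)
  · rintro _ ⟨m, v, rfl⟩
    obtain ⟨p, hp⟩ := h.polyOn_polytope v
    refine sum_nodePoly_of_polynomial hp (Polynomial.degree_lt_of_isLittleO ?_) t ht
    obtain ⟨C, hC, hgrow⟩ := h.exists_growth
    obtain ⟨R, hR, hK⟩ := (polytope v).exists_inBall
    have h1 : (fun t => p.eval t) =O[atTop] fun t : ℝ => t ^ n := by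
      refine IsBigO.of_bound (C * (1 + R) ^ n) ?_
      filter_upwards [eventually_ge_atTop 1] with t ht
      have ht0 : 0 ≤ t := by linarith
      rw [← hp t ht0, Real.norm_eq_abs, Real.norm_of_nonneg (by positivity), mul_assoc,
        ← mul_pow]
      refine (hgrow (t * R) _ (by positivity) (hK.smul ht0)).trans ?_
      gcongr
      nlinarith
    have h2 : (fun t : ℝ => t ^ n) =o[atTop] fun t : ℝ => t ^ (n + 1) :=
      isLittleO_pow_pow_atTop_of_lt (Nat.lt_succ_self n)
    exact h1.trans_isLittleO h2
  · obtain ⟨m, v, hv, -⟩ := K.exists_polytope (half_pos hε)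
    exact ⟨polytope v, ⟨m, v, rfl⟩, by rw [dist_comm]; linarith⟩

theorem WDeg.diffOp {n : ℕ} {φ : ConvexBody (Eucl n) → ℝ} {d : ℕ} (h : IsVal φ)
    (hd : WDeg (d + 1) φ) (L : ConvexBody (Eucl n)) : WDeg d (diffOp L φ) := by
  intro K
  obtain ⟨p, hp⟩ := (h.diffOp L).wDeg.exists_polynomial K
  refine sum_nodePoly_of_polynomial hp (Polynomial.degree_lt_of_isLittleO ?_)
  have hlim : ∀ j : ℕ, (fun t : ℝ => φ ((j : ℝ) • (K + t⁻¹ • L)) - φ ((j : ℝ) • K))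
      =o[atTop] fun _ => (1 : ℝ) := by
    intro j
    rw [isLittleO_one_iff]
    have hc : Continuous fun s : ℝ => φ ((j : ℝ) • (K + s • L)) - φ ((j : ℝ) • K) :=
      (h.cont.comp ((continuous_const.add (continuous_id.smul continuous_const)).const_smul
        (j : ℝ))).sub continuous_const
    have h1 := (hc.tendsto 0).comp tendsto_inv_atTop_zero
    simpa [ConvexBody.zero_smul', Function.comp_def] using h1
  have hsum : (fun t : ℝ => ∑ j ∈ Finset.range (d + 1 + 1), (nodePoly (d + 1) j).eval t *
      (φ ((j : ℝ) • (K + t⁻¹ • L)) - φ ((j : ℝ) • K))) =o[atTop] fun t : ℝ => t ^ (d + 1) := by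
    refine IsLittleO.fun_sum fun j hj => ?_
    have h1 : (fun t => (nodePoly (d + 1) j).eval t) =O[atTop] fun t : ℝ => t ^ (d + 1) := by
      have := Polynomial.isBigO_atTop_of_degree_le (nodePoly (d + 1) j)
        (Polynomial.X ^ (d + 1) : Polynomial ℝ)
        (by rw [Polynomial.degree_X_pow]; exact degree_nodePoly_le hj)
      simpa using this
    simpa using h1.mul_isLittleO (hlim j)
  refine hsum.congr' ?_ EventuallyEq.rfl
  filter_upwards [eventually_gt_atTop 0] with t ht
  rw [← hp t ht.le, _root_.diffOp, hd K t ht.le]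
  have : t • K + L = t • (K + t⁻¹ • L) := by
    rw [smul_add, smul_smul, mul_inv_cancel₀ ht.ne', one_smul]
  rw [this, hd _ t ht.le, ← Finset.sum_sub_distrib]
  exact Finset.sum_congr rfl fun j _ => by ring

/-- All iterated differences of `φ` of order `j` vanish. -/
def IsPolyVal : ℕ → (ConvexBody V → ℝ) → Prop
  | 0, φ => φ = 0
  | j + 1, φ => ∀ L, IsPolyVal j (diffOp L φ)

theorem WDeg.isPolyVal {n : ℕ} (d : ℕ) : ∀ {φ : ConvexBody (Eucl n) → ℝ}, IsVal φ → WDeg d φ →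
    IsPolyVal (d + 1) φ := by
  induction d with
  | zero =>
    intro φ _ h L
    have key : ∀ K, φ K = φ 0 := fun K => by
      have h1 := h K 1 zero_le_one
      have h2 : nodePoly 0 0 = 1 := by simp [nodePoly]
      simpa [h2, ConvexBody.zero_smul'] using h1
    funext K
    simp [_root_.diffOp, key (K + L), key K]
  | succ d ih =>
    intro φ hφ h L
    exact ih (hφ.diffOp L) (h.diffOp hφ L)

theorem IsVal.isPolyVal {n : ℕ} {φ : ConvexBody (Eucl n) → ℝ} (h : IsVal φ) :
    IsPolyVal (n + 1) φ := WDeg.isPolyVal n h h.wDeg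

end DegreeInduction

section Support

open scoped InnerProductSpace

variable {n : ℕ}

/-- The support function of a convex body. -/
def supp (K : ConvexBody (Eucl n)) (u : Eucl n) : ℝ := sSup ((fun x => ⟪x, u⟫_ℝ) '' (K : Set (Eucl n)))

theorem exists_inner_eq_supp (K : ConvexBody (Eucl n)) (u : Eucl n) :
    ∃ x ∈ K, ⟪x, u⟫_ℝ = supp K u := by
  obtain ⟨x, hx, h⟩ := K.isCompact.exists_sSup_image_eq K.nonempty
    (f := fun x => ⟪x, u⟫_ℝ) (by fun_prop)
  exact ⟨x, hx, h.symm⟩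

theorem inner_le_supp {K : ConvexBody (Eucl n)} {x : Eucl n} (hx : x ∈ K) (u : Eucl n) :
    ⟪x, u⟫_ℝ ≤ supp K u :=
  le_csSup (K.isCompact.image (by fun_prop : Continuous fun x : Eucl n => ⟪x, u⟫_ℝ)).bddAbove
    ⟨x, hx, rfl⟩

theorem supp_le {K : ConvexBody (Eucl n)} {u : Eucl n} {c : ℝ}
    (h : ∀ x ∈ K, ⟪x, u⟫_ℝ ≤ c) : supp K u ≤ c := by
  obtain ⟨x, hx, hu⟩ := exists_inner_eq_supp K u
  exact hu ▸ h x hx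

theorem supp_add_body (K L : ConvexBody (Eucl n)) (u : Eucl n) :
    supp (K + L) u = supp K u + supp L u := by
  refine le_antisymm (supp_le fun x hx => ?_) ?_
  · obtain ⟨a, ha, b, hb, rfl⟩ := ConvexBody.mem_add.1 hx
    rw [inner_add_left]
    exact add_le_add (inner_le_supp ha u) (inner_le_supp hb u)
  · obtain ⟨a, ha, h1⟩ := exists_inner_eq_supp K u
    obtain ⟨b, hb, h2⟩ := exists_inner_eq_supp L u
    rw [← h1, ← h2, ← inner_add_left]
    exact inner_le_supp (ConvexBody.mem_add.2 ⟨a, ha, b, hb, rfl⟩) u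

theorem supp_smul_body {t : ℝ} (ht : 0 ≤ t) (K : ConvexBody (Eucl n)) (u : Eucl n) :
    supp (t • K) u = t * supp K u := by
  refine le_antisymm (supp_le fun x hx => ?_) ?_
  · obtain ⟨a, ha, rfl⟩ := ConvexBody.mem_smul.1 hx
    rw [real_inner_smul_left]
    exact mul_le_mul_of_nonneg_left (inner_le_supp ha u) ht
  · obtain ⟨a, ha, h1⟩ := exists_inner_eq_supp K u
    rw [← h1, ← real_inner_smul_left]
    exact inner_le_supp (ConvexBody.mem_smul.2 ⟨a, ha, rfl⟩) u

theorem supp_zero_body (u : Eucl n) : supp (0 : ConvexBody (Eucl n)) u = 0 := by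
  obtain ⟨x, hx, h⟩ := exists_inner_eq_supp (0 : ConvexBody (Eucl n)) u
  have : x = 0 := hx
  rw [← h, this, inner_zero_left]

theorem supp_add_le (K : ConvexBody (Eucl n)) (u v : Eucl n) :
    supp K (u + v) ≤ supp K u + supp K v :=
  supp_le fun x hx => by
    rw [inner_add_right]
    exact add_le_add (inner_le_supp hx u) (inner_le_supp hx v)

theorem supp_smul {t : ℝ} (ht : 0 ≤ t) (K : ConvexBody (Eucl n)) (u : Eucl n) :
    supp K (t • u) = t * supp K u := by
  refine le_antisymm (supp_le fun x hx => ?_) ?_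
  · rw [real_inner_smul_right]
    exact mul_le_mul_of_nonneg_left (inner_le_supp hx u) ht
  · obtain ⟨a, ha, h1⟩ := exists_inner_eq_supp K u
    rw [← h1, ← real_inner_smul_right]
    exact inner_le_supp ha _

theorem supp_le_mul_norm {K : ConvexBody (Eucl n)} {R : ℝ} (h : K.InBall R) (u : Eucl n) :
    supp K u ≤ R * ‖u‖ :=
  supp_le fun x hx => (real_inner_le_norm x u).trans
    (mul_le_mul_of_nonneg_right (h x hx) (norm_nonneg u))

theorem continuous_supp (K : ConvexBody (Eucl n)) : Continuous (supp K) := by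
  obtain ⟨R, hR, hK⟩ := K.exists_inBall
  refine (LipschitzWith.of_le_add_mul ⟨R, hR.le⟩ fun u v => ?_).continuous
  have h1 := supp_add_le K v (u - v)
  have h2 := supp_le_mul_norm hK (u - v)
  rw [add_sub_cancel] at h1
  rw [dist_eq_norm]
  exact h1.trans (add_le_add_right h2 _)

theorem mem_of_forall_inner_le {K : ConvexBody (Eucl n)} {x : Eucl n}
    (h : ∀ u, ‖u‖ = 1 → ⟪x, u⟫_ℝ ≤ supp K u) : x ∈ K := by
  by_contra hx
  obtain ⟨f, s, hs, hsx⟩ := geometric_hahn_banach_closed_point K.convex K.isClosed hx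
  set w : Eucl n := (InnerProductSpace.toDual ℝ (Eucl n)).symm f with hw
  have hf : ∀ y, f y = ⟪y, w⟫_ℝ := fun y => by
    rw [real_inner_comm, hw, InnerProductSpace.toDual_symm_apply]
  have hlt : supp K w < ⟪x, w⟫_ℝ := by
    obtain ⟨y, hy, hyw⟩ := exists_inner_eq_supp K w
    rw [← hyw, ← hf, ← hf]
    exact (hs y hy).trans hsx
  have hw0 : w ≠ 0 := by
    intro h0
    have h1 : supp K 0 = 0 := by
      have := supp_smul le_rfl K 0
      rwa [zero_smul, zero_mul] at this
    rw [h0, h1, inner_zero_right] at hlt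
    exact lt_irrefl _ hlt
  have hn : 0 < ‖w‖ := norm_pos_iff.2 hw0
  have := h (‖w‖⁻¹ • w) (by rw [norm_smul, norm_inv, norm_norm, inv_mul_cancel₀ hn.ne'])
  rw [real_inner_smul_right, supp_smul (inv_nonneg.2 hn.le)] at this
  exact absurd (le_of_mul_le_mul_left this (inv_pos.2 hn)) (not_le.2 hlt)

/-- The unit sphere of `ℝⁿ`. -/
abbrev Sph (n : ℕ) : Type := Metric.sphere (0 : Eucl n) 1

/-- The support function restricted to the unit sphere. -/
def hs (K : ConvexBody (Eucl n)) : Sph n → ℝ := fun u => supp K u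

theorem norm_sph (u : Sph n) : ‖(u : Eucl n)‖ = 1 := by simp

theorem hs_add (K L : ConvexBody (Eucl n)) : hs (K + L) = hs K + hs L :=
  funext fun u => supp_add_body K L u

theorem hs_smul {t : ℝ} (ht : 0 ≤ t) (K : ConvexBody (Eucl n)) : hs (t • K) = t • hs K :=
  funext fun u => supp_smul_body ht K u

theorem hs_zero : hs (0 : ConvexBody (Eucl n)) = 0 := funext fun u => supp_zero_body (u : Eucl n)

theorem continuous_hs (K : ConvexBody (Eucl n)) : Continuous (hs K) :=
  (continuous_supp K).comp continuous_subtype_val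

theorem mem_of_forall_inner_le_hs {K : ConvexBody (Eucl n)} {x : Eucl n}
    (h : ∀ u : Sph n, ⟪x, (u : Eucl n)⟫_ℝ ≤ hs K u) : x ∈ K :=
  mem_of_forall_inner_le fun u hu => h ⟨u, by simpa using hu⟩

theorem subset_of_hs_le {K L : ConvexBody (Eucl n)} (h : hs K ≤ hs L) :
    (K : Set (Eucl n)) ⊆ L := fun _ hx =>
  mem_of_forall_inner_le_hs fun u => (inner_le_supp hx _).trans (h u)

theorem hs_injective : Function.Injective (hs : ConvexBody (Eucl n) → Sph n → ℝ) :=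
  fun _ _ h => ConvexBody.ext (Set.Subset.antisymm (subset_of_hs_le h.le) (subset_of_hs_le h.ge))

/-- The closed ball of radius `r` about the origin. -/
def ballBody (n : ℕ) {r : ℝ} (hr : 0 ≤ r) : ConvexBody (Eucl n) :=
  ⟨Metric.closedBall 0 r, convex_closedBall 0 r, isCompact_closedBall 0 r,
    ⟨0, Metric.mem_closedBall_self hr⟩⟩

theorem mem_ballBody {r : ℝ} (hr : 0 ≤ r) {x : Eucl n} : x ∈ ballBody n hr ↔ ‖x‖ ≤ r := by
  change x ∈ Metric.closedBall 0 r ↔ _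
  simp

theorem hs_ballBody {r : ℝ} (hr : 0 ≤ r) : hs (ballBody n hr) = fun _ => r := by
  funext u
  have hu := norm_sph u
  refine le_antisymm ?_ ?_
  · refine (supp_le_mul_norm (R := r) (fun x hx => (mem_ballBody hr).1 hx) _).trans ?_
    rw [hu, mul_one]
  · have h1 : r • (u : Eucl n) ∈ ballBody n hr := by
      rw [mem_ballBody, norm_smul, hu, mul_one, Real.norm_of_nonneg hr]
    have h2 := inner_le_supp h1 (u : Eucl n)
    rwa [real_inner_smul_left, real_inner_self_eq_norm_sq, hu, one_pow, mul_one] at h2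

theorem dist_le_of_hs {K L : ConvexBody (Eucl n)} {r : ℝ} (hr : 0 ≤ r)
    (h : ∀ u, |hs K u - hs L u| ≤ r) : dist K L ≤ r := by
  have key : ∀ K L : ConvexBody (Eucl n), (∀ u, hs K u - hs L u ≤ r) →
      ∀ x ∈ K, ∃ y ∈ L, dist x y ≤ r := by
    intro K L h x hx
    have : x ∈ L + ballBody n hr := by
      refine subset_of_hs_le (fun u => ?_) hx
      rw [hs_add, hs_ballBody, Pi.add_apply]
      linarith [h u]
    obtain ⟨y, hy, z, hz, rfl⟩ := ConvexBody.mem_add.1 this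
    exact ⟨y, hy, by rw [dist_eq_norm, add_sub_cancel_left]; exact (mem_ballBody hr).1 hz⟩
  exact ConvexBody.dist_le_of _ _ hr (key K L fun u => (abs_le.1 (h u)).2)
    (key L K fun u => by linarith [(abs_le.1 (h u)).1])

theorem exists_body_of_sublinear (f : Eucl n → ℝ) (hf : ∀ t : ℝ, 0 < t → ∀ u, f (t • u) = t * f u)
    (hadd : ∀ u v, f (u + v) ≤ f u + f v) : ∃ K : ConvexBody (Eucl n), ∀ u, supp K u = f u := by
  have h0 : f 0 = 0 := by
    have := hf 2 two_pos 0
    rw [smul_zero] at this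
    linarith
  have key : ∀ u₀, ∃ x : Eucl n, (∀ u, ⟪x, u⟫_ℝ ≤ f u) ∧ ⟪x, u₀⟫_ℝ = f u₀ := by
    intro u₀
    have hz : ∀ c : ℝ, c • u₀ = 0 → c • f u₀ = 0 := by
      intro c hc
      rcases smul_eq_zero.1 hc with h | h
      · rw [h, zero_smul]
      · rw [h, h0, smul_zero]
    obtain ⟨g, hg, hgf⟩ := exists_extension_of_le_sublinear
      (LinearPMap.mkSpanSingleton' u₀ (f u₀) hz) f hf hadd (by
        rintro ⟨x, hx⟩
        obtain ⟨c, rfl⟩ := Submodule.mem_span_singleton.1 hx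
        rw [LinearPMap.mkSpanSingleton'_apply]
        change c * f u₀ ≤ f (c • u₀)
        rcases lt_trichotomy c 0 with hc | rfl | hc
        · have h1 := hadd (c • u₀) ((-c) • u₀)
          rw [← add_smul, add_neg_cancel, zero_smul, h0, hf (-c) (by linarith)] at h1
          linarith
        · simp [h0]
        · rw [hf c hc])
    set G : Eucl n →L[ℝ] ℝ := LinearMap.toContinuousLinearMap g
    refine ⟨(InnerProductSpace.toDual ℝ (Eucl n)).symm G, fun u => ?_, ?_⟩
    · rw [InnerProductSpace.toDual_symm_apply]
      exact hgf u
    · rw [InnerProductSpace.toDual_symm_apply]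
      have := hg ⟨u₀, Submodule.mem_span_singleton_self u₀⟩
      exact this.trans (LinearPMap.mkSpanSingleton'_apply_self (σ := RingHom.id ℝ) u₀ (f u₀) hz _)
  set S : Set (Eucl n) := {x | ∀ u, ⟪x, u⟫_ℝ ≤ f u} with hS
  have hclosed : IsClosed S := by
    rw [hS, Set.ofPred_forall]
    exact isClosed_iInter fun u => isClosed_le (by fun_prop) continuous_const
  have hconv : Convex ℝ S := by
    intro x hx y hy a b ha hb hab u
    rw [inner_add_left, real_inner_smul_left, real_inner_smul_left]
    calc a * ⟪x, u⟫_ℝ + b * ⟪y, u⟫_ℝ ≤ a * f u + b * f u :=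
          add_le_add (mul_le_mul_of_nonneg_left (hx u) ha) (mul_le_mul_of_nonneg_left (hy u) hb)
      _ = f u := by rw [← add_mul, hab, one_mul]
  have hbdd : Bornology.IsBounded S := by
    set b := EuclideanSpace.basisFun (Fin n) ℝ
    refine isBounded_iff_forall_norm_le.2 ⟨∑ i, (|f (b i)| + |f (-b i)|), fun x hx => ?_⟩
    rw [← b.sum_repr' x]
    refine (norm_sum_le _ _).trans (Finset.sum_le_sum fun i _ => ?_)
    rw [norm_smul, b.norm_eq_one, mul_one, Real.norm_eq_abs, real_inner_comm]
    have h1 := hx (b i)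
    have h2 := hx (-b i)
    rw [inner_neg_right] at h2
    rw [abs_le]
    constructor <;> linarith [le_abs_self (f (b i)), le_abs_self (f (-b i)),
      abs_nonneg (f (b i)), abs_nonneg (f (-b i))]
  obtain ⟨x₀, hx₀, -⟩ := key 0
  refine ⟨⟨S, hconv, Metric.isCompact_of_isClosed_isBounded hclosed hbdd, ⟨x₀, hx₀⟩⟩,
    fun u => ?_⟩
  obtain ⟨x, hx, hxu⟩ := key u
  exact le_antisymm (supp_le fun y hy => hy u) (hxu ▸ inner_le_supp (K := ⟨S, _, _, _⟩) hx u)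

theorem exists_body_of_sphere (f : Sph n → ℝ)
    (hf : ∀ (a b v : Sph n) (s t r : ℝ), 0 ≤ s → 0 ≤ t → 0 ≤ r →
      s • (a : Eucl n) + t • (b : Eucl n) = r • (v : Eucl n) → r * f v ≤ s * f a + t * f b) :
    ∃ K : ConvexBody (Eucl n), hs K = f := by
  classical
  have hunit : ∀ u : Eucl n, u ≠ 0 → ‖u‖⁻¹ • u ∈ Metric.sphere (0 : Eucl n) 1 := fun u hu => by
    rw [mem_sphere_zero_iff_norm, norm_smul, norm_inv, norm_norm,
      inv_mul_cancel₀ (norm_ne_zero_iff.2 hu)]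
  set F : Eucl n → ℝ := fun u =>
    if hu : u = 0 then 0 else ‖u‖ * f ⟨‖u‖⁻¹ • u, hunit u hu⟩ with hF
  have hF0 : F 0 = 0 := by simp [hF]
  have hFne : ∀ u (hu : u ≠ 0), F u = ‖u‖ * f ⟨‖u‖⁻¹ • u, hunit u hu⟩ := fun u hu => by
    simp [hF, hu]
  have hback : ∀ u : Eucl n, u ≠ 0 → ‖u‖ • (‖u‖⁻¹ • u) = u := fun u hu => by
    rw [smul_smul, mul_inv_cancel₀ (norm_ne_zero_iff.2 hu), one_smul]
  obtain ⟨K, hK⟩ := exists_body_of_sublinear F (by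
    intro t ht u
    by_cases hu : u = 0
    · rw [hu, smul_zero, hF0, mul_zero]
    · have htu : t • u ≠ 0 := smul_ne_zero ht.ne' hu
      have heq : (⟨‖t • u‖⁻¹ • t • u, hunit _ htu⟩ : Sph n) = ⟨‖u‖⁻¹ • u, hunit u hu⟩ := by
        apply Subtype.ext
        change ‖t • u‖⁻¹ • t • u = ‖u‖⁻¹ • u
        rw [smul_smul, norm_smul, Real.norm_of_nonneg ht.le]
        congr 1
        field_simp
      rw [hFne _ htu, hFne _ hu, heq, norm_smul, Real.norm_of_nonneg ht.le, mul_assoc]) (by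
    intro u v
    by_cases hu : u = 0
    · rw [hu, zero_add, hF0, zero_add]
    by_cases hv : v = 0
    · rw [hv, add_zero, hF0, add_zero]
    by_cases huv : u + v = 0
    · rw [huv, hF0, hFne _ hu, hFne _ hv]
      have := hf ⟨_, hunit u hu⟩ ⟨_, hunit v hv⟩ ⟨_, hunit u hu⟩ ‖u‖ ‖v‖ 0 (norm_nonneg _)
        (norm_nonneg _) le_rfl (by
          change ‖u‖ • (‖u‖⁻¹ • u) + ‖v‖ • (‖v‖⁻¹ • v) = (0 : ℝ) • (‖u‖⁻¹ • u)
          rw [hback u hu, hback v hv, huv, zero_smul])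
      linarith
    · rw [hFne _ huv, hFne _ hu, hFne _ hv]
      refine hf _ _ _ _ _ _ (norm_nonneg _) (norm_nonneg _) (norm_nonneg _) ?_
      change ‖u‖ • (‖u‖⁻¹ • u) + ‖v‖ • (‖v‖⁻¹ • v) = ‖u + v‖ • (‖u + v‖⁻¹ • (u + v))
      rw [hback u hu, hback v hv, hback _ huv])
  refine ⟨K, funext fun u => ?_⟩
  have hu := norm_sph u
  have hu0 : (u : Eucl n) ≠ 0 := by
    intro h
    rw [h, norm_zero] at hu
    exact zero_ne_one hu
  rw [hs, hK, hFne _ hu0]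
  have : (⟨‖(u : Eucl n)‖⁻¹ • (u : Eucl n), hunit _ hu0⟩ : Sph n) = u := by
    apply Subtype.ext
    change ‖(u : Eucl n)‖⁻¹ • (u : Eucl n) = u
    rw [hu, inv_one, one_smul]
  rw [this, hu, one_mul]

theorem inter_of_hs_min {K L I : ConvexBody (Eucl n)} (h : ∀ u, hs I u = min (hs K u) (hs L u)) :
    (I : Set (Eucl n)) = (K : Set (Eucl n)) ∩ L := by
  refine Set.Subset.antisymm (Set.subset_inter
    (subset_of_hs_le fun u => by rw [h]; exact min_le_left _ _)
    (subset_of_hs_le fun u => by rw [h]; exact min_le_right _ _)) ?_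
  rintro x ⟨hK, hL⟩
  exact mem_of_forall_inner_le_hs fun u => by
    rw [h]
    exact le_min (inner_le_supp hK _) (inner_le_supp hL _)

theorem supp_eq_of_hs {K L : ConvexBody (Eucl n)} {op : ℝ → ℝ → ℝ} {M : ConvexBody (Eucl n)}
    (hop : ∀ t a b : ℝ, 0 ≤ t → t * op a b = op (t * a) (t * b))
    (h : ∀ u, hs M u = op (hs K u) (hs L u)) (u : Eucl n) (hu : u ≠ 0) :
    supp M u = op (supp K u) (supp L u) := by
  have hn : 0 < ‖u‖ := norm_pos_iff.2 hu
  have hmem : ‖u‖⁻¹ • u ∈ Metric.sphere (0 : Eucl n) 1 := by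
    rw [mem_sphere_zero_iff_norm, norm_smul, norm_inv, norm_norm, inv_mul_cancel₀ hn.ne']
  have hback : u = ‖u‖ • (‖u‖⁻¹ • u) := by rw [smul_smul, mul_inv_cancel₀ hn.ne', one_smul]
  have := h ⟨_, hmem⟩
  simp only [hs] at this
  rw [hback, supp_smul hn.le, supp_smul hn.le, supp_smul hn.le, this, hop _ _ _ hn.le]

theorem union_of_hs_max {K L M I : ConvexBody (Eucl n)}
    (hM : ∀ u, hs M u = max (hs K u) (hs L u)) (hI : ∀ u, hs I u = min (hs K u) (hs L u)) :
    (M : Set (Eucl n)) = (K : Set (Eucl n)) ∪ L := by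
  refine Set.Subset.antisymm ?_ (Set.union_subset
    (subset_of_hs_le fun u => by rw [hM]; exact le_max_left _ _)
    (subset_of_hs_le fun u => by rw [hM]; exact le_max_right _ _))
  intro x hx
  by_contra hcon
  rw [Set.mem_union, not_or] at hcon
  have exK : ∀ K : ConvexBody (Eucl n), x ∉ K → ∃ u : Eucl n, u ≠ 0 ∧ supp K u < ⟪x, u⟫_ℝ := by
    intro K hxK
    by_contra! hcon
    refine hxK (mem_of_forall_inner_le fun u hu => hcon u ?_)
    rintro rfl
    simp at hu
  obtain ⟨u, hu0, hu⟩ := exK K hcon.1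
  obtain ⟨w, hw0, hw⟩ := exK L hcon.2
  have hmin : ∀ p : Eucl n, p ≠ 0 → supp I p = min (supp K p) (supp L p) :=
    supp_eq_of_hs (fun t a b ht => mul_min_of_nonneg a b ht) hI
  have hmax : ∀ p : Eucl n, p ≠ 0 → supp M p = max (supp K p) (supp L p) :=
    supp_eq_of_hs (fun t a b ht => mul_max_of_nonneg a b ht) hM
  have hneg : ∀ p ∈ segment ℝ u w, supp I p < ⟪x, p⟫_ℝ := by
    rintro _ ⟨a, b, ha, hb, hab, rfl⟩
    have h1 : supp I u < ⟪x, u⟫_ℝ := by rw [hmin u hu0]; exact (min_le_left _ _).trans_lt hu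
    have h2 : supp I w < ⟪x, w⟫_ℝ := by rw [hmin w hw0]; exact (min_le_right _ _).trans_lt hw
    have h3 := supp_add_le I (a • u) (b • w)
    rw [supp_smul ha, supp_smul hb] at h3
    rw [inner_add_right, real_inner_smul_right, real_inner_smul_right]
    rcases ha.eq_or_lt with rfl | ha
    · have : b = 1 := by linarith
      subst this
      linarith
    · nlinarith [mul_lt_mul_of_pos_left h1 ha, mul_le_mul_of_nonneg_left h2.le hb]
  have hne : ∀ p ∈ segment ℝ u w, p ≠ 0 := by
    rintro p hp rfl
    have h1 := hneg 0 hp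
    have h2 : supp I 0 = 0 := by
      have := supp_smul le_rfl I 0
      rwa [zero_smul, zero_mul] at this
    rw [h2, inner_zero_right] at h1
    exact lt_irrefl _ h1
  have hopen : ∀ K : ConvexBody (Eucl n), IsOpen {p : Eucl n | supp K p < ⟪x, p⟫_ℝ} :=
    fun K => isOpen_lt (continuous_supp K) (by fun_prop)
  obtain ⟨p, hp, hpK, hpL⟩ := (convex_segment u w).isPreconnected _ _ (hopen K) (hopen L)
    (fun p hp => by
      have h1 := hneg p hp
      rw [hmin p (hne p hp), min_lt_iff] at h1
      exact h1)
    ⟨u, left_mem_segment ℝ u w, hu⟩ ⟨w, right_mem_segment ℝ u w, hw⟩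
  have h1 := inner_le_supp hx p
  rw [hmax p (hne p hp)] at h1
  exact absurd h1 (not_le.2 (max_lt hpK hpL))

end Support

section MultilinearSpan

variable {E M : Type*} [AddCommGroup E] [Module ℝ E] [AddCommGroup M] [Module ℝ M]

theorem MultilinearMap.mem_of_mem_span (N : Submodule ℝ M) :
    ∀ {d : ℕ} (Φ : MultilinearMap ℝ (fun _ : Fin d => E) M) (s : Fin d → Set E),
      (∀ x, (∀ i, x i ∈ s i) → Φ x ∈ N) → ∀ x, (∀ i, x i ∈ Submodule.span ℝ (s i)) → Φ x ∈ N
  | 0, Φ, s, h, x, _ => h x fun i => i.elim0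
  | d + 1, Φ, s, h, x, hx => by
    have key : Submodule.span ℝ (s 0) ≤ N.comap
        ({ toFun := fun e => Φ.curryLeft e (Fin.tail x)
           map_add' := fun a b => by simp
           map_smul' := fun a b => by simp } : E →ₗ[ℝ] M) := by
      refine Submodule.span_le.2 fun e he => ?_
      refine mem_of_mem_span N (Φ.curryLeft e) (fun i => s i.succ) (fun y hy => ?_) (Fin.tail x)
        fun i => hx i.succ
      rw [MultilinearMap.curryLeft_apply]
      refine h _ fun i => ?_
      induction i using Fin.cases with
      | zero => exact he
      | succ i => exact hy i
    have := key (hx 0)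
    rw [Submodule.mem_comap] at this
    change Φ.curryLeft (x 0) (Fin.tail x) ∈ N at this
    rwa [MultilinearMap.curryLeft_apply, Fin.cons_self_tail] at this

theorem MultilinearMap.abs_le_of_sub :
    ∀ {d : ℕ} (Φ : MultilinearMap ℝ (fun _ : Fin d => E) ℝ) (s : Fin d → Set E) (C : ℝ),
      (∀ x, (∀ i, x i ∈ s i) → |Φ x| ≤ C) →
      ∀ x, (∀ i, ∃ a ∈ s i, ∃ b ∈ s i, x i = a - b) → |Φ x| ≤ 2 ^ d * C
  | 0, Φ, s, C, h, x, _ => by simpa using h x fun i => i.elim0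
  | d + 1, Φ, s, C, h, x, hx => by
    have key : ∀ e ∈ s 0, |Φ.curryLeft e (Fin.tail x)| ≤ 2 ^ d * C := by
      intro e he
      refine abs_le_of_sub (Φ.curryLeft e) (fun i => s i.succ) C (fun y hy => ?_) (Fin.tail x)
        fun i => hx i.succ
      rw [MultilinearMap.curryLeft_apply]
      refine h _ fun i => ?_
      induction i using Fin.cases with
      | zero => exact he
      | succ i => exact hy i
    obtain ⟨a, ha, b, hb, hab⟩ := hx 0
    have h1 : Φ x = Φ.curryLeft a (Fin.tail x) - Φ.curryLeft b (Fin.tail x) := by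
      rw [← sub_apply, ← map_sub, ← hab, MultilinearMap.curryLeft_apply,
        Fin.cons_self_tail]
    rw [h1]
    refine (abs_sub _ _).trans ?_
    rw [pow_succ]
    linarith [key a ha, key b hb]

end MultilinearSpan

section Symbols

variable {V : Type*} [NormedAddCommGroup V] [NormedSpace ℝ V] {n : ℕ}

/-- The top-order iterated difference of `φ` at the origin. -/
def symF : (d : ℕ) → (ConvexBody V → ℝ) → (Fin d → ConvexBody V) → ℝ
  | 0, φ, _ => φ 0
  | d + 1, φ, L => symF d (diffOp (L 0) φ) (Fin.tail L)

theorem diffOp_add (L : ConvexBody V) (φ ψ : ConvexBody V → ℝ) :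
    diffOp L (φ + ψ) = diffOp L φ + diffOp L ψ := by
  funext K
  simp only [diffOp, Pi.add_apply]
  ring

theorem diffOp_smul (L : ConvexBody V) (c : ℝ) (φ : ConvexBody V → ℝ) :
    diffOp L (c • φ) = c • diffOp L φ := by
  funext K
  simp only [diffOp, Pi.smul_apply, smul_eq_mul]
  ring

theorem diffOp_comm (L L' : ConvexBody V) (φ : ConvexBody V → ℝ) :
    diffOp L (diffOp L' φ) = diffOp L' (diffOp L φ) := by
  funext K
  simp only [diffOp, add_right_comm K L L']
  ring

theorem diffOp_body_add (L L' : ConvexBody V) (φ : ConvexBody V → ℝ) :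
    diffOp (L + L') φ = diffOp L φ + diffOp L' φ + diffOp L (diffOp L' φ) := by
  funext K
  simp only [diffOp, Pi.add_apply, add_assoc]
  ring

theorem IsPolyVal.add : ∀ {j : ℕ} {φ ψ : ConvexBody V → ℝ}, IsPolyVal j φ → IsPolyVal j ψ →
    IsPolyVal j (φ + ψ)
  | 0, _, _, h, h' => by
    rw [IsPolyVal] at h h' ⊢
    rw [h, h', add_zero]
  | _ + 1, _, _, h, h' => fun L => by
    rw [diffOp_add]
    exact IsPolyVal.add (h L) (h' L)

theorem IsPolyVal.smul (c : ℝ) : ∀ {j : ℕ} {φ : ConvexBody V → ℝ}, IsPolyVal j φ →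
    IsPolyVal j (c • φ)
  | 0, _, h => by
    rw [IsPolyVal] at h ⊢
    rw [h, smul_zero]
  | _ + 1, _, h => fun L => by
    rw [diffOp_smul]
    exact IsPolyVal.smul c (h L)

theorem IsPolyVal.zero : ∀ j : ℕ, IsPolyVal j (0 : ConvexBody V → ℝ)
  | 0 => rfl
  | j + 1 => fun L => by
    have : diffOp L (0 : ConvexBody V → ℝ) = 0 := by
      funext K
      simp [diffOp]
    rw [this]
    exact IsPolyVal.zero j

theorem IsPolyVal.of_symF_eq_zero : ∀ {d : ℕ} {φ : ConvexBody V → ℝ}, IsPolyVal (d + 1) φ →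
    (∀ L, symF d φ L = 0) → IsPolyVal d φ
  | 0, φ, h, h0 => by
    have h1 : φ 0 = 0 := h0 Fin.elim0
    funext K
    have h2 : diffOp K φ 0 = 0 := congrFun (h K) 0
    rw [diffOp, zero_add, h1, sub_zero] at h2
    exact h2
  | d + 1, φ, h, h0 => fun L =>
    IsPolyVal.of_symF_eq_zero (h L) fun L' => by
      simpa [symF] using h0 (Fin.cons L L')

theorem symF_eq_zero : ∀ {d : ℕ} {φ : ConvexBody V → ℝ}, IsPolyVal d φ → ∀ L, symF d φ L = 0
  | 0, _, h, _ => congrFun h 0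
  | _ + 1, _, h, L => symF_eq_zero (h (L 0)) _

theorem symF_add : ∀ {d : ℕ} (φ ψ : ConvexBody V → ℝ) (L : Fin d → ConvexBody V),
    symF d (φ + ψ) L = symF d φ L + symF d ψ L
  | 0, _, _, _ => rfl
  | d + 1, φ, ψ, L => by
    rw [symF, diffOp_add, symF_add]
    rfl

theorem symF_smul (c : ℝ) : ∀ {d : ℕ} (φ : ConvexBody V → ℝ) (L : Fin d → ConvexBody V),
    symF d (c • φ) L = c * symF d φ L
  | 0, _, _ => rfl
  | d + 1, φ, L => by
    rw [symF, diffOp_smul, symF_smul]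
    rfl

theorem continuous_symF {X : Type*} [TopologicalSpace X] :
    ∀ {d : ℕ} (φ : X → ConvexBody V → ℝ) (L : X → Fin d → ConvexBody V),
      Continuous (fun p : X × ConvexBody V => φ p.1 p.2) → Continuous L →
      Continuous fun x => symF d (φ x) (L x)
  | 0, φ, _, hφ, _ => hφ.comp (continuous_id.prodMk continuous_const)
  | d + 1, φ, L, hφ, hL => by
    refine continuous_symF (fun x => diffOp (L x 0) (φ x)) (fun x => Fin.tail (L x)) ?_
      (continuous_pi fun i => (continuous_apply i.succ).comp hL)
    have h0 : Continuous fun x => L x 0 := (continuous_apply 0).comp hL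
    exact (hφ.comp (continuous_fst.prodMk
      (continuous_snd.add (h0.comp continuous_fst)))).sub hφ

theorem eq_mul_of_additive {a : ℝ → ℝ} (hadd : ∀ s t, 0 ≤ s → 0 ≤ t → a (s + t) = a s + a t)
    (hc : Continuous a) {t : ℝ} (ht : 0 ≤ t) : a t = t * a 1 := by
  have hb : ∀ p q, 0 ≤ p → 0 ≤ q → a (max (p - q) 0) - a (max (-(p - q)) 0) = a p - a q := by
    intro p q hp hq
    have h1 := hadd p (max (-(p - q)) 0) hp (le_max_right _ _)
    have h2 := hadd q (max (p - q) 0) hq (le_max_right _ _)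
    have h3 : p + max (-(p - q)) 0 = q + max (p - q) 0 := by
      rcases le_total p q with h | h
      · rw [max_eq_left (by linarith), max_eq_right (by linarith)]; ring
      · rw [max_eq_right (by linarith), max_eq_left (by linarith)]; ring
    rw [h3] at h1
    linarith
  let b : ℝ →+ ℝ := AddMonoidHom.mk' (fun t => a (max t 0) - a (max (-t) 0)) (by
    intro s t
    have h1 := hb (max s 0 + max t 0) (max (-s) 0 + max (-t) 0) (by positivity) (by positivity)
    have h2 : max s 0 + max t 0 - (max (-s) 0 + max (-t) 0) = s + t := by
      rcases le_total s 0 with h | h <;> rcases le_total t 0 with h' | h' <;> simp [h, h'] <;> ring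
    rw [h2, hadd _ _ (le_max_right _ _) (le_max_right _ _),
      hadd _ _ (le_max_right _ _) (le_max_right _ _)] at h1
    linarith)
  have hbc : Continuous b := by
    change Continuous fun t => a (max t 0) - a (max (-t) 0)
    fun_prop
  have h0 : a 0 = 0 := by
    have := hadd 0 0 le_rfl le_rfl
    rw [add_zero] at this
    linarith
  have hpos : ∀ t, 0 ≤ t → b t = a t := fun t ht => by
    change a (max t 0) - a (max (-t) 0) = a t
    rw [max_eq_left ht, max_eq_right (by linarith), h0, sub_zero]
  have := map_real_smul b hbc t 1
  rw [smul_eq_mul, mul_one, smul_eq_mul, hpos t ht, hpos 1 zero_le_one] at this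
  exact this

theorem symF_cons_add {d : ℕ} {φ : ConvexBody V → ℝ} (h : IsPolyVal (d + 2) φ)
    (A B : ConvexBody V) (L : Fin d → ConvexBody V) :
    symF (d + 1) φ (Fin.cons (A + B) L) =
      symF (d + 1) φ (Fin.cons A L) + symF (d + 1) φ (Fin.cons B L) := by
  simp only [symF, Fin.cons_zero, Fin.tail_cons]
  rw [diffOp_body_add, symF_add, symF_add, symF_eq_zero (h B A), add_zero]

theorem symF_cons_smul {d : ℕ} {φ : ConvexBody V → ℝ} (h : IsPolyVal (d + 2) φ)
    (hc : Continuous φ) {t : ℝ} (ht : 0 ≤ t) (A : ConvexBody V) (L : Fin d → ConvexBody V) :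
    symF (d + 1) φ (Fin.cons (t • A) L) = t * symF (d + 1) φ (Fin.cons A L) := by
  have := eq_mul_of_additive (a := fun t => symF (d + 1) φ (Fin.cons (t • A) L)) (by
    intro s t hs ht
    simp only [ConvexBody.add_smul_of_nonneg A hs ht, symF_cons_add h]) (by
    refine continuous_symF (fun _ => φ) _ (hc.comp continuous_snd) ?_
    refine continuous_pi fun i => ?_
    induction i using Fin.cases with
    | zero => exact continuous_id.smul continuous_const
    | succ i => exact continuous_const) ht
  simpa using this

end Symbols

section SymbolExtension

variable {n : ℕ}

/-- The space of differences of support functions. -/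
def bodySpan (n : ℕ) : Submodule ℝ (Sph n → ℝ) where
  carrier := {f | ∃ K L : ConvexBody (Eucl n), f = hs K - hs L}
  zero_mem' := ⟨0, 0, (sub_self _).symm⟩
  add_mem' := by
    rintro _ _ ⟨K, L, rfl⟩ ⟨K', L', rfl⟩
    refine ⟨K + K', L + L', ?_⟩
    rw [hs_add, hs_add]
    abel
  smul_mem' := by
    rintro c _ ⟨K, L, rfl⟩
    rcases le_total 0 c with hc | hc
    · exact ⟨c • K, c • L, by rw [hs_smul hc, hs_smul hc, smul_sub]⟩
    · refine ⟨(-c) • L, (-c) • K, ?_⟩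
      rw [hs_smul (neg_nonneg.2 hc), hs_smul (neg_nonneg.2 hc), ← smul_sub, neg_smul, ← smul_neg,
        neg_sub]

theorem hs_mem_bodySpan (K : ConvexBody (Eucl n)) : hs K ∈ bodySpan n :=
  ⟨K, 0, by rw [hs_zero, sub_zero]⟩

/-- The support function as an element of `bodySpan n`. -/
def hsD (K : ConvexBody (Eucl n)) : bodySpan n := ⟨hs K, hs_mem_bodySpan K⟩

theorem span_range_hsD : Submodule.span ℝ (Set.range (hsD (n := n))) = ⊤ := by
  refine eq_top_iff.2 fun x _ => ?_
  obtain ⟨f, K, L, hf⟩ := x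
  have : (⟨f, K, L, hf⟩ : bodySpan n) = hsD K - hsD L := Subtype.ext hf
  rw [this]
  exact sub_mem (Submodule.subset_span ⟨K, rfl⟩) (Submodule.subset_span ⟨L, rfl⟩)

theorem span_range_hs : Submodule.span ℝ (Set.range (hs (n := n))) = bodySpan n := by
  refine le_antisymm (Submodule.span_le.2 ?_) ?_
  · rintro _ ⟨K, rfl⟩
    exact hs_mem_bodySpan K
  · rintro _ ⟨K, L, rfl⟩
    exact sub_mem (Submodule.subset_span ⟨K, rfl⟩) (Submodule.subset_span ⟨L, rfl⟩)

theorem exists_linearMap_extending {M : Type*} [AddCommGroup M] [Module ℝ M]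
    (A : ConvexBody (Eucl n) → M) (hadd : ∀ K L, A (K + L) = A K + A L)
    (hsmul : ∀ t : ℝ, 0 ≤ t → ∀ K, A (t • K) = t • A K) :
    ∃ T : bodySpan n →ₗ[ℝ] M, ∀ K, T (hsD K) = A K := by
  choose P Q hPQ using fun x : bodySpan n => x.2
  have key : ∀ (x : bodySpan n) (K L : ConvexBody (Eucl n)), (x : Sph n → ℝ) = hs K - hs L →
      A (P x) - A (Q x) = A K - A L := by
    intro x K L h
    have h1 : P x + L = K + Q x := by
      apply hs_injective
      rw [hs_add, hs_add]
      have h2 := (hPQ x).symm.trans h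
      rw [sub_eq_sub_iff_add_eq_add] at h2
      exact h2
    have h3 := congrArg A h1
    rw [hadd, hadd] at h3
    rw [sub_eq_sub_iff_add_eq_add, h3]
  refine ⟨{ toFun := fun x => A (P x) - A (Q x), map_add' := fun x y => ?_,
            map_smul' := fun c x => ?_ }, fun K => ?_⟩
  · rw [key (x + y) (P x + P y) (Q x + Q y), hadd, hadd]
    · abel
    · rw [hs_add, hs_add, Submodule.coe_add, hPQ x, hPQ y]
      abel
  · rw [RingHom.id_apply]
    rcases le_total 0 c with hc | hc
    · rw [key (c • x) (c • P x) (c • Q x), hsmul c hc, hsmul c hc, smul_sub]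
      rw [hs_smul hc, hs_smul hc, ← smul_sub, ← hPQ x, Submodule.coe_smul]
    · have hc' := neg_nonneg.2 hc
      rw [key (c • x) ((-c) • Q x) ((-c) • P x), hsmul _ hc', hsmul _ hc', ← smul_sub, neg_smul,
        ← smul_neg, neg_sub]
      rw [hs_smul hc', hs_smul hc', ← smul_sub, neg_smul, ← smul_neg, neg_sub, ← hPQ x,
        Submodule.coe_smul]
  · change A (P (hsD K)) - A (Q (hsD K)) = A K
    have h0 : A 0 = 0 := by
      have := hadd 0 0
      rwa [add_zero, left_eq_add] at this
    rw [key (hsD K) K 0 (by rw [hs_zero, sub_zero]; rfl), h0, sub_zero]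

theorem multilinearMap_ext_hsD {M : Type*} [AddCommGroup M] [Module ℝ M] {d : ℕ}
    {Φ Ψ : MultilinearMap ℝ (fun _ : Fin d => bodySpan n) M}
    (h : ∀ L : Fin d → ConvexBody (Eucl n), Φ (fun i => hsD (L i)) = Ψ fun i => hsD (L i)) :
    Φ = Ψ := by
  ext x
  have := MultilinearMap.mem_of_mem_span ⊥ (Φ - Ψ) (fun _ => Set.range hsD) (fun x hx => by
    choose L hL using hx
    have : x = fun i => hsD (L i) := funext fun i => (hL i).symm
    rw [this, Submodule.mem_bot, sub_apply, h, sub_self]) x fun i => by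
      rw [span_range_hsD]
      trivial
  rwa [Submodule.mem_bot, sub_apply, sub_eq_zero] at this

theorem exists_symbol_bodySpan : ∀ (d : ℕ) {φ : ConvexBody (Eucl n) → ℝ}, Continuous φ →
    IsPolyVal (d + 1) φ → ∃ Φ : MultilinearMap ℝ (fun _ : Fin d => bodySpan n) ℝ,
      ∀ L : Fin d → ConvexBody (Eucl n), Φ (fun i => hsD (L i)) = symF d φ L
  | 0, φ, _, _ => ⟨MultilinearMap.constOfIsEmpty ℝ _ (φ 0), fun _ => rfl⟩
  | d + 1, φ, hc, h => by
    have hcd : ∀ L, Continuous (diffOp L φ) := fun L =>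
      (hc.comp (continuous_id.add continuous_const)).sub hc
    choose Ψ hΨ using fun L₀ => exists_symbol_bodySpan d (hcd L₀) (h L₀)
    have hΨ' : ∀ L₀ L, Ψ L₀ (fun i => hsD (L i)) = symF (d + 1) φ (Fin.cons L₀ L) := fun L₀ L => by
      rw [hΨ, symF, Fin.cons_zero, Fin.tail_cons]
    obtain ⟨T, hT⟩ := exists_linearMap_extending Ψ
      (fun K L => multilinearMap_ext_hsD fun L' => by
        rw [add_apply, hΨ', hΨ', hΨ', symF_cons_add h])
      (fun t ht K => multilinearMap_ext_hsD fun L' => by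
        rw [smul_apply, hΨ', hΨ', symF_cons_smul h hc ht, smul_eq_mul])
    refine ⟨LinearMap.uncurryLeft T, fun L => ?_⟩
    rw [LinearMap.uncurryLeft_apply, hT]
    exact hΨ (L 0) (Fin.tail L)

/-- `Φ` is a multilinear extension to all functions on the sphere of the top-order iterated
difference of `φ`. -/
def IsSymbol (d : ℕ) (φ : ConvexBody (Eucl n) → ℝ)
    (Φ : MultilinearMap ℝ (fun _ : Fin d => Sph n → ℝ) ℝ) : Prop :=
  ∀ L : Fin d → ConvexBody (Eucl n), Φ (fun i => hs (L i)) = symF d φ L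

theorem exists_symbol (d : ℕ) {φ : ConvexBody (Eucl n) → ℝ} (hc : Continuous φ)
    (h : IsPolyVal (d + 1) φ) : ∃ Φ, IsSymbol d φ Φ := by
  obtain ⟨Φ, hΦ⟩ := exists_symbol_bodySpan d hc h
  obtain ⟨P, hP⟩ := (bodySpan n).subtype.exists_leftInverse_of_injective
    (Submodule.ker_subtype _)
  refine ⟨Φ.compLinearMap fun _ => P, fun L => ?_⟩
  rw [MultilinearMap.compLinearMap_apply, ← hΦ]
  congr 1
  funext i
  exact LinearMap.congr_fun hP (hsD (L i))

end SymbolExtension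

section SymbolProperties

open scoped InnerProductSpace

variable {V : Type*} [NormedAddCommGroup V] [NormedSpace ℝ V] {n : ℕ}

theorem abs_symF_le : ∀ {d : ℕ} {φ : ConvexBody V → ℝ} {R B : ℝ} (L : Fin d → ConvexBody V),
    0 ≤ R → (∀ K : ConvexBody V, K.InBall (R + d) → |φ K| ≤ B) → (∀ i, (L i).InBall 1) →
    |symF d φ L| ≤ 2 ^ d * B
  | 0, φ, R, B, L, hR, h, _ => by
    rw [pow_zero, one_mul]
    refine h 0 fun x hx => ?_
    have : x = 0 := hx
    simpa [this] using hR
  | d + 1, φ, R, B, L, hR, h, hL => by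
    rw [symF, pow_succ, mul_assoc]
    refine abs_symF_le (R := R) _ hR (fun K hK => ?_) fun i => hL i.succ
    have h1 := h (K + L 0) (by
      have := hK.add (hL 0)
      rwa [add_assoc, ← Nat.cast_succ] at this)
    have h2 := h K (hK.mono (by push_cast; linarith))
    refine (abs_sub _ _).trans ?_
    linarith

theorem symF_comp {g : ConvexBody V → ConvexBody V} (hg : ∀ K L, g (K + L) = g K + g L)
    (h0 : g 0 = 0) : ∀ {d : ℕ} (φ : ConvexBody V → ℝ) (L : Fin d → ConvexBody V),
      symF d (fun K => φ (g K)) L = symF d φ fun i => g (L i)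
  | 0, φ, L => by rw [symF, symF, h0]
  | d + 1, φ, L => by
    have : diffOp (L 0) (fun K => φ (g K)) = fun K => diffOp (g (L 0)) φ (g K) := by
      funext K
      rw [diffOp, diffOp, hg]
    rw [symF, this, symF_comp hg h0]
    rfl

theorem symF_update_eq {A B : ConvexBody V} : ∀ {d : ℕ} {μ : ConvexBody V → ℝ},
    diffOp A μ = diffOp B μ → ∀ (L : Fin d → ConvexBody V) (j : Fin d),
      symF d μ (Function.update L j A) = symF d μ (Function.update L j B)
  | 0, _, _, _, j => j.elim0
  | d + 1, μ, h, L, j => by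
    induction j using Fin.cases with
    | zero => simp only [symF, Function.update_self, Fin.tail_update_zero, h]
    | succ j =>
      simp only [symF, Fin.tail_update_succ]
      rw [Function.update_of_ne (Fin.succ_ne_zero j).symm,
        Function.update_of_ne (Fin.succ_ne_zero j).symm]
      refine symF_update_eq ?_ _ j
      rw [diffOp_comm, h, diffOp_comm]

theorem IsSymbol.bound {d : ℕ} {φ : ConvexBody (Eucl n) → ℝ}
    {Φ : MultilinearMap ℝ (fun _ : Fin d => Sph n → ℝ) ℝ} (hΦ : IsSymbol d φ Φ) (h : IsVal φ) :
    ∃ C, 0 ≤ C ∧ ∀ (f : Fin d → Sph n → ℝ) (r : Fin d → ℝ), (∀ i, 0 < r i) →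
      (∀ i, ∃ K L : ConvexBody (Eucl n), K.InBall (r i) ∧ L.InBall (r i) ∧ f i = hs K - hs L) →
      |Φ f| ≤ C * ∏ i, r i := by
  obtain ⟨C, hC, hg⟩ := h.exists_growth
  have hB : 0 ≤ C * (1 + (0 + d : ℝ)) ^ n := by positivity
  refine ⟨2 ^ d * (2 ^ d * (C * (1 + (0 + d : ℝ)) ^ n)), by positivity, fun f r hr hf => ?_⟩
  have h1 := Φ.abs_le_of_sub (fun _ => {f | ∃ K : ConvexBody (Eucl n), K.InBall 1 ∧ hs K = f})
    (2 ^ d * (C * (1 + (0 + d : ℝ)) ^ n)) (fun x hx => by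
      choose L hL hLx using hx
      rw [← funext hLx, hΦ]
      exact abs_symF_le L le_rfl (fun K hK => hg _ K (by positivity) hK) hL)
    (fun i => (r i)⁻¹ • f i) (fun i => by
      obtain ⟨K, L, hK, hL, hKL⟩ := hf i
      have hi := inv_nonneg.2 (hr i).le
      have h1 : (r i)⁻¹ * r i = 1 := inv_mul_cancel₀ (hr i).ne'
      exact ⟨_, ⟨(r i)⁻¹ • K, h1 ▸ hK.smul hi, rfl⟩, _, ⟨(r i)⁻¹ • L, h1 ▸ hL.smul hi, rfl⟩, by
        rw [hs_smul hi, hs_smul hi, ← smul_sub, hKL]⟩)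
  have h2 : Φ f = (∏ i, r i) * Φ fun i => (r i)⁻¹ • f i := by
    rw [← smul_eq_mul, ← MultilinearMap.map_smul_univ]
    congr 1
    funext i
    rw [smul_smul, mul_inv_cancel₀ (hr i).ne', one_smul]
  have h3 : 0 ≤ ∏ i, r i := Finset.prod_nonneg fun i _ => (hr i).le
  rw [h2, abs_mul, abs_of_nonneg h3, mul_comm]
  exact mul_le_mul_of_nonneg_right h1 h3

/-- The map of the sphere induced by a linear isometry. -/
def sphMap (T : Eucl n ≃ₗᵢ[ℝ] Eucl n) (u : Sph n) : Sph n :=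
  ⟨T u, by rw [mem_sphere_zero_iff_norm, T.norm_map, norm_sph]⟩

theorem hs_map (T : Eucl n ≃ₗᵢ[ℝ] Eucl n) (K : ConvexBody (Eucl n)) :
    hs (K.map (T.toContinuousLinearEquiv : Eucl n →L[ℝ] Eucl n)) = hs K ∘ sphMap T.symm := by
  have key : ∀ x u : Eucl n, ⟪T x, u⟫_ℝ = ⟪x, T.symm u⟫_ℝ := fun x u => by
    rw [← T.inner_map_map x, T.apply_symm_apply]
  funext u
  change supp _ (u : Eucl n) = supp K (T.symm u)
  refine le_antisymm (supp_le fun y hy => ?_) (supp_le fun x hx => ?_)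
  · obtain ⟨x, hx, rfl⟩ := ConvexBody.mem_map.1 hy
    exact (key x u).trans_le (inner_le_supp hx _)
  · rw [← key]
    have hmem : T x ∈ K.map (T.toContinuousLinearEquiv : Eucl n →L[ℝ] Eucl n) :=
      ConvexBody.mem_map.2 ⟨x, hx, rfl⟩
    exact inner_le_supp hmem _

theorem IsSymbol.eq_of_forall_hs {d : ℕ} {Φ Ψ : MultilinearMap ℝ (fun _ : Fin d => Sph n → ℝ) ℝ}
    (h : ∀ L : Fin d → ConvexBody (Eucl n), Φ (fun i => hs (L i)) = Ψ fun i => hs (L i))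
    {x : Fin d → Sph n → ℝ} (hx : ∀ i, x i ∈ bodySpan n) : Φ x = Ψ x := by
  have := MultilinearMap.mem_of_mem_span ⊥ (Φ - Ψ) (fun _ => Set.range hs) (fun x hx => by
    choose L hL using hx
    have : x = fun i => hs (L i) := funext fun i => (hL i).symm
    rw [this, Submodule.mem_bot, sub_apply, h, sub_self]) x fun i => by
      rw [span_range_hs]
      exact hx i
  rwa [Submodule.mem_bot, sub_apply, sub_eq_zero] at this

theorem IsSymbol.comp_sphMap {d : ℕ} {φ : ConvexBody (Eucl n) → ℝ}
    {Φ : MultilinearMap ℝ (fun _ : Fin d => Sph n → ℝ) ℝ} (hΦ : IsSymbol d φ Φ)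
    (T : Eucl n ≃ₗᵢ[ℝ] Eucl n)
    (hT : ∀ K, φ (K.map (T.toContinuousLinearEquiv : Eucl n →L[ℝ] Eucl n)) = φ K)
    {x : Fin d → Sph n → ℝ} (hx : ∀ i, x i ∈ bodySpan n) :
    Φ (fun i => x i ∘ sphMap T.symm) = Φ x := by
  let P : (Sph n → ℝ) →ₗ[ℝ] (Sph n → ℝ) := LinearMap.funLeft ℝ ℝ (sphMap T.symm)
  refine IsSymbol.eq_of_forall_hs (Φ := Φ.compLinearMap fun _ => P) (fun L => ?_) hx
  rw [MultilinearMap.compLinearMap_apply, hΦ]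
  have h1 : (fun i => P (hs (L i))) = fun i =>
      hs ((L i).map (T.toContinuousLinearEquiv : Eucl n →L[ℝ] Eucl n)) :=
    funext fun i => (hs_map T (L i)).symm
  rw [h1, hΦ, ← symF_comp (g := fun K => K.map (T.toContinuousLinearEquiv : Eucl n →L[ℝ] Eucl n))
    (ConvexBody.map_add _) (by rw [← ConvexBody.point_zero, ConvexBody.map_point, _root_.map_zero])]
  simp only [hT]

theorem IsSymbol.eq_zero_of_max_min {d : ℕ} {φ : ConvexBody (Eucl n) → ℝ}
    {Φ : MultilinearMap ℝ (fun _ : Fin (d + 1) => Sph n → ℝ) ℝ} (hΦ : IsSymbol (d + 1) φ Φ)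
    (hφ : IsVal φ) {A B M I : ConvexBody (Eucl n)} (hM : ∀ u, hs M u = max (hs A u) (hs B u))
    (hI : ∀ u, hs I u = min (hs A u) (hs B u)) (j : Fin d) {x : Fin (d + 1) → Sph n → ℝ}
    (h0 : x 0 = hs A - hs I) (hj : x j.succ = hs B - hs I) (hx : ∀ i, x i ∈ bodySpan n) :
    Φ x = 0 := by
  have hval : ∀ Y, φ (Y + M) + φ (Y + I) = φ (Y + A) + φ (Y + B) := fun Y =>
    (hφ.comp_add Y).val A B M I (union_of_hs_max hM hI) (inter_of_hs_min hI)
  have hsum : A + B = M + I := hs_injective (by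
    rw [hs_add, hs_add]
    funext u
    rw [Pi.add_apply, Pi.add_apply, hM, hI, max_add_min])
  set μ : ConvexBody (Eucl n) → ℝ := diffOp A φ + (-1 : ℝ) • diffOp I φ with hμ
  have hdiff : diffOp B μ = diffOp I μ := by
    funext Y
    have h1 := hval (Y + I)
    have h2 : Y + B + A = Y + I + M := by
      rw [add_assoc, add_comm B, hsum, add_assoc, add_comm I]
    simp only [hμ, diffOp, Pi.add_apply, Pi.smul_apply, smul_eq_mul, h2]
    rw [add_right_comm Y B I]
    linarith
  have key : ∀ L : Fin d → ConvexBody (Eucl n), ∀ Y : ConvexBody (Eucl n),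
      Φ.curryLeft (hs A - hs I) (Function.update (fun i => hs (L i)) j (hs Y)) =
        symF d μ (Function.update L j Y) := by
    intro L Y
    have h1 : Function.update (fun i => hs (L i)) j (hs Y) =
        fun i => hs (Function.update L j Y i) := by
      funext i
      rcases eq_or_ne i j with rfl | hij
      · simp
      · simp [Function.update_of_ne hij]
    have h2 : ∀ Z, Φ.curryLeft (hs Z) (fun i => hs (Function.update L j Y i)) =
        symF d (diffOp Z φ) (Function.update L j Y) := by
      intro Z
      have h3 := hΦ (Fin.cons Z (Function.update L j Y))
      rw [symF, Fin.cons_zero, Fin.tail_cons] at h3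
      rw [← h3, MultilinearMap.curryLeft_apply]
      congr 1
      funext i
      induction i using Fin.cases <;> rfl
    rw [h1, _root_.map_sub, sub_apply, h2, h2, hμ, symF_add, symF_smul]
    ring
  have := MultilinearMap.mem_of_mem_span ⊥ (Φ.curryLeft (hs A - hs I))
    (fun i => if i = j then {hs B - hs I} else Set.range hs) (fun y hy => by
      have hex : ∀ i, ∃ L : ConvexBody (Eucl n), i ≠ j → hs L = y i := by
        intro i
        by_cases hij : i = j
        · exact ⟨0, fun h => absurd hij h⟩
        · have := hy i
          rw [if_neg hij] at this
          obtain ⟨L, hL⟩ := this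
          exact ⟨L, fun _ => hL⟩
      choose L hL using hex
      have hyj : y j = hs B - hs I := by simpa using hy j
      have h1 : y = Function.update (fun i => hs (L i)) j (hs B - hs I) := by
        funext i
        rcases eq_or_ne i j with rfl | hij
        · simp [hyj]
        · rw [Function.update_of_ne hij, hL i hij]
      rw [Submodule.mem_bot, h1, MultilinearMap.map_update_sub, key, key,
        symF_update_eq hdiff, sub_self]) (Fin.tail x) (fun i => by
      by_cases hij : i = j
      · rw [if_pos hij, hij]
        exact Submodule.subset_span hj
      · rw [if_neg hij, span_range_hs]
        exact hx i.succ)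
  rw [Submodule.mem_bot, MultilinearMap.curryLeft_apply, ← h0, Fin.cons_self_tail] at this
  exact this

end SymbolProperties

section Regularity

open scoped InnerProductSpace

variable {n : ℕ}

/-- `f` is of class `C^{1,1}` on the sphere, with bounds adapted to the length scale `1 / s`. -/
def Reg (s A : ℝ) (f : Sph n → ℝ) : Prop :=
  ∀ v, |f v| ≤ A ∧ ∃ ℓ : Eucl n, ‖ℓ‖ ≤ A * s ∧ ∀ a : Sph n,
    |f a - f v - ⟪ℓ, (a : Eucl n) - v⟫_ℝ| ≤ A * s ^ 2 * ‖(a : Eucl n) - v‖ ^ 2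

variable {s A B : ℝ} {f g : Sph n → ℝ}

theorem Reg.mono (h : Reg s A f) (hs : 0 ≤ s) (hAB : A ≤ B) : Reg s B f := fun v => by
  obtain ⟨h1, ℓ, h2, h3⟩ := h v
  refine ⟨h1.trans hAB, ℓ, h2.trans (mul_le_mul_of_nonneg_right hAB hs), fun a => ?_⟩
  refine (h3 a).trans ?_
  gcongr

theorem Reg.to_one (h : Reg s A f) (hs : 1 ≤ s) : Reg 1 (A * s ^ 2) f := fun v => by
  obtain ⟨h1, ℓ, h2, h3⟩ := h v
  have hA : 0 ≤ A := (abs_nonneg _).trans h1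
  have h4 : s ≤ s ^ 2 := by nlinarith
  refine ⟨h1.trans (by nlinarith), ℓ, h2.trans (by nlinarith), fun a => ?_⟩
  simpa using h3 a

theorem Reg.abs_sub_le (h : Reg s A f) (hs : 0 ≤ s) (a v : Sph n) :
    |f a - f v| ≤ 2 * A * s * ‖(a : Eucl n) - v‖ := by
  obtain ⟨h1, ℓ, h2, h3⟩ := h v
  have hA : 0 ≤ A := (abs_nonneg _).trans h1
  set δ := ‖(a : Eucl n) - v‖ with hδ
  have hδ0 : 0 ≤ δ := norm_nonneg _
  rcases le_total (s * δ) 1 with hle | hle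
  · have h4 : |⟪ℓ, (a : Eucl n) - v⟫_ℝ| ≤ A * s * δ :=
      (abs_real_inner_le_norm _ _).trans (mul_le_mul_of_nonneg_right h2 hδ0)
    have h5 : |f a - f v| ≤ |f a - f v - ⟪ℓ, (a : Eucl n) - v⟫_ℝ| + |⟪ℓ, (a : Eucl n) - v⟫_ℝ| := by
      have := abs_add_le (f a - f v - ⟪ℓ, (a : Eucl n) - v⟫_ℝ) ⟪ℓ, (a : Eucl n) - v⟫_ℝ
      rwa [sub_add_cancel] at this
    have h6 : A * s ^ 2 * δ ^ 2 ≤ A * s * δ := by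
      have : A * (s * δ) * (s * δ) ≤ A * (s * δ) * 1 :=
        mul_le_mul_of_nonneg_left hle (by positivity)
      nlinarith
    linarith [h3 a]
  · have h4 := (abs_sub (f a) (f v)).trans (add_le_add (h a).1 h1)
    nlinarith

theorem Reg.const (hs : 0 ≤ s) (c : ℝ) : Reg s |c| (fun _ : Sph n => c) := fun v => by
  refine ⟨le_rfl, 0, by rw [norm_zero]; positivity, fun a => ?_⟩
  rw [sub_self, inner_zero_left, sub_zero, abs_zero]
  positivity

theorem Reg.add (h : Reg s A f) (h' : Reg s B g) : Reg s (A + B) (fun u => f u + g u) := fun v => by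
  obtain ⟨h1, ℓ, h2, h3⟩ := h v
  obtain ⟨h1', ℓ', h2', h3'⟩ := h' v
  refine ⟨(abs_add_le _ _).trans (add_le_add h1 h1'), ℓ + ℓ',
    (norm_add_le _ _).trans ((add_le_add h2 h2').trans_eq (by ring)), fun a => ?_⟩
  have := (abs_add_le _ _).trans (add_le_add (h3 a) (h3' a))
  rw [inner_add_left]
  refine (le_of_eq ?_).trans (this.trans_eq (by ring))
  congr 1
  ring

theorem Reg.mul (h : Reg s A f) (h' : Reg s B g) (hs : 0 ≤ s) :
    Reg s (4 * A * B) (fun u => f u * g u) := fun v => by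
  obtain ⟨h1, ℓ, h2, h3⟩ := h v
  obtain ⟨h1', ℓ', h2', h3'⟩ := h' v
  have hA : 0 ≤ A := (abs_nonneg _).trans h1
  have hB : 0 ≤ B := (abs_nonneg _).trans h1'
  refine ⟨?_, f v • ℓ' + g v • ℓ, ?_, fun a => ?_⟩
  · rw [abs_mul]
    have := mul_le_mul h1 h1' (abs_nonneg _) hA
    nlinarith [mul_nonneg hA hB]
  · refine (norm_add_le _ _).trans ?_
    rw [norm_smul, norm_smul, Real.norm_eq_abs, Real.norm_eq_abs]
    have e1 := mul_le_mul h1 h2' (norm_nonneg _) hA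
    have e2 := mul_le_mul h1' h2 (norm_nonneg _) hB
    nlinarith [mul_nonneg (mul_nonneg hA hB) hs]
  · set δ := (a : Eucl n) - v
    have hδ : 0 ≤ ‖δ‖ := norm_nonneg _
    have e1 : |g v * (f a - f v - ⟪ℓ, δ⟫_ℝ)| ≤ B * (A * s ^ 2 * ‖δ‖ ^ 2) := by
      rw [abs_mul]
      exact mul_le_mul h1' (h3 a) (abs_nonneg _) hB
    have e2 : |(f a - f v) * ⟪ℓ', δ⟫_ℝ| ≤ 2 * A * s * ‖δ‖ * (B * s * ‖δ‖) := by
      rw [abs_mul]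
      exact mul_le_mul (h.abs_sub_le hs a v) ((abs_real_inner_le_norm _ _).trans
        (mul_le_mul_of_nonneg_right h2' hδ)) (abs_nonneg _) (by positivity)
    have e3 : |f a * (g a - g v - ⟪ℓ', δ⟫_ℝ)| ≤ A * (B * s ^ 2 * ‖δ‖ ^ 2) := by
      rw [abs_mul]
      exact mul_le_mul (h a).1 (h3' a) (abs_nonneg _) hA
    have e4 : f a * g a - f v * g v - ⟪f v • ℓ' + g v • ℓ, δ⟫_ℝ =
        g v * (f a - f v - ⟪ℓ, δ⟫_ℝ) + (f a - f v) * ⟪ℓ', δ⟫_ℝ +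
          f a * (g a - g v - ⟪ℓ', δ⟫_ℝ) := by
      rw [inner_add_left, real_inner_smul_left, real_inner_smul_left]
      ring
    rw [e4]
    refine (abs_add_three _ _ _).trans ((add_le_add (add_le_add e1 e2) e3).trans_eq ?_)
    ring

theorem Reg.smul (h : Reg s A f) (c : ℝ) : Reg s (|c| * A) (fun u => c * f u) :=
  fun v => by
    obtain ⟨h1, ℓ, h2, h3⟩ := h v
    refine ⟨?_, c • ℓ, ?_, fun a => ?_⟩
    · rw [abs_mul]
      exact mul_le_mul_of_nonneg_left h1 (abs_nonneg _)
    · rw [norm_smul, Real.norm_eq_abs, mul_assoc]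
      exact mul_le_mul_of_nonneg_left h2 (abs_nonneg _)
    · rw [real_inner_smul_left, ← mul_sub, ← mul_sub, abs_mul, mul_assoc, mul_assoc, ← mul_assoc A]
      exact mul_le_mul_of_nonneg_left (h3 a) (abs_nonneg _)

theorem Reg.prod {ι : Type*} (t : Finset ι) {A : ι → ℝ} {f : ι → Sph n → ℝ} (hs : 0 ≤ s)
    (h : ∀ i ∈ t, Reg s (A i) (f i)) : Reg s (∏ i ∈ t, 4 * A i) (fun u => ∏ i ∈ t, f i u) := by
  classical
  induction t using Finset.induction_on with
  | empty => simpa using Reg.const (n := n) hs 1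
  | insert i t hi ih =>
    simp only [Finset.prod_insert hi]
    exact (h i (Finset.mem_insert_self _ _)).mul
      (ih fun j hj => h j (Finset.mem_insert_of_mem hj)) hs

theorem Reg.pow (h : Reg s A f) (hs : 0 ≤ s) (k : ℕ) : Reg s ((4 * A) ^ k) (fun u => f u ^ k) := by
  simpa using Reg.prod (Finset.range k) hs (A := fun _ => A) (f := fun _ => f) fun _ _ => h

/-- The squared positive part. -/
def posSq (x : ℝ) : ℝ := max x 0 ^ 2

theorem posSq_nonneg (x : ℝ) : 0 ≤ posSq x := sq_nonneg _

theorem posSq_of_nonpos {x : ℝ} (h : x ≤ 0) : posSq x = 0 := by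
  rw [posSq, max_eq_right h]
  norm_num

theorem posSq_of_nonneg {x : ℝ} (h : 0 ≤ x) : posSq x = x ^ 2 := by rw [posSq, max_eq_left h]

theorem abs_posSq_sub_le (x y : ℝ) :
    |posSq y - posSq x - 2 * max x 0 * (y - x)| ≤ (y - x) ^ 2 := by
  rw [posSq, posSq, abs_le]
  rcases le_total x 0 with h | h <;> rcases le_total y 0 with h' | h' <;>
    simp only [max_eq_left, max_eq_right, h, h'] <;> constructor <;> nlinarith

theorem Reg.posSq (h : Reg s A f) (hs : 0 ≤ s) : Reg s (6 * A ^ 2) (fun u => posSq (f u)) :=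
  fun v => by
    obtain ⟨h1, ℓ, h2, h3⟩ := h v
    have hA : 0 ≤ A := (abs_nonneg _).trans h1
    have hmax : ∀ u, 0 ≤ max (f u) 0 ∧ max (f u) 0 ≤ A := fun u =>
      ⟨le_max_right _ _, max_le ((le_abs_self _).trans (h u).1) hA⟩
    refine ⟨?_, (2 * max (f v) 0) • ℓ, ?_, fun a => ?_⟩
    · rw [abs_of_nonneg (posSq_nonneg _), _root_.posSq]
      nlinarith [hmax v]
    · rw [norm_smul, Real.norm_of_nonneg (by linarith [hmax v])]
      have := mul_le_mul (hmax v).2 h2 (norm_nonneg _) hA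
      nlinarith [mul_nonneg (mul_nonneg hA hA) hs]
    · set δ := (a : Eucl n) - v
      have e1 := abs_posSq_sub_le (f v) (f a)
      have e2 : |2 * max (f v) 0 * (f a - f v - ⟪ℓ, δ⟫_ℝ)| ≤ 2 * A * (A * s ^ 2 * ‖δ‖ ^ 2) := by
        rw [abs_mul, abs_of_nonneg (by linarith [hmax v])]
        exact mul_le_mul (by linarith [hmax v]) (h3 a) (abs_nonneg _) (by linarith)
      have e3 : (f a - f v) ^ 2 ≤ (2 * A * s * ‖δ‖) ^ 2 :=
        sq_le_sq' (by linarith [(abs_le.1 (h.abs_sub_le hs a v)).1])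
          (abs_le.1 (h.abs_sub_le hs a v)).2
      have e4 : _root_.posSq (f a) - _root_.posSq (f v) - ⟪(2 * max (f v) 0) • ℓ, δ⟫_ℝ =
          (_root_.posSq (f a) - _root_.posSq (f v) - 2 * max (f v) 0 * (f a - f v)) +
            2 * max (f v) 0 * (f a - f v - ⟪ℓ, δ⟫_ℝ) := by
        rw [real_inner_smul_left]
        ring
      rw [e4]
      refine (abs_add_le _ _).trans ((add_le_add (e1.trans e3) e2).trans_eq ?_)
      ring

/-- A bounded `C^{1,1}` function which is the identity on `[-2, 2]`. -/
def trunc (t : ℝ) : ℝ :=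
  t - posSq (t - 2) / 2 + posSq (t - 3) / 2 + posSq (-t - 2) / 2 - posSq (-t - 3) / 2

theorem trunc_of_abs_le {t : ℝ} (h : |t| ≤ 2) : trunc t = t := by
  obtain ⟨h1, h2⟩ := abs_le.1 h
  rw [trunc, posSq_of_nonpos, posSq_of_nonpos, posSq_of_nonpos, posSq_of_nonpos] <;> linarith

theorem abs_trunc_le (t : ℝ) : |trunc t| ≤ 3 := by
  rw [trunc, posSq, posSq, posSq, posSq, abs_le]
  rcases le_total (t - 2) 0 with h1 | h1 <;> rcases le_total (t - 3) 0 with h2 | h2 <;>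
  rcases le_total (-t - 2) 0 with h3 | h3 <;> rcases le_total (-t - 3) 0 with h4 | h4 <;>
  simp only [max_eq_left, max_eq_right, h1, h2, h3, h4] <;> constructor <;> nlinarith

theorem two_le_abs_trunc {t : ℝ} (h : 2 ≤ |t|) : 2 ≤ |trunc t| := by
  rcases le_abs.1 h with h | h
  · refine le_trans ?_ (le_abs_self _)
    rw [trunc, posSq_of_nonpos (x := -t - 2) (by linarith),
      posSq_of_nonpos (x := -t - 3) (by linarith), posSq_of_nonneg (x := t - 2) (by linarith)]
    rcases le_total t 3 with h3 | h3
    · rw [posSq_of_nonpos (by linarith)]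
      nlinarith
    · rw [posSq_of_nonneg (by linarith)]
      nlinarith
  · refine le_trans ?_ (neg_le_abs _)
    rw [trunc, posSq_of_nonpos (x := t - 2) (by linarith),
      posSq_of_nonpos (x := t - 3) (by linarith), posSq_of_nonneg (x := -t - 2) (by linarith)]
    rcases le_total (-t) 3 with h3 | h3
    · rw [posSq_of_nonpos (by linarith)]
      nlinarith
    · rw [posSq_of_nonneg (by linarith)]
      nlinarith

/-- The derivative of `trunc`. -/
def truncDeriv (t : ℝ) : ℝ :=
  1 - max (t - 2) 0 + max (t - 3) 0 - max (-t - 2) 0 + max (-t - 3) 0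

theorem abs_truncDeriv_le (t : ℝ) : |truncDeriv t| ≤ 3 := by
  rw [truncDeriv, abs_le]
  rcases le_total (t - 2) 0 with h1 | h1 <;> rcases le_total (t - 3) 0 with h2 | h2 <;>
  rcases le_total (-t - 2) 0 with h3 | h3 <;> rcases le_total (-t - 3) 0 with h4 | h4 <;>
  simp only [max_eq_left, max_eq_right, h1, h2, h3, h4] <;> constructor <;> linarith

theorem abs_trunc_sub_le (x y : ℝ) :
    |trunc y - trunc x - truncDeriv x * (y - x)| ≤ 3 * (y - x) ^ 2 := by
  have h1 := abs_le.1 (abs_posSq_sub_le (x - 2) (y - 2))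
  have h2 := abs_le.1 (abs_posSq_sub_le (x - 3) (y - 3))
  have h3 := abs_le.1 (abs_posSq_sub_le (-x - 2) (-y - 2))
  have h4 := abs_le.1 (abs_posSq_sub_le (-x - 3) (-y - 3))
  rw [sub_sub_sub_cancel_right] at h1 h2 h3 h4
  have h5 : (-y - -x) ^ 2 = (y - x) ^ 2 := by ring
  rw [h5] at h3 h4
  rw [trunc, trunc, truncDeriv, abs_le]
  constructor <;> nlinarith [sq_nonneg (y - x)]

theorem reg_coord (e : Sph n) (j : Fin n) :
    Reg 1 2 (fun u : Sph n => (u : Eucl n) j - (e : Eucl n) j) := fun v => by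
  have hc : ∀ x : Eucl n, |x j| ≤ ‖x‖ := fun x => by
    simpa using EuclideanSpace.norm_eq x ▸ PiLp.norm_apply_le x j
  refine ⟨?_, EuclideanSpace.single j 1, by simp, fun a => ?_⟩
  · refine (abs_sub _ _).trans ?_
    have h1 := hc (v : Eucl n)
    have h2 := hc (e : Eucl n)
    rw [norm_sph] at h1 h2
    linarith
  · have : ⟪EuclideanSpace.single j (1 : ℝ), (a : Eucl n) - v⟫_ℝ = (a : Eucl n) j - (v : Eucl n) j := by
      simp [EuclideanSpace.inner_single_left]
    rw [this, sub_sub_sub_cancel_right, sub_self, abs_zero]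
    positivity

theorem reg_trunc (e : Sph n) (j : Fin n) (hs : 0 ≤ s) :
    Reg s 3 (fun u : Sph n => trunc (s * ((u : Eucl n) j - (e : Eucl n) j))) := fun v => by
  have hc : ∀ x : Eucl n, |x j| ≤ ‖x‖ := fun x => by
    simpa using EuclideanSpace.norm_eq x ▸ PiLp.norm_apply_le x j
  set t := truncDeriv (s * ((v : Eucl n) j - (e : Eucl n) j)) with ht
  refine ⟨abs_trunc_le _, (t * s) • EuclideanSpace.single j 1, ?_, fun a => ?_⟩
  · rw [norm_smul, norm_mul, Real.norm_eq_abs, Real.norm_of_nonneg hs]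
    have := mul_le_mul_of_nonneg_right (abs_truncDeriv_le (s * ((v : Eucl n) j - (e : Eucl n) j))) hs
    simpa using this
  · have : ⟪(t * s) • EuclideanSpace.single j (1 : ℝ), (a : Eucl n) - v⟫_ℝ =
        t * (s * ((a : Eucl n) j - (e : Eucl n) j) - s * ((v : Eucl n) j - (e : Eucl n) j)) := by
      rw [real_inner_smul_left, EuclideanSpace.inner_single_left, PiLp.sub_apply, map_one]
      ring
    rw [this]
    refine (abs_trunc_sub_le _ _).trans ?_
    have h1 : |((a : Eucl n) - v) j| ^ 2 ≤ ‖(a : Eucl n) - v‖ ^ 2 :=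
      pow_le_pow_left₀ (abs_nonneg _) (hc _) 2
    rw [sq_abs] at h1
    have h2 : ((a : Eucl n) - v) j = (a : Eucl n) j - (v : Eucl n) j := rfl
    rw [h2] at h1
    have h3 := mul_le_mul_of_nonneg_left h1 (by positivity : 0 ≤ 3 * s ^ 2)
    refine (le_of_eq ?_).trans h3
    ring

theorem Reg.exists_body (h : Reg s A f) {C : ℝ} (hC : A * (1 + s + 2 * s ^ 2) ≤ C) :
    ∃ K : ConvexBody (Eucl n), hs K = fun u => f u + C := by
  refine exists_body_of_sphere _ fun a b v x y r hx hy hr hxy => ?_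
  obtain ⟨h1, ℓ, h2, h3⟩ := h v
  have hn : ∀ w : Sph n, ‖(w : Eucl n) - v‖ ^ 2 = 2 - 2 * ⟪(w : Eucl n), v⟫_ℝ := fun w => by
    rw [norm_sub_sq_real, norm_sph, norm_sph]
    ring
  have ha := (abs_le.1 (h3 a)).1
  have hb := (abs_le.1 (h3 b)).1
  have hr' : r ≤ x + y := by
    have h4 := norm_add_le (x • (a : Eucl n)) (y • (b : Eucl n))
    rw [hxy, norm_smul, norm_smul, norm_smul, norm_sph, norm_sph, norm_sph,
      Real.norm_of_nonneg hx, Real.norm_of_nonneg hy, Real.norm_of_nonneg hr] at h4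
    linarith
  have i1 : x * ⟪ℓ, (a : Eucl n) - v⟫_ℝ + y * ⟪ℓ, (b : Eucl n) - v⟫_ℝ =
      (r - x - y) * ⟪ℓ, (v : Eucl n)⟫_ℝ := by
    have h4 := congrArg (fun z => ⟪ℓ, z⟫_ℝ) hxy
    simp only [inner_add_right, real_inner_smul_right] at h4
    rw [inner_sub_right, inner_sub_right]
    linarith
  have i2 : x * ⟪(a : Eucl n), v⟫_ℝ + y * ⟪(b : Eucl n), v⟫_ℝ = r := by
    have h4 := congrArg (fun z => ⟪z, (v : Eucl n)⟫_ℝ) hxy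
    simp only [inner_add_left, real_inner_smul_left] at h4
    rw [h4, real_inner_self_eq_norm_sq, norm_sph]
    ring
  have i3 : |⟪ℓ, (v : Eucl n)⟫_ℝ| ≤ A * s := by
    have := abs_real_inner_le_norm ℓ (v : Eucl n)
    rw [norm_sph, mul_one] at this
    exact this.trans h2
  rw [hn] at ha hb
  have i4 : 0 ≤ (x + y - r) * (f v - ⟪ℓ, (v : Eucl n)⟫_ℝ - 2 * (A * s ^ 2) + C) :=
    mul_nonneg (by linarith) (by linarith [(abs_le.1 h1).1, (abs_le.1 i3).2])
  have ha' := mul_le_mul_of_nonneg_left ha hx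
  have hb' := mul_le_mul_of_nonneg_left hb hy
  linear_combination ha' + hb' + i4 - i1 - 2 * A * s ^ 2 * i2

end Regularity

section Localization

open scoped InnerProductSpace

variable {n d : ℕ} {s A B : ℝ} {f g : Sph n → ℝ}

theorem inBall_of_hs_le {K : ConvexBody (Eucl n)} {r : ℝ} (hr : 0 ≤ r) (h : ∀ u, hs K u ≤ r) :
    K.InBall r := fun x hx => by
  have h1 : hs K ≤ hs (ballBody n hr) := by
    rw [hs_ballBody]
    exact h
  exact (mem_ballBody hr).1 (subset_of_hs_le h1 hx)

theorem Reg.exists_sub (h : Reg s A f) (hA : 0 ≤ A) (hs1 : 1 ≤ s) :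
    ∃ K L : ConvexBody (Eucl n), K.InBall (5 * A * s ^ 2) ∧ L.InBall (5 * A * s ^ 2) ∧
      f = hs K - hs L := by
  have h2 : s ≤ s ^ 2 := by nlinarith
  have hC : A * (1 + s + 2 * s ^ 2) ≤ A * (4 * s ^ 2) := by
    gcongr
    nlinarith
  have hC0 : 0 ≤ A * (4 * s ^ 2) := by positivity
  have hAs : A * 1 ≤ A * s ^ 2 := by
    gcongr
    nlinarith
  obtain ⟨K, hK⟩ := h.exists_body hC
  refine ⟨K, ballBody n hC0, inBall_of_hs_le (by positivity) fun u => ?_, fun x hx => ?_, ?_⟩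
  · rw [hK]
    linarith [(le_abs_self _).trans (h u).1]
  · have := (mem_ballBody hC0).1 hx
    linarith
  · rw [hK, hs_ballBody]
    funext u
    simp

theorem Reg.mem_bodySpan (h : Reg 1 A f) : f ∈ bodySpan n := by
  obtain ⟨K, hK⟩ := h.exists_body le_rfl
  have h1 : f = hs K - (A * (1 + 1 + 2 * 1 ^ 2)) • (fun _ => 1) := by
    rw [hK]
    funext u
    simp
  rw [h1]
  refine sub_mem (hs_mem_bodySpan K) (Submodule.smul_mem _ _ ?_)
  rw [← hs_ballBody zero_le_one]
  exact hs_mem_bodySpan _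

theorem IsSymbol.eq_zero_of_mul_eq_zero {φ : ConvexBody (Eucl n) → ℝ}
    {Φ : MultilinearMap ℝ (fun _ : Fin (d + 1) => Sph n → ℝ) ℝ} (hΦ : IsSymbol (d + 1) φ Φ)
    (hφ : IsVal φ) (j : Fin d) {x : Fin (d + 1) → Sph n → ℝ} (hx : ∀ i, x i ∈ bodySpan n)
    (h0 : Reg 1 A (x 0)) (hj : Reg 1 B (x j.succ)) (p0 : ∀ u, 0 ≤ x 0 u)
    (pj : ∀ u, 0 ≤ x j.succ u) (h0j : ∀ u, x 0 u = 0 ∨ x j.succ u = 0) : Φ x = 0 := by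
  rcases isEmpty_or_nonempty (Sph n) with hS | ⟨⟨e⟩⟩
  · have : x 0 = 0 := Subsingleton.elim _ _
    exact Φ.map_coord_zero 0 this
  have hA : 0 ≤ A := (p0 e).trans ((le_abs_self _).trans (h0 e).1)
  have hB : 0 ≤ B := (pj e).trans ((le_abs_self _).trans (hj e).1)
  set C := (A + B) * (1 + 1 + 2 * 1 ^ 2) with hC
  obtain ⟨P, hP⟩ := h0.exists_body (C := C) (by rw [hC]; gcongr; linarith)
  obtain ⟨Q, hQ⟩ := hj.exists_body (C := C) (by rw [hC]; gcongr; linarith)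
  obtain ⟨M, hM⟩ := (h0.add hj).exists_body (C := C) le_rfl
  have hC0 : 0 ≤ C := by positivity
  refine hΦ.eq_zero_of_max_min hφ (A := P) (B := Q) (M := M) (I := ballBody n hC0) (fun u => ?_)
    (fun u => ?_) j (by rw [hP, hs_ballBody]; funext u; simp)
    (by rw [hQ, hs_ballBody]; funext u; simp) hx
  · rw [hM, hP, hQ]
    beta_reduce
    rcases h0j u with h | h
    · rw [h, max_eq_right (by linarith [pj u])]
      ring
    · rw [h, max_eq_left (by linarith [p0 u])]
      ring
  · rw [hP, hQ, hs_ballBody]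
    beta_reduce
    rcases h0j u with h | h
    · rw [h, min_eq_left (by linarith [pj u]), zero_add]
    · rw [h, min_eq_right (by linarith [p0 u]), zero_add]

/-- The truncated coordinate `s (uⱼ - eⱼ)`. -/
def trCoord (e : Sph n) (s : ℝ) (j : Fin n) (u : Sph n) : ℝ :=
  trunc (s * ((u : Eucl n) j - (e : Eucl n) j))

/-- A cutoff function on the sphere concentrated near `e` at scale `1 / s`. -/
def cutoff (e : Sph n) (s : ℝ) (u : Sph n) : ℝ :=
  ∏ j, posSq (1 + -1 * trCoord e s j u ^ 2)

theorem cutoff_nonneg (e : Sph n) (s : ℝ) (u : Sph n) : 0 ≤ cutoff e s u :=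
  Finset.prod_nonneg fun _ _ => posSq_nonneg _

theorem reg_cutoff (e : Sph n) (hs : 0 ≤ s) :
    Reg s (∏ _j : Fin n, 4 * (6 * (|1| + |-1| * (4 * 3) ^ 2) ^ 2)) (cutoff e s) :=
  Reg.prod Finset.univ hs fun j _ =>
    (((Reg.const hs 1).add (((reg_trunc e j hs).pow hs 2).smul (-1))).posSq hs)

theorem abs_trCoord_lt_of_cutoff_ne_zero {e u : Sph n} (h : cutoff e s u ≠ 0) (j : Fin n) :
    |trCoord e s j u| < 1 := by
  by_contra! hcon
  refine h (Finset.prod_eq_zero (Finset.mem_univ j) (posSq_of_nonpos ?_))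
  have := one_le_sq_iff_one_le_abs _ |>.2 hcon
  linarith

theorem reg_one_cutoff (e : Sph n) (hs : 1 ≤ s) : ∃ A, Reg 1 A (cutoff e s) :=
  ⟨_, (reg_cutoff e (zero_le_one.trans hs)).to_one hs⟩

theorem IsSymbol.eq_zero_of_cutoff {φ : ConvexBody (Eucl n) → ℝ}
    {Φ : MultilinearMap ℝ (fun _ : Fin (d + 1) => Sph n → ℝ) ℝ} (hΦ : IsSymbol (d + 1) φ Φ)
    (hφ : IsVal φ) (e : Sph n) (hs : 1 ≤ s) (j : Fin d) {x : Fin (d + 1) → Sph n → ℝ}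
    (hx : ∀ i, x i ∈ bodySpan n) (h0 : x 0 = fun u => cutoff e s u * f u) (hf : Reg 1 A f)
    (hj : Reg 1 B (x j.succ))
    (hloc : ∀ u : Sph n, (∀ k, |s * ((u : Eucl n) k - (e : Eucl n) k)| ≤ 2) → x j.succ u = 0) :
    Φ x = 0 := by
  have hs0 : 0 ≤ s := zero_le_one.trans hs
  obtain ⟨Ac, hAc⟩ := reg_one_cutoff e hs
  have hA : 0 ≤ A := (abs_nonneg _).trans (hf e).1
  have hB : 0 ≤ B := (abs_nonneg _).trans (hj e).1
  set W : Sph n → ℝ := fun u => ∑ k, posSq (trCoord e s k u ^ 2 + -1) with hW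
  have hWreg : ∃ D, Reg 1 D W := by
    have : ∀ t : Finset (Fin n), ∃ D, Reg 1 D fun u => ∑ k ∈ t, posSq (trCoord e s k u ^ 2 + -1) := by
      intro t
      induction t using Finset.induction_on with
      | empty => exact ⟨_, by simpa using Reg.const (n := n) zero_le_one 0⟩
      | insert k t hk ih =>
        obtain ⟨D, hD⟩ := ih
        simp only [Finset.sum_insert hk]
        exact ⟨_, ((((((reg_trunc e k hs0).pow hs0 2).add (Reg.const hs0 (-1))).posSq hs0).to_one
          hs)).add hD⟩
    exact this _
  obtain ⟨D, hD⟩ := hWreg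
  have hW0 : ∀ u, 0 ≤ W u := fun u => Finset.sum_nonneg fun _ _ => posSq_nonneg _
  have hWcut : ∀ u, cutoff e s u ≠ 0 → W u = 0 := fun u hu =>
    Finset.sum_eq_zero fun k _ => posSq_of_nonpos (by
      have := (sq_lt_one_iff_abs_lt_one _).2 (abs_trCoord_lt_of_cutoff_ne_zero hu k)
      linarith)
  have hcut : ∀ u, cutoff e s u ≠ 0 → x j.succ u = 0 := fun u hu => hloc u fun k => by
    by_contra! hcon
    have h1 := two_le_abs_trunc hcon.le
    have h2 := abs_trCoord_lt_of_cutoff_ne_zero hu k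
    rw [trCoord] at h2
    linarith
  have hbig : ∀ u, 0 ≤ x j.succ u + B * W u := fun u => by
    by_cases h : ∀ k, |s * ((u : Eucl n) k - (e : Eucl n) k)| ≤ 2
    · rw [hloc u h, zero_add]
      exact mul_nonneg hB (hW0 u)
    · push Not at h
      obtain ⟨k, hk⟩ := h
      have h1 : 4 ≤ trCoord e s k u ^ 2 := by
        have := two_le_abs_trunc hk.le
        rw [← sq_abs, trCoord]
        nlinarith
      have h2 : 1 ≤ W u := by
        refine le_trans ?_ (Finset.single_le_sum (fun k _ => posSq_nonneg
          (trCoord e s k u ^ 2 + -1)) (Finset.mem_univ k))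
        rw [posSq_of_nonneg (by linarith)]
        nlinarith
      have h3 := (abs_le.1 (hj u).1).1
      nlinarith
  set F₁ : Sph n → ℝ := fun u => cutoff e s u * (f u + A) with hF₁
  set F₂ : Sph n → ℝ := fun u => cutoff e s u * A with hF₂
  set G₁ : Sph n → ℝ := fun u => x j.succ u + B * W u with hG₁
  set G₂ : Sph n → ℝ := fun u => B * W u with hG₂
  have hA' : Reg 1 |A| fun _ : Sph n => A := Reg.const zero_le_one A
  have rF₁ := hAc.mul (hf.add hA') zero_le_one
  have rF₂ := hAc.mul hA' zero_le_one
  have rG₂ := hD.smul B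
  have rG₁ := hj.add rG₂
  have e0 : x 0 = F₁ - F₂ := by
    rw [h0]
    funext u
    simp only [hF₁, hF₂, Pi.sub_apply]
    ring
  have ej : x j.succ = G₁ - G₂ := by
    funext u
    simp only [hG₁, hG₂, Pi.sub_apply]
    ring
  set S : Fin (d + 1) → Set (Sph n → ℝ) := fun i =>
    if i = 0 then {F₁, F₂} else if i = j.succ then {G₁, G₂} else {x i} with hS
  have hfin := MultilinearMap.mem_of_mem_span ⊥ Φ S (fun y hy => by
      have hy0 : y 0 = F₁ ∨ y 0 = F₂ := by simpa [hS] using hy 0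
      have hyj : y j.succ = G₁ ∨ y j.succ = G₂ := by
        simpa [hS, Fin.succ_ne_zero] using hy j.succ
      have r0 : (∃ C, Reg 1 C (y 0)) ∧ (∀ u, 0 ≤ y 0 u) ∧ ∀ u, cutoff e s u = 0 → y 0 u = 0 := by
        rcases hy0 with h | h <;> rw [h]
        · exact ⟨⟨_, rF₁⟩, fun u => mul_nonneg (cutoff_nonneg _ _ _)
            (by linarith [(abs_le.1 (hf u).1).1]), fun u hu => by simp [hF₁, hu]⟩
        · exact ⟨⟨_, rF₂⟩, fun u => mul_nonneg (cutoff_nonneg _ _ _) hA,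
            fun u hu => by simp [hF₂, hu]⟩
      have rj : (∃ C, Reg 1 C (y j.succ)) ∧ (∀ u, 0 ≤ y j.succ u) ∧
          ∀ u, cutoff e s u ≠ 0 → y j.succ u = 0 := by
        rcases hyj with h | h <;> rw [h]
        · exact ⟨⟨_, rG₁⟩, hbig, fun u hu => by simp [hG₁, hcut u hu, hWcut u hu]⟩
        · exact ⟨⟨_, rG₂⟩, fun u => mul_nonneg hB (hW0 u),
            fun u hu => by simp [hG₂, hWcut u hu]⟩
      obtain ⟨⟨C0, r0⟩, p0, z0⟩ := r0
      obtain ⟨⟨Cj, rj⟩, pj, zj⟩ := rj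
      refine hΦ.eq_zero_of_mul_eq_zero hφ j (fun i => ?_) r0 rj p0 pj fun u => ?_
      · by_cases hi0 : i = 0
        · rw [hi0]
          exact r0.mem_bodySpan
        by_cases hij : i = j.succ
        · rw [hij]
          exact rj.mem_bodySpan
        have : y i = x i := by simpa [hS, hi0, hij] using hy i
        rw [this]
        exact hx i
      · by_cases hu : cutoff e s u = 0
        · exact Or.inl (z0 u hu)
        · exact Or.inr (zj u hu)) x fun i => by
    by_cases hi0 : i = 0
    · subst hi0
      have : S 0 = {F₁, F₂} := by simp [hS]
      rw [this, e0]
      exact sub_mem (Submodule.subset_span (by simp)) (Submodule.subset_span (by simp))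
    by_cases hij : i = j.succ
    · subst hij
      have : S j.succ = {G₁, G₂} := by simp [hS, Fin.succ_ne_zero]
      rw [this, ej]
      exact sub_mem (Submodule.subset_span (by simp)) (Submodule.subset_span (by simp))
    · have : S i = {x i} := by simp [hS, hi0, hij]
      rw [this]
      exact Submodule.subset_span rfl
  simpa using hfin

end Localization

section Monomials

open scoped InnerProductSpace

variable {n d : ℕ} {s A B : ℝ}

/-- The truncated monomial `∏ⱼ (uⱼ - eⱼ) ^ αⱼ`. -/
def trMono (e : Sph n) (s : ℝ) (α : Fin n → ℕ) (u : Sph n) : ℝ :=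
  ∏ j, (s⁻¹ * trCoord e s j u) ^ α j

theorem trMono_eq {e u : Sph n} (hs : 0 < s) (α : Fin n → ℕ)
    (h : ∀ k, |s * ((u : Eucl n) k - (e : Eucl n) k)| ≤ 2) :
    trMono e s α u = ∏ j, ((u : Eucl n) j - (e : Eucl n) j) ^ α j := by
  refine Finset.prod_congr rfl fun j _ => ?_
  rw [trCoord, trunc_of_abs_le (h j), inv_mul_cancel_left₀ hs.ne']

theorem reg_trMono (e : Sph n) (hs : 0 < s) (α : Fin n → ℕ) :
    Reg s (4 ^ n * 12 ^ (∑ j, α j) * (s⁻¹) ^ (∑ j, α j)) (trMono e s α) := by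
  have h := Reg.prod Finset.univ hs.le fun j _ =>
    (((reg_trunc e j hs.le).smul s⁻¹).pow hs.le (α j))
  have h2 : ∏ j, 4 * (4 * (|s⁻¹| * 3)) ^ α j = 4 ^ n * 12 ^ (∑ j, α j) * (s⁻¹) ^ (∑ j, α j) := by
    rw [Finset.prod_mul_distrib, Finset.prod_pow_eq_pow_sum, abs_of_pos (inv_pos.2 hs),
      Finset.prod_const, Finset.card_univ, Fintype.card_fin, mul_assoc, ← mul_pow]
    congr 2
    ring
  rw [h2] at h
  exact h

/-- The algebra of polynomial functions on Euclidean space. -/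
def polyAlg (n : ℕ) : Subalgebra ℝ (Eucl n → ℝ) :=
  Algebra.adjoin ℝ (Set.range fun (j : Fin n) (u : Eucl n) => u j)

theorem coord_mem_polyAlg (j : Fin n) : (fun u : Eucl n => u j) ∈ polyAlg n :=
  Algebra.subset_adjoin ⟨j, rfl⟩

theorem const_mem_polyAlg (c : ℝ) : (fun _ : Eucl n => c) ∈ polyAlg n :=
  (polyAlg n).algebraMap_mem c

theorem inner_mem_polyAlg (v : Eucl n) : (fun u : Eucl n => ⟪u, v⟫_ℝ) ∈ polyAlg n := by
  have : (fun u : Eucl n => ⟪u, v⟫_ℝ) = ∑ j, v j • (fun u : Eucl n => u j) := by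
    funext u
    simp [PiLp.inner_apply]
  rw [this]
  exact sum_mem fun j _ => Subalgebra.smul_mem _ (coord_mem_polyAlg j) _

theorem continuous_of_mem_polyAlg {f : Eucl n → ℝ} (hf : f ∈ polyAlg n) : Continuous f := by
  induction hf using Algebra.adjoin_induction with
  | mem x hx =>
    obtain ⟨j, rfl⟩ := hx
    fun_prop
  | algebraMap r => exact continuous_const
  | add x y _ _ hx hy => exact hx.add hy
  | mul x y _ _ hx hy => exact hx.mul hy

theorem exists_expansion {f : Eucl n → ℝ} (hf : f ∈ polyAlg n) (e : Sph n) :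
    ∃ (κ : Type) (_ : Fintype κ) (α : κ → Fin n → ℕ) (A : ℝ), ∀ T : Eucl n ≃ₗᵢ[ℝ] Eucl n,
      ∃ a : κ → ℝ, (∀ k, |a k| ≤ A) ∧
        ∀ u, f (T u) = ∑ k, a k * ∏ j, (u j - (e : Eucl n) j) ^ α k j := by
  induction hf using Algebra.adjoin_induction with
  | mem x hx =>
    obtain ⟨i, rfl⟩ := hx
    refine ⟨Option (Fin n), inferInstance, fun k => k.elim 0 fun i => Pi.single i 1, 1,
      fun T => ⟨fun k => k.elim (T e i) fun j => T (EuclideanSpace.single j 1) i,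
        fun k => ?_, fun u => ?_⟩⟩
    · have h1 : ∀ v : Eucl n, ‖v‖ = 1 → |T v i| ≤ 1 := fun v hv => by
        have := PiLp.norm_apply_le (T v) i
        rwa [T.norm_map, hv] at this
      rcases k with _ | k
      · exact h1 _ (norm_sph e)
      · exact h1 _ (by simp)
    · have h1 : ∀ j, ∏ l, (u l - (e : Eucl n) l) ^ (Pi.single j 1 : Fin n → ℕ) l =
          u j - (e : Eucl n) j := fun j => by
        rw [Finset.prod_eq_single j]
        · simp
        · intro b _ hb
          simp [hb]
        · simp
      have h2 : u = (e : Eucl n) + ∑ j, (u j - (e : Eucl n) j) • EuclideanSpace.single j (1 : ℝ) := by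
        ext k
        simp [Finset.sum_apply, Pi.single_apply]
      simp only [Fintype.sum_option, Option.elim, h1]
      conv_lhs => rw [h2]
      simp [_root_.map_add, map_sum, mul_comm]
  | algebraMap r =>
    exact ⟨Unit, inferInstance, fun _ _ => 0, |r|, fun T => ⟨fun _ => r, fun _ => le_rfl, fun u => by
      simp⟩⟩
  | add x y _ _ hx hy =>
    obtain ⟨κ, _, α, A, h⟩ := hx
    obtain ⟨κ', _, α', A', h'⟩ := hy
    refine ⟨κ ⊕ κ', inferInstance, Sum.elim α α', max A A', fun T => ?_⟩
    obtain ⟨a, ha, hu⟩ := h T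
    obtain ⟨a', ha', hu'⟩ := h' T
    refine ⟨Sum.elim a a', ?_, fun u => ?_⟩
    · rintro (k | k)
      · exact (ha k).trans (le_max_left _ _)
      · exact (ha' k).trans (le_max_right _ _)
    · simp [hu, hu']
  | mul x y _ _ hx hy =>
    obtain ⟨κ, _, α, A, h⟩ := hx
    obtain ⟨κ', _, α', A', h'⟩ := hy
    refine ⟨κ × κ', inferInstance, fun k => α k.1 + α' k.2, A * A', fun T => ?_⟩
    obtain ⟨a, ha, hu⟩ := h T
    obtain ⟨a', ha', hu'⟩ := h' T
    refine ⟨fun k => a k.1 * a' k.2, fun k => ?_, fun u => ?_⟩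
    · rw [abs_mul]
      exact mul_le_mul (ha _) (ha' _) (abs_nonneg _) ((abs_nonneg _).trans (ha k.1))
    · simp only [Pi.mul_apply, hu, hu', Finset.sum_mul_sum, Fintype.sum_prod_type, Pi.add_apply,
        pow_add, Finset.prod_mul_distrib]
      refine Finset.sum_congr rfl fun k _ => Finset.sum_congr rfl fun l _ => ?_
      ring

theorem Reg.sum {ι : Type*} (t : Finset ι) {f : ι → Sph n → ℝ} (hs : 0 ≤ s)
    (h : ∀ i ∈ t, ∃ A, Reg s A (f i)) : ∃ A, Reg s A fun u => ∑ i ∈ t, f i u := by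
  classical
  induction t using Finset.induction_on with
  | empty => exact ⟨_, by simpa using Reg.const (n := n) hs 0⟩
  | insert k t hk ih =>
    obtain ⟨D, hD⟩ := ih fun i hi => h i (Finset.mem_insert_of_mem hi)
    obtain ⟨E, hE⟩ := h k (Finset.mem_insert_self k t)
    simp only [Finset.sum_insert hk]
    exact ⟨_, hE.add hD⟩

theorem exists_reg_sum_monomials {κ : Type} [Fintype κ] (e : Sph n) (α : κ → Fin n → ℕ)
    (a : κ → ℝ) :
    ∃ A, Reg 1 A fun u : Sph n => ∑ k, a k * ∏ j, ((u : Eucl n) j - (e : Eucl n) j) ^ α k j :=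
  Reg.sum _ zero_le_one fun k _ => ⟨_, (Reg.prod Finset.univ zero_le_one fun j _ =>
    (reg_coord e j).pow zero_le_one (α k j)).smul (a k)⟩

theorem exists_reg_sum_trMono {κ : Type} [Fintype κ] (e : Sph n) (hs : 1 ≤ s)
    (α : κ → Fin n → ℕ) (a : κ → ℝ) : ∃ A, Reg 1 A fun u : Sph n => ∑ k, a k * trMono e s (α k) u :=
  Reg.sum _ zero_le_one fun k _ =>
    ⟨_, ((reg_trMono e (zero_lt_one.trans_le hs) (α k)).smul (a k)).to_one hs⟩

/-- The symbol is bounded on regular functions. -/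
theorem IsSymbol.bound_reg {φ : ConvexBody (Eucl n) → ℝ}
    {Φ : MultilinearMap ℝ (fun _ : Fin d => Sph n → ℝ) ℝ} (hΦ : IsSymbol d φ Φ) (h : IsVal φ) :
    ∃ C, 0 ≤ C ∧ ∀ (s : ℝ) (A : Fin d → ℝ) (f : Fin d → Sph n → ℝ), 1 ≤ s → (∀ i, 0 < A i) →
      (∀ i, Reg s (A i) (f i)) → |Φ f| ≤ C * ∏ i, (5 * A i * s ^ 2) := by
  obtain ⟨C, hC, hb⟩ := hΦ.bound h
  exact ⟨C, hC, fun s A f hs hA hf => hb f _ (fun i => by have := hA i; positivity)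
    fun i => (hf i).exists_sub (hA i).le hs⟩

end Monomials

section LocalEstimate

variable {n d m : ℕ} {s A B : ℝ}

/-- The bound of `IsSymbol.bound_reg` as a property of a multilinear functional. -/
def RegBound (Φ : MultilinearMap ℝ (fun _ : Fin d => Sph n → ℝ) ℝ) (C : ℝ) : Prop :=
  ∀ (s : ℝ) (A : Fin d → ℝ) (f : Fin d → Sph n → ℝ), 1 ≤ s → (∀ i, 0 < A i) →
    (∀ i, Reg s (A i) (f i)) → |Φ f| ≤ C * ∏ i, (5 * A i * s ^ 2)

/-- Tuples of truncated monomials, the first one being multiplied by the cutoff function. -/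
def locMono (e : Sph n) (s : ℝ) (α : Fin (d + 1) → Fin n → ℕ) : Fin (d + 1) → Sph n → ℝ :=
  Fin.cons (fun u => cutoff e s u * trMono e s (α 0) u) fun i => trMono e s (α i.succ)

/-- The constant in the regularity of the entries of `locMono`. -/
def locConst (n k : ℕ) : ℝ :=
  4 * (∏ _j : Fin n, 4 * (6 * (|(1 : ℝ)| + |(-1 : ℝ)| * (4 * 3) ^ 2) ^ 2)) * (4 ^ n * 12 ^ k)

theorem locConst_pos (n k : ℕ) : 0 < locConst n k := by
  unfold locConst
  positivity

theorem reg_locMono (e : Sph n) (hs : 1 ≤ s) (α : Fin (d + 1) → Fin n → ℕ) (i : Fin (d + 1)) :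
    Reg s (locConst n (∑ j, α i j) * (s⁻¹) ^ (∑ j, α i j)) (locMono e s α i) := by
  have hs0 : 0 < s := zero_lt_one.trans_le hs
  have h1 : (1 : ℝ) ≤ ∏ _j : Fin n, 4 * (6 * (|(1 : ℝ)| + |(-1 : ℝ)| * (4 * 3) ^ 2) ^ 2) := by
    rw [Finset.prod_const]
    exact one_le_pow₀ (by norm_num)
  refine Fin.cases ?_ (fun i => ?_) i
  · refine ((reg_cutoff e hs0.le).mul (reg_trMono e hs0 (α 0)) hs0.le).mono hs0.le (le_of_eq ?_)
    unfold locConst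
    ring
  · refine (reg_trMono e hs0 (α i.succ)).mono hs0.le ?_
    refine mul_le_mul_of_nonneg_right ?_ (by positivity)
    unfold locConst
    refine le_mul_of_one_le_left (by positivity) ?_
    linarith

theorem RegBound.locMono_le {Φ : MultilinearMap ℝ (fun _ : Fin (d + 1) => Sph n → ℝ) ℝ} {C : ℝ}
    (hΦ : RegBound Φ C) (hC : 0 ≤ C) (e : Sph n) (hs : 1 ≤ s) (α : Fin (d + 1) → Fin n → ℕ)
    (hα : ¬ ∀ i j, α i j ≤ m) :
    |Φ (locMono e s α)| ≤
      (C * ∏ i, (5 * locConst n (∑ j, α i j))) * (s ^ (2 * (d + 1)) * (s⁻¹) ^ (m + 1)) := by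
  have hs0 : 0 < s := zero_lt_one.trans_le hs
  have h := hΦ s _ _ hs (fun i => mul_pos (locConst_pos n _) (by positivity))
    (reg_locMono e hs α)
  have h2 : ∏ i, (5 * (locConst n (∑ j, α i j) * (s⁻¹) ^ (∑ j, α i j)) * s ^ 2) =
      (∏ i, (5 * locConst n (∑ j, α i j))) * (s ^ (2 * (d + 1)) * (s⁻¹) ^ (∑ i, ∑ j, α i j)) := by
    rw [← Finset.prod_pow_eq_pow_sum, pow_mul]
    have : (s ^ 2) ^ (d + 1) = ∏ _i : Fin (d + 1), s ^ 2 := by simp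
    rw [this, ← Finset.prod_mul_distrib, ← Finset.prod_mul_distrib]
    refine Finset.prod_congr rfl fun i _ => ?_
    ring
  rw [h2] at h
  refine h.trans ?_
  rw [← mul_assoc C]
  have h3 : 0 ≤ ∏ i, (5 * locConst n (∑ j, α i j)) :=
    Finset.prod_nonneg fun i _ => (mul_pos (by norm_num) (locConst_pos n _)).le
  refine mul_le_mul_of_nonneg_left (mul_le_mul_of_nonneg_left ?_ (by positivity))
    (mul_nonneg hC h3)
  refine pow_le_pow_of_le_one (by positivity) (inv_le_one_of_one_le₀ hs) ?_
  push Not at hα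
  obtain ⟨i, j, hij⟩ := hα
  calc m + 1 ≤ α i j := hij
    _ ≤ ∑ j, α i j := Finset.single_le_sum (fun _ _ => Nat.zero_le _) (Finset.mem_univ j)
    _ ≤ _ := Finset.single_le_sum (f := fun i => ∑ j, α i j) (fun _ _ => Nat.zero_le _)
      (Finset.mem_univ i)

theorem abs_le_two_of_cutoff_ne_zero {e u : Sph n} (h : cutoff e s u ≠ 0) (k : Fin n) :
    |s * ((u : Eucl n) k - (e : Eucl n) k)| ≤ 2 := by
  by_contra! hcon
  have h1 := two_le_abs_trunc hcon.le
  have h2 := abs_trCoord_lt_of_cutoff_ne_zero h k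
  rw [trCoord] at h2
  linarith

theorem IsSymbol.exists_local_estimate (f : Fin (d + 1) → Eucl n → ℝ) (hf : ∀ i, f i ∈ polyAlg n)
    (e : Sph n) (m : ℕ) {C : ℝ} (hC : 0 ≤ C) :
    ∃ C', 0 ≤ C' ∧ ∀ (φ : ConvexBody (Eucl n) → ℝ)
      (Φ : MultilinearMap ℝ (fun _ : Fin (d + 1) => Sph n → ℝ) ℝ) (s : ℝ),
      IsSymbol (d + 1) φ Φ → IsVal φ → RegBound Φ C → 1 ≤ s →
      (∀ α : Fin (d + 1) → Fin n → ℕ, (∀ i j, α i j ≤ m) → Φ (locMono e s α) = 0) →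
      ∀ T : Eucl n ≃ₗᵢ[ℝ] Eucl n,
        |Φ (Fin.cons (fun u => cutoff e s u * f 0 (T u)) fun i u => f i.succ (T u))| ≤
          C' * (s ^ (2 * (d + 1)) * (s⁻¹) ^ (m + 1)) := by
  choose κ hκ α A hA using fun i => exists_expansion (hf i) e
  refine ⟨∑ r : ∀ i, κ i, (∏ i, |A i|) *
    (C * ∏ i, (5 * locConst n (∑ j, α i (r i) j))), ?_, ?_⟩
  · refine Finset.sum_nonneg fun r _ => mul_nonneg (Finset.prod_nonneg fun _ _ => abs_nonneg _)
      (mul_nonneg hC (Finset.prod_nonneg fun i _ => (mul_pos (by norm_num) (locConst_pos n _)).le))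
  intro φ Φ s hΦ hφ hb hs hzero T
  have hs0 : 0 < s := zero_lt_one.trans_le hs
  choose a ha hu using fun i => hA i T
  set x0 : Sph n → ℝ := fun u => cutoff e s u * f 0 (T u) with hx0
  set x : Fin d → Sph n → ℝ := fun i u => f i.succ (T u) with hx
  set y : Fin d → Sph n → ℝ := fun i u => ∑ k, a i.succ k * trMono e s (α i.succ k) u with hy
  have regf : ∀ i, ∃ B, Reg 1 B fun u : Sph n => f i (T u) := fun i => by
    simp only [hu]
    exact exists_reg_sum_monomials e _ _
  have regy : ∀ i, ∃ B, Reg 1 B (y i) := fun i => exists_reg_sum_trMono e hs _ _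
  obtain ⟨Ac, hAc⟩ := reg_one_cutoff e hs
  obtain ⟨B0, hB0⟩ := regf 0
  have regx0 := hAc.mul hB0 zero_le_one
  have step : ∀ t : Finset (Fin d), Φ (Fin.cons x0 (t.piecewise y x)) = Φ (Fin.cons x0 x) := by
    classical
    intro t
    induction t using Finset.induction_on with
    | empty => simp
    | insert j t hj ih =>
      rw [← ih, ← sub_eq_zero]
      have e1 : (Fin.cons x0 ((insert j t).piecewise y x) : Fin (d + 1) → Sph n → ℝ) =
          Function.update (Fin.cons x0 (t.piecewise y x)) j.succ (y j) := by
        rw [Finset.piecewise_insert, ← Fin.cons_update]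
      have e2 : (Fin.cons x0 (t.piecewise y x) : Fin (d + 1) → Sph n → ℝ) =
          Function.update (Fin.cons x0 (t.piecewise y x)) j.succ (x j) := by
        rw [← Fin.cons_update]
        congr 1
        funext i
        by_cases hij : i = j
        · subst hij
          simp [hj]
        · simp [hij]
      rw [e1]
      conv_lhs => rw [e2]
      rw [Function.update_idem, ← MultilinearMap.map_update_sub]
      obtain ⟨By, hBy⟩ := regy j
      obtain ⟨Bx, hBx⟩ := regf j.succ
      have regd : Reg 1 (By + |-1| * Bx) (y j - x j) := by
        have := hBy.add (hBx.smul (-1))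
        convert this using 2
        simp [hx]
        ring
      refine hΦ.eq_zero_of_cutoff hφ e hs j (fun i => ?_) (f := fun u => f 0 (T u)) ?_ hB0
        (B := By + |-1| * Bx) ?_ ?_
      · refine Fin.cases ?_ (fun i => ?_) i
        · simpa [Function.update_of_ne (Fin.succ_ne_zero j).symm] using regx0.mem_bodySpan
        · by_cases hij : i = j
          · subst hij
            simpa using regd.mem_bodySpan
          · rw [Function.update_of_ne (by simpa using hij), Fin.cons_succ]
            by_cases hit : i ∈ t
            · simp only [hit, Finset.piecewise_eq_of_mem]
              exact (regy i).choose_spec.mem_bodySpan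
            · simp only [hit, not_false_eq_true, Finset.piecewise_eq_of_notMem]
              exact (regf i.succ).choose_spec.mem_bodySpan
      · simp [Function.update_of_ne (Fin.succ_ne_zero j).symm, hx0]
      · simpa using regd
      · intro u hk
        simp only [Function.update_self, Pi.sub_apply, hx, hy, hu]
        rw [sub_eq_zero]
        exact Finset.sum_congr rfl fun k _ => by rw [trMono_eq hs0 _ hk]
  have hfull : Φ (Fin.cons x0 x) = Φ fun i => ∑ k, a i k • locMono e s (fun _ => α i k) i := by
    rw [← step Finset.univ, Finset.piecewise_univ]
    congr 1
    funext i
    refine Fin.cases ?_ (fun i => ?_) i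
    · funext u
      simp only [Fin.cons_zero, hx0, locMono, Finset.sum_apply, Pi.smul_apply, smul_eq_mul, hu]
      by_cases hc : cutoff e s u = 0
      · simp [hc]
      · rw [Finset.mul_sum]
        refine Finset.sum_congr rfl fun k _ => ?_
        rw [trMono_eq hs0 _ (abs_le_two_of_cutoff_ne_zero hc)]
        ring
    · funext u
      simp [locMono, hy]
  rw [hfull, MultilinearMap.map_sum, Finset.sum_mul]
  refine (Finset.abs_sum_le_sum_abs _ _).trans (Finset.sum_le_sum fun r _ => ?_)
  rw [MultilinearMap.map_smul_univ, smul_eq_mul, abs_mul, Finset.abs_prod, mul_assoc]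
  have hr : (fun i => locMono e s (fun _ => α i (r i)) i : Fin (d + 1) → Sph n → ℝ) =
      locMono e s fun i => α i (r i) := by
    funext i
    refine Fin.cases ?_ (fun i => ?_) i <;> simp [locMono]
  rw [hr]
  refine mul_le_mul (Finset.prod_le_prod (fun _ _ => abs_nonneg _)
    fun i _ => (ha i (r i)).trans (le_abs_self _)) ?_ (abs_nonneg _)
    (Finset.prod_nonneg fun _ _ => abs_nonneg _)
  by_cases hα : ∀ i j, α i (r i) j ≤ m
  · rw [hzero _ hα, abs_zero]
    exact mul_nonneg (mul_nonneg hC (Finset.prod_nonneg fun i _ =>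
      (mul_pos (by norm_num) (locConst_pos n _)).le)) (by positivity)
  · exact hb.locMono_le hC e hs _ hα

end LocalEstimate

section Isometries

open scoped InnerProductSpace

variable {n : ℕ}

theorem toEuclideanLin_mul_apply (A B : Matrix (Fin n) (Fin n) ℝ) (v : Eucl n) :
    Matrix.toEuclideanLin (A * B) v = Matrix.toEuclideanLin A (Matrix.toEuclideanLin B v) := by
  ext i
  simp

theorem toEuclideanLin_one_apply (v : Eucl n) :
    Matrix.toEuclideanLin (1 : Matrix (Fin n) (Fin n) ℝ) v = v := by
  ext i
  simp

theorem inner_toEuclideanLin (A : Matrix (Fin n) (Fin n) ℝ) (v w : Eucl n) :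
    ⟪Matrix.toEuclideanLin A v, w⟫_ℝ = ⟪v, Matrix.toEuclideanLin A.transpose w⟫_ℝ := by
  rw [← Matrix.conjTranspose_eq_transpose_of_trivial,
    Matrix.toEuclideanLin_conjTranspose_eq_adjoint, LinearMap.adjoint_inner_right]

theorem exists_isometry_of_orthogonal {A : Matrix (Fin n) (Fin n) ℝ}
    (hA : A ∈ Matrix.orthogonalGroup (Fin n) ℝ) :
    ∃ T : Eucl n ≃ₗᵢ[ℝ] Eucl n, (∀ v, T v = Matrix.toEuclideanLin A v) ∧
      ∀ v, T.symm v = Matrix.toEuclideanLin A.transpose v := by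
  have h1 : A.transpose * A = 1 := (Matrix.mem_orthogonalGroup_iff' _ _).1 hA
  have h2 : A * A.transpose = 1 := (Matrix.mem_orthogonalGroup_iff _ _).1 hA
  let T₀ : Eucl n ≃ₗ[ℝ] Eucl n := LinearEquiv.ofLinearMap (Matrix.toEuclideanLin A)
    (Matrix.toEuclideanLin A.transpose)
    (LinearMap.ext fun v => by
      simp only [LinearMap.comp_apply, ← toEuclideanLin_mul_apply, h2, toEuclideanLin_one_apply,
        LinearMap.id_apply])
    (LinearMap.ext fun v => by
      simp only [LinearMap.comp_apply, ← toEuclideanLin_mul_apply, h1, toEuclideanLin_one_apply,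
        LinearMap.id_apply])
  refine ⟨T₀.isometryOfInner fun v w => ?_, fun v => rfl, fun v => rfl⟩
  change ⟪Matrix.toEuclideanLin A v, Matrix.toEuclideanLin A w⟫_ℝ = _
  rw [inner_toEuclideanLin, ← toEuclideanLin_mul_apply, h1, toEuclideanLin_one_apply]

theorem continuous_toEuclideanLin_transpose : Continuous fun p : Mat n × Eucl n =>
    Matrix.toEuclideanLin (Matrix.of p.1).transpose p.2 := by
  refine (PiLp.continuous_toLp 2 _).comp (continuous_pi fun i => ?_)
  change Continuous fun p : Mat n × Eucl n => ∑ j, p.1 j i * p.2 j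
  fun_prop

theorem continuous_matMul (B : Mat n) :
    Continuous fun A : Mat n => (Matrix.of.symm (Matrix.of B * Matrix.of A) : Mat n) := by
  refine continuous_pi fun i => continuous_pi fun j => ?_
  simp only [Matrix.of_symm_apply, Matrix.mul_apply, Matrix.of_apply]
  fun_prop

/-- `γ` is the Haar probability measure of the closed subgroup `G` of `O(n)`, which acts
transitively on the unit sphere. -/
structure IsTransHaar (G : Set (Matrix (Fin n) (Fin n) ℝ)) (γ : Measure (Mat n)) : Prop where
  sub : IsClosedSubgroupO G
  trans : ActsTransitively G
  prob : IsProbabilityMeasure γ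
  supp : γ {A : Mat n | Matrix.of A ∉ G} = 0
  inv : ∀ B : Mat n, Matrix.of B ∈ G →
    Measure.map (fun A : Mat n => Matrix.of.symm (Matrix.of B * Matrix.of A)) γ = γ

namespace IsTransHaar

variable {G : Set (Matrix (Fin n) (Fin n) ℝ)} {γ : Measure (Mat n)}

theorem ae_mem (h : IsTransHaar G γ) : ∀ᵐ g ∂γ, Matrix.of g ∈ G := by
  rw [ae_iff]
  exact h.supp

theorem transpose_mem (h : IsTransHaar G γ) {A : Matrix (Fin n) (Fin n) ℝ} (hA : A ∈ G) :
    A.transpose ∈ G := by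
  have h1 := (Matrix.mem_orthogonalGroup_iff _ _).1 (h.sub.1 A hA)
  have h2 : A⁻¹ = A.transpose := Matrix.inv_eq_right_inv h1
  rw [← h2]
  exact h.sub.2.2.2.1 A hA

theorem integral_mul_left (h : IsTransHaar G γ) {B : Mat n} (hB : Matrix.of B ∈ G) {F : Mat n → ℝ}
    (hF : Continuous F) :
    ∫ g, F (Matrix.of.symm (Matrix.of B * Matrix.of g)) ∂γ = ∫ g, F g ∂γ := by
  conv_rhs => rw [← h.inv B hB]
  exact (integral_map (continuous_matMul B).measurable.aemeasurable
    hF.aestronglyMeasurable).symm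

end IsTransHaar

end Isometries

section Averages

open scoped InnerProductSpace

variable {n : ℕ} {s : ℝ}

theorem posSq_mono {x y : ℝ} (h : x ≤ y) : posSq x ≤ posSq y :=
  pow_le_pow_left₀ (le_max_right _ _) (max_le_max_right _ h) 2

theorem continuous_posSq : Continuous posSq := (continuous_id.max continuous_const).pow 2

theorem continuous_trunc : Continuous trunc := by
  have := continuous_posSq
  unfold trunc
  fun_prop

/-- The cutoff function as a function on the whole space. -/
def cutoffAt (e : Sph n) (s : ℝ) (v : Eucl n) : ℝ :=
  ∏ j, posSq (1 + -1 * trunc (s * (v j - (e : Eucl n) j)) ^ 2)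

theorem continuous_cutoffAt (e : Sph n) (s : ℝ) : Continuous (cutoffAt e s) := by
  have h1 := continuous_posSq
  have h2 := continuous_trunc
  unfold cutoffAt
  fun_prop

theorem cutoffAt_nonneg (e : Sph n) (s : ℝ) (v : Eucl n) : 0 ≤ cutoffAt e s v :=
  Finset.prod_nonneg fun _ _ => posSq_nonneg _

theorem cutoffAt_le_one (e : Sph n) (s : ℝ) (v : Eucl n) : cutoffAt e s v ≤ 1 := by
  refine Finset.prod_le_one (fun _ _ => posSq_nonneg _) fun j _ => ?_
  refine (posSq_mono (y := 1) ?_).trans (by rw [posSq_of_nonneg] <;> norm_num)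
  linarith [sq_nonneg (trunc (s * (v j - (e : Eucl n) j)))]

theorem le_cutoffAt {e : Sph n} (hs : 0 ≤ s) {v : Eucl n} (h : s * ‖v - e‖ ≤ 1 / 2) :
    (9 / 16) ^ n ≤ cutoffAt e s v := by
  have : (9 / 16 : ℝ) ^ n = ∏ _j : Fin n, (9 / 16 : ℝ) := by
    rw [Finset.prod_const, Finset.card_univ, Fintype.card_fin]
  rw [this]
  refine Finset.prod_le_prod (fun _ _ => by norm_num) fun j _ => ?_
  have h1 : |s * (v j - (e : Eucl n) j)| ≤ 1 / 2 := by
    rw [abs_mul, abs_of_nonneg hs]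
    have := PiLp.norm_apply_le (v - (e : Eucl n)) j
    exact (mul_le_mul_of_nonneg_left this hs).trans h
  rw [trunc_of_abs_le (h1.trans (by norm_num))]
  have h2 : (s * (v j - (e : Eucl n) j)) ^ 2 ≤ (1 / 2) ^ 2 := sq_le_sq' (by linarith [(abs_le.1 h1).1])
    (abs_le.1 h1).2
  refine le_trans ?_ (posSq_mono (x := 3 / 4) (by linarith))
  rw [posSq_of_nonneg] <;> norm_num

theorem exists_net (e : Sph n) {k : ℕ} (hk : 1 ≤ k) :
    ∃ (Q : Type) (_ : Fintype Q) (w : Q → Sph n), (Fintype.card Q : ℝ) ≤ (5 * n * k : ℝ) ^ n ∧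
      ∀ v : Sph n, ∃ q, (k : ℝ) * ‖(v : Eucl n) - w q‖ ≤ 1 / 2 := by
  classical
  have hn : 1 ≤ n := by
    rcases Nat.eq_zero_or_pos n with rfl | h
    · have := norm_sph e
      simp [Subsingleton.elim (e : Eucl 0) 0] at this
    · exact h
  have hnk : (1 : ℝ) ≤ n * k := by exact_mod_cast Nat.mul_pos hn hk
  set L : ℕ := 2 * k * n with hL
  have hL0 : (0 : ℝ) < L := by
    rw [hL]
    push_cast
    linarith
  let cell : Sph n → Fin n → Finset.Icc (-(L : ℤ)) L := fun v j =>
    ⟨⌊(v : Eucl n) j * L⌋, by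
      have h1 : |(v : Eucl n) j| ≤ 1 := by
        have := PiLp.norm_apply_le (v : Eucl n) j
        rwa [norm_sph] at this
      obtain ⟨h2, h3⟩ := abs_le.1 h1
      rw [Finset.mem_Icc]
      constructor
      · rw [Int.le_floor]
        push_cast
        nlinarith
      · have : ⌊(v : Eucl n) j * L⌋ ≤ ⌊(L : ℝ)⌋ := Int.floor_mono (by nlinarith)
        simpa using this⟩
  refine ⟨Fin n → Finset.Icc (-(L : ℤ)) L, inferInstance,
    fun q => if h : ∃ v, cell v = q then h.choose else e, ?_, fun v => ⟨cell v, ?_⟩⟩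
  · rw [Fintype.card_fun, Fintype.card_fin, Fintype.card_coe, Int.card_Icc]
    push_cast
    refine pow_le_pow_left₀ (by positivity) ?_ n
    have : (((L : ℤ) + 1 - -(L : ℤ)).toNat : ℝ) = 2 * L + 1 := by
      have : (L : ℤ) + 1 - -(L : ℤ) = ((2 * L + 1 : ℕ) : ℤ) := by
        push_cast
        ring
      rw [this, Int.toNat_natCast]
      push_cast
      ring
    rw [this, hL]
    push_cast
    linarith
  · have hex : ∃ u, cell u = cell v := ⟨v, rfl⟩
    beta_reduce
    rw [dif_pos hex]
    have hu := hex.choose_spec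
    set u := hex.choose
    have hj : ∀ j, ((v : Eucl n) j - (u : Eucl n) j) ^ 2 ≤ (1 / L) ^ 2 := fun j => by
      have h1 : ⌊(u : Eucl n) j * L⌋ = ⌊(v : Eucl n) j * L⌋ := congrArg Subtype.val (congrFun hu j)
      have h2 := Int.abs_sub_lt_one_of_floor_eq_floor h1.symm
      rw [← sub_mul, abs_mul, abs_of_pos hL0] at h2
      refine sq_le_sq.2 ?_
      rw [abs_of_pos (by positivity : (0 : ℝ) < 1 / L), le_div_iff₀ hL0]
      exact h2.le
    have h3 : ‖(v : Eucl n) - u‖ ^ 2 ≤ (n / L) ^ 2 := by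
      rw [EuclideanSpace.norm_sq_eq]
      calc ∑ j, ‖((v : Eucl n) - u) j‖ ^ 2 ≤ ∑ _j : Fin n, (1 / L : ℝ) ^ 2 :=
            Finset.sum_le_sum fun j _ => by
              rw [Real.norm_eq_abs, sq_abs]
              exact hj j
        _ = n * (1 / L) ^ 2 := by simp
        _ ≤ n ^ 2 * (1 / L) ^ 2 := by
            refine mul_le_mul_of_nonneg_right ?_ (by positivity)
            exact_mod_cast Nat.le_self_pow two_ne_zero n
        _ = _ := by ring
    have h4 : ‖(v : Eucl n) - u‖ ≤ n / L := abs_le_of_sq_le_sq' h3 (by positivity) |>.2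
    have hk0 : (0 : ℝ) < k := by exact_mod_cast hk
    have hn0 : (0 : ℝ) < n := by exact_mod_cast hn
    calc (k : ℝ) * ‖(v : Eucl n) - u‖ ≤ k * (n / L) := by gcongr
      _ = 1 / 2 := by
        rw [hL]
        push_cast
        field_simp

/-- Averages of the cutoff functions over the group. -/
def avgCut (γ : Measure (Mat n)) (e : Sph n) (s : ℝ) (u : Sph n) : ℝ :=
  ∫ g, cutoffAt e s (Matrix.toEuclideanLin (Matrix.of g).transpose (u : Eucl n)) ∂γ

variable {G : Set (Matrix (Fin n) (Fin n) ℝ)} {γ : Measure (Mat n)}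

theorem continuous_cutoffAt_act (e : Sph n) (s : ℝ) : Continuous fun p : Mat n × Eucl n =>
    cutoffAt e s (Matrix.toEuclideanLin (Matrix.of p.1).transpose p.2) :=
  (continuous_cutoffAt e s).comp continuous_toEuclideanLin_transpose

theorem continuous_cutoffAt_act_left (e : Sph n) (s : ℝ) (v : Eucl n) : Continuous fun g : Mat n =>
    cutoffAt e s (Matrix.toEuclideanLin (Matrix.of g).transpose v) :=
  Continuous.comp (f := fun g : Mat n => (g, v)) (continuous_cutoffAt_act e s) (by fun_prop)

theorem IsTransHaar.avgCut_eq (h : IsTransHaar G γ) (e : Sph n) (s : ℝ) (u v : Sph n) :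
    avgCut γ e s u = avgCut γ e s v := by
  obtain ⟨B, hB, hBu⟩ := h.trans v u (norm_sph v) (norm_sph u)
  have := h.integral_mul_left (B := Matrix.of.symm B.transpose) (h.transpose_mem hB)
    (F := fun g => cutoffAt e s (Matrix.toEuclideanLin (Matrix.of g).transpose (v : Eucl n)))
    (continuous_cutoffAt_act_left e s v)
  rw [avgCut, avgCut, ← this]
  refine integral_congr_ae (Filter.Eventually.of_forall fun g => ?_)
  simp only [Equiv.apply_symm_apply, Matrix.transpose_mul, Matrix.transpose_transpose,
    toEuclideanLin_mul_apply, hBu]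

theorem integrable_of_abs_le [IsFiniteMeasure γ] {F : Mat n → ℝ} (hF : Continuous F) {C : ℝ}
    (hC : ∀ g, |F g| ≤ C) : Integrable F γ :=
  Integrable.of_bound hF.aestronglyMeasurable C (Filter.Eventually.of_forall hC)

theorem IsTransHaar.le_avgCut (h : IsTransHaar G γ) (e u : Sph n) {k : ℕ} (hk : 1 ≤ k) :
    (9 / 16) ^ n ≤ (5 * n * k : ℝ) ^ n * avgCut γ e k u := by
  have := h.prob
  obtain ⟨Q, _, w, hcard, hw⟩ := exists_net e hk
  have h_int : ∀ q, Integrable (fun g : Mat n => cutoffAt e k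
      (Matrix.toEuclideanLin (Matrix.of g).transpose (w q : Eucl n))) γ := fun q =>
    integrable_of_abs_le (C := 1)
      (continuous_cutoffAt_act_left e k (w q)) fun g => by
        rw [abs_of_nonneg (cutoffAt_nonneg _ _ _)]
        exact cutoffAt_le_one _ _ _
  have h1 : ∀ᵐ g ∂γ, ((9 / 16) ^ n : ℝ) ≤ ∑ q, cutoffAt e k
      (Matrix.toEuclideanLin (Matrix.of g).transpose (w q : Eucl n)) := by
    filter_upwards [h.ae_mem] with g hg
    obtain ⟨T, hT, hT'⟩ := exists_isometry_of_orthogonal (h.sub.1 _ hg)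
    obtain ⟨q, hq⟩ := hw (sphMap T e)
    refine le_trans (le_cutoffAt (Nat.cast_nonneg k) ?_) (Finset.single_le_sum
      (f := fun q => cutoffAt e k (Matrix.toEuclideanLin (Matrix.of g).transpose (w q : Eucl n)))
      (fun _ _ => cutoffAt_nonneg _ _ _) (Finset.mem_univ q))
    rw [← hT', ← T.norm_map, _root_.map_sub, T.apply_symm_apply, norm_sub_rev]
    exact hq
  have h2 := integral_mono_ae (integrable_const _) (integrable_finsetSum _ fun q _ => h_int q) h1
  rw [integral_finsetSum _ fun q _ => h_int q] at h2
  have h3 : ∀ q, ∫ g, cutoffAt e k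
      (Matrix.toEuclideanLin (Matrix.of g).transpose (w q : Eucl n)) ∂γ = avgCut γ e k u :=
    fun q => h.avgCut_eq e k (w q) u
  simp only [h3, integral_const, probReal_univ, one_smul, Finset.sum_const, Finset.card_univ,
    nsmul_eq_mul] at h2
  refine h2.trans (mul_le_mul_of_nonneg_right hcard ?_)
  exact integral_nonneg fun g => cutoffAt_nonneg _ _ _

end Averages

section Averaging

open scoped InnerProductSpace

variable {n d : ℕ} {s A : ℝ} {f : Sph n → ℝ}

theorem Reg.comp_sphMap (h : Reg s A f) (T : Eucl n ≃ₗᵢ[ℝ] Eucl n) :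
    Reg s A fun u => f (sphMap T u) := fun v => by
  obtain ⟨h1, ℓ, h2, h3⟩ := h (sphMap T v)
  refine ⟨h1, T.symm ℓ, by rwa [T.symm.norm_map], fun a => ?_⟩
  have e1 : ⟪T.symm ℓ, (a : Eucl n) - v⟫_ℝ = ⟪ℓ, (sphMap T a : Eucl n) - sphMap T v⟫_ℝ := by
    change _ = ⟪ℓ, T a - T v⟫_ℝ
    rw [← T.inner_map_map, T.apply_symm_apply, _root_.map_sub]
  have e2 : ‖(a : Eucl n) - v‖ = ‖(sphMap T a : Eucl n) - sphMap T v‖ := by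
    change _ = ‖T a - T v‖
    rw [← _root_.map_sub, T.norm_map]
  rw [e1, e2]
  exact h3 _

theorem Reg.continuous (h : Reg 1 A f) : Continuous f := by
  obtain ⟨K, hK⟩ := h.exists_body le_rfl
  have h1 : f = fun u => hs K u - A * (1 + 1 + 2 * 1 ^ 2) := by
    rw [hK]
    funext u
    ring
  rw [h1]
  exact (continuous_hs K).sub continuous_const

/-- As a function of its first argument, the symbol is continuous on convex bodies. -/
theorem IsSymbol.continuous_cons {φ : ConvexBody (Eucl n) → ℝ}
    {Φ : MultilinearMap ℝ (fun _ : Fin (d + 1) => Sph n → ℝ) ℝ} (hΦ : IsSymbol (d + 1) φ Φ)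
    (hc : Continuous φ) {x : Fin d → Sph n → ℝ} (hx : ∀ i, x i ∈ bodySpan n) :
    Continuous fun K : ConvexBody (Eucl n) => Φ (Fin.cons (hs K) x) := by
  let Ξ : MultilinearMap ℝ (fun _ : Fin d => Sph n → ℝ) (ConvexBody (Eucl n) → ℝ) :=
    MultilinearMap.pi fun K => Φ.curryLeft (hs K)
  let N : Submodule ℝ (ConvexBody (Eucl n) → ℝ) :=
    { carrier := {F | Continuous F}
      add_mem' := fun ha hb => Continuous.add ha hb
      zero_mem' := continuous_const
      smul_mem' := fun c _ ha => Continuous.const_smul ha c }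
  have key := MultilinearMap.mem_of_mem_span N Ξ (fun _ => Set.range hs) (fun y hy => by
    choose L hL using hy
    change Continuous fun K => Φ (Fin.cons (hs K) y)
    have : ∀ K, Φ (Fin.cons (hs K) y) = symF (d + 1) φ (Fin.cons K L) := fun K => by
      rw [← hΦ]
      congr 1
      funext i
      refine Fin.cases ?_ (fun i => ?_) i
      · simp
      · simp [hL]
    simp only [this]
    refine continuous_symF (fun _ => φ) (fun K => (Fin.cons K L : Fin (d + 1) → _)) ?_ ?_
    · exact hc.comp continuous_snd
    · refine continuous_pi fun i => ?_
      refine Fin.cases ?_ (fun i => ?_) i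
      · simpa using continuous_id'
      · simpa using continuous_const) x fun i => by
    rw [span_range_hs]
    exact hx i
  exact key

variable {G : Set (Matrix (Fin n) (Fin n) ℝ)} {γ : Measure (Mat n)}

theorem IsSymbol.abs_avg_le {φ : ConvexBody (Eucl n) → ℝ}
    {Φ : MultilinearMap ℝ (fun _ : Fin (d + 1) => Sph n → ℝ) ℝ} (hΦ : IsSymbol (d + 1) φ Φ)
    (hc : Continuous φ) (h : IsTransHaar G γ) (e : Sph n) (hs1 : 1 ≤ s) (hf : Reg 1 A f)
    {x : Fin d → Sph n → ℝ} (hx : ∀ i, x i ∈ bodySpan n) {δ : ℝ}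
    (hδ : ∀ g : Mat n, Matrix.of g ∈ G → |Φ (Fin.cons (fun u : Sph n =>
      cutoffAt e s (Matrix.toEuclideanLin (Matrix.of g).transpose (u : Eucl n)) * f u) x)| ≤ δ) :
    avgCut γ e s e * |Φ (Fin.cons f x)| ≤ δ := by
  have := h.prob
  have hA : 0 ≤ A := (abs_nonneg _).trans (hf e).1
  obtain ⟨Ac, hAc⟩ := reg_one_cutoff e hs1
  have hAc0 : 0 ≤ Ac := (abs_nonneg _).trans (hAc e).1
  set c := avgCut γ e s e with hcdef
  have hc0 : 0 ≤ c := integral_nonneg fun g => cutoffAt_nonneg _ _ _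
  set F : ConvexBody (Eucl n) → ℝ := fun K => Φ (Fin.cons (hs K) x) with hF
  have hFc : Continuous F := hΦ.continuous_cons hc hx
  have hFlin : ∀ (K L M : ConvexBody (Eucl n)) (a b : ℝ), hs M = a • hs K + b • hs L →
      F M = a * F K + b * F L := fun K L M a b hM => by
    change Φ.curryLeft (hs M) x = a * Φ.curryLeft (hs K) x + b * Φ.curryLeft (hs L) x
    rw [hM, _root_.map_add, _root_.map_smul, _root_.map_smul]
    rfl
  set C : ℝ := (4 * Ac * A + |c| * A) * (1 + 1 + 2 * 1 ^ 2) with hC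
  have hC0 : 0 ≤ C := by positivity
  obtain ⟨M, hM⟩ := (hf.smul c).exists_body (C := C) (by
    rw [hC]
    gcongr
    linarith [mul_nonneg (mul_nonneg zero_le_four hAc0) hA])
  have hbody : ∀ g : Mat n, Matrix.of g ∈ G → ∃ K, hs K = fun u : Sph n =>
      cutoffAt e s (Matrix.toEuclideanLin (Matrix.of g).transpose (u : Eucl n)) * f u + C := by
    intro g hg
    obtain ⟨T, -, hT⟩ := exists_isometry_of_orthogonal (h.sub.1 _ hg)
    obtain ⟨K, hK⟩ := ((hAc.comp_sphMap T.symm).mul hf zero_le_one).exists_body (C := C) (by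
      rw [hC]
      gcongr
      linarith [mul_nonneg (abs_nonneg c) hA])
    refine ⟨K, ?_⟩
    rw [hK]
    funext u
    rw [← hT]
    rfl
  set B := ballBody n hC0 with hB
  have hsB : hs B = fun _ => C := hs_ballBody hC0
  have hdiff : ∀ (K : ConvexBody (Eucl n)) (q : Sph n → ℝ), hs K = (fun u => q u + C) →
      F K - F B = Φ (Fin.cons q x) := fun K q hK => by
    change Φ.curryLeft (hs K) x - Φ.curryLeft (hs B) x = Φ.curryLeft q x
    have : q = hs K - hs B := by
      rw [hK, hsB]
      funext u
      simp
    rw [this, _root_.map_sub]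
    rfl
  let S : Set C(Sph n, ℝ) := {q | ∃ K, hs K = q ∧ |F K - F B| ≤ δ}
  have hSconv : Convex ℝ S := by
    rintro q ⟨K, hK, hK'⟩ r ⟨L, hL, hL'⟩ a b ha hb hab
    have hsum : hs (a • K + b • L) = a • hs K + b • hs L := by
      rw [hs_add, hs_smul ha, hs_smul hb]
    refine ⟨a • K + b • L, ?_, ?_⟩
    · rw [hsum, hK, hL]
      rfl
    · rw [hFlin K L _ a b hsum]
      have e1 : a * F K + b * F L - F B = a * (F K - F B) + b * (F L - F B) := by
        linear_combination F B * hab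
      rw [e1]
      calc _ ≤ |a * (F K - F B)| + |b * (F L - F B)| := abs_add_le _ _
        _ ≤ a * δ + b * δ := by
          rw [abs_mul, abs_mul, abs_of_nonneg ha, abs_of_nonneg hb]
          gcongr
        _ = δ := by rw [← add_mul, hab, one_mul]
  let H : C(Mat n × Sph n, ℝ) := ⟨fun p =>
    cutoffAt e s (Matrix.toEuclideanLin (Matrix.of p.1).transpose (p.2 : Eucl n)) * f p.2 + C,
    ((Continuous.comp (f := fun p : Mat n × Sph n => (p.1, (p.2 : Eucl n)))
      (continuous_cutoffAt_act e s) (by fun_prop)).mul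
      (hf.continuous.comp continuous_snd)).add continuous_const⟩
  have hHint : Integrable (fun g => H.curry g) γ := by
    refine Integrable.of_bound H.curry.continuous.aestronglyMeasurable (A + C)
      (Filter.Eventually.of_forall fun g => ?_)
    rw [ContinuousMap.norm_le _ (by positivity)]
    intro u
    change |cutoffAt e s _ * f u + C| ≤ A + C
    refine (abs_add_le _ _).trans (add_le_add ?_ (abs_of_nonneg hC0).le)
    rw [abs_mul, abs_of_nonneg (cutoffAt_nonneg _ _ _)]
    exact (mul_le_of_le_one_left (abs_nonneg _) (cutoffAt_le_one _ _ _)).trans (hf u).1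
  have hmem : ∫ g, H.curry g ∂γ ∈ closure S := by
    refine hSconv.closure.integral_mem isClosed_closure ?_ hHint
    filter_upwards [h.ae_mem] with g hg
    obtain ⟨K, hK⟩ := hbody g hg
    refine subset_closure ⟨K, hK, ?_⟩
    rw [hdiff K _ hK]
    exact hδ g hg
  have happly : ∀ u, (∫ g, H.curry g ∂γ) u = hs M u := fun u => by
    rw [ContinuousMap.integral_apply hHint, hM]
    change ∫ g, (cutoffAt e s (Matrix.toEuclideanLin (Matrix.of g).transpose (u : Eucl n)) * f u + C)
      ∂γ = c * f u + C
    have hi : Integrable (fun g : Mat n => cutoffAt e s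
        (Matrix.toEuclideanLin (Matrix.of g).transpose (u : Eucl n))) γ :=
      integrable_of_abs_le (C := 1) (continuous_cutoffAt_act_left e s u) fun g => by
        rw [abs_of_nonneg (cutoffAt_nonneg _ _ _)]
        exact cutoffAt_le_one _ _ _
    rw [integral_add (hi.mul_const _) (integrable_const _), integral_mul_const, integral_const,
      probReal_univ, one_smul]
    congr 2
    exact h.avgCut_eq e s u e
  have hle : |F M - F B| ≤ δ := by
    have hcl : M ∈ closure {K | |F K - F B| ≤ δ} := by
      rw [Metric.mem_closure_iff]
      intro ε hε
      obtain ⟨q, ⟨K, hK, hK'⟩, hq⟩ := Metric.mem_closure_iff.1 hmem (ε / 2) (by positivity)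
      refine ⟨K, hK', lt_of_le_of_lt (dist_le_of_hs (by positivity) fun u => ?_) (half_lt_self hε)⟩
      rw [← happly u, hK, ← Real.dist_eq]
      exact (ContinuousMap.dist_apply_le_dist u).trans hq.le
    have hclosed : IsClosed {K | |F K - F B| ≤ δ} :=
      isClosed_le (hFc.sub continuous_const).abs continuous_const
    rwa [hclosed.closure_eq] at hcl
  rw [hdiff M _ hM] at hle
  have e2 : Φ (Fin.cons (fun u => c * f u) x) = c * Φ (Fin.cons f x) := by
    change Φ.curryLeft (c • f) x = c * Φ.curryLeft f x
    rw [_root_.map_smul]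
    rfl
  rwa [e2, abs_mul, abs_of_nonneg hc0] at hle

end Averaging

section GlobalEstimate

variable {n d : ℕ} {G : Set (Matrix (Fin n) (Fin n) ℝ)} {γ : Measure (Mat n)}

theorem exists_reg_comp {f : Eucl n → ℝ} (hf : f ∈ polyAlg n) (e : Sph n)
    (T : Eucl n ≃ₗᵢ[ℝ] Eucl n) : ∃ B, Reg 1 B fun u : Sph n => f (T u) := by
  obtain ⟨κ, _, α, A, hA⟩ := exists_expansion hf e
  obtain ⟨a, -, ha⟩ := hA T
  simp only [ha]
  exact exists_reg_sum_monomials e _ _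

theorem matBody_eq_map {A : Matrix (Fin n) (Fin n) ℝ} {T : Eucl n ≃ₗᵢ[ℝ] Eucl n}
    (hT : ∀ v, T v = Matrix.toEuclideanLin A v) (K : ConvexBody (Eucl n)) :
    K.map (T.toContinuousLinearEquiv : Eucl n →L[ℝ] Eucl n) = matBody A K :=
  ConvexBody.ext (Set.image_congr fun v _ => hT v)

theorem IsSymbol.exists_global_estimate (h : IsTransHaar G γ) (f : Fin (d + 1) → Eucl n → ℝ)
    (hf : ∀ i, f i ∈ polyAlg n) (e : Sph n) {C : ℝ} (hC : 0 ≤ C) :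
    ∃ C', 0 ≤ C' ∧ ∀ (φ : ConvexBody (Eucl n) → ℝ)
      (Φ : MultilinearMap ℝ (fun _ : Fin (d + 1) => Sph n → ℝ) ℝ) (k : ℕ),
      IsSymbol (d + 1) φ Φ → IsVal φ → GInv G φ → RegBound Φ C → 1 ≤ k →
      (∀ α : Fin (d + 1) → Fin n → ℕ, (∀ i j, α i j ≤ 2 * (d + 1) + n) →
        Φ (locMono e k α) = 0) →
      |Φ fun i u => f i u| ≤ C' * (k : ℝ)⁻¹ := by
  obtain ⟨C₁, hC₁, hloc⟩ := IsSymbol.exists_local_estimate f hf e (2 * (d + 1) + n) hC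
  refine ⟨(16 / 9) ^ n * (5 * n) ^ n * C₁, by positivity, ?_⟩
  intro φ Φ k hΦ hφ hinv hb hk hzero
  have hk1 : (1 : ℝ) ≤ k := by exact_mod_cast hk
  have hk0 : (0 : ℝ) < k := zero_lt_one.trans_le hk1
  obtain ⟨B, hB⟩ := exists_reg_comp (hf 0) e (LinearIsometryEquiv.refl ℝ (Eucl n))
  have havg := hΦ.abs_avg_le hφ.cont h e hk1 hB (x := fun i u => f i.succ u) (fun i => by
    obtain ⟨B, hB⟩ := exists_reg_comp (hf i.succ) e (LinearIsometryEquiv.refl ℝ (Eucl n))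
    exact hB.mem_bodySpan) (δ := C₁ * (k ^ (2 * (d + 1)) * ((k : ℝ)⁻¹) ^ (2 * (d + 1) + n + 1)))
    (fun g hg => by
      obtain ⟨T, hT, hT'⟩ := exists_isometry_of_orthogonal (h.sub.1 _ hg)
      have key := hloc φ Φ k hΦ hφ hb hk1 hzero T
      rw [← hΦ.comp_sphMap T (fun K => by rw [matBody_eq_map hT]; exact hinv _ hg K)] at key
      · convert key using 3
        funext i u
        refine Fin.cases ?_ (fun i => ?_) i
        · simp only [Fin.cons_zero, Function.comp_apply, ← hT']
          congr 2
          exact (T.apply_symm_apply _).symm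
        · simp only [Fin.cons_succ, Function.comp_apply]
          congr 1
          exact (T.apply_symm_apply _).symm
      · intro i
        refine Fin.cases ?_ (fun i => ?_) i
        · obtain ⟨A₀, h₀⟩ := reg_one_cutoff e hk1
          obtain ⟨A₁, h₁⟩ := exists_reg_comp (hf 0) e T
          exact (h₀.mul h₁ zero_le_one).mem_bodySpan
        · obtain ⟨A₁, h₁⟩ := exists_reg_comp (hf i.succ) e T
          exact h₁.mem_bodySpan)
  have hcons : (Fin.cons (fun u : Sph n => f 0 (LinearIsometryEquiv.refl ℝ (Eucl n) u))
      fun i (u : Sph n) => f i.succ u : Fin (d + 1) → Sph n → ℝ) = fun i (u : Sph n) => f i u := by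
    funext i
    refine Fin.cases ?_ (fun i => ?_) i <;> rfl
  rw [hcons] at havg
  set X := |Φ fun i u => f i u|
  have hX : 0 ≤ X := abs_nonneg _
  have hlow := h.le_avgCut e e hk
  have h1 : (9 / 16) ^ n * X ≤ (5 * n * k : ℝ) ^ n *
      (C₁ * (k ^ (2 * (d + 1)) * ((k : ℝ)⁻¹) ^ (2 * (d + 1) + n + 1))) :=
    calc _ ≤ ((5 * n * k : ℝ) ^ n * avgCut γ e k e) * X := mul_le_mul_of_nonneg_right hlow hX
      _ = (5 * n * k : ℝ) ^ n * (avgCut γ e k e * X) := by ring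
      _ ≤ _ := mul_le_mul_of_nonneg_left havg (by positivity)
  have h2 : (5 * n * k : ℝ) ^ n *
      (C₁ * (k ^ (2 * (d + 1)) * ((k : ℝ)⁻¹) ^ (2 * (d + 1) + n + 1))) =
      (5 * n) ^ n * C₁ * (k : ℝ)⁻¹ := by
    rw [pow_succ, pow_add, inv_pow, inv_pow, mul_pow (5 * n : ℝ)]
    field_simp
  rw [h2] at h1
  have h3 : X = (16 / 9) ^ n * ((9 / 16) ^ n * X) := by
    rw [← mul_assoc, ← mul_pow]
    norm_num
  rw [h3]
  calc (16 / 9 : ℝ) ^ n * ((9 / 16) ^ n * X) ≤ (16 / 9) ^ n * ((5 * n) ^ n * C₁ * (k : ℝ)⁻¹) :=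
        mul_le_mul_of_nonneg_left h1 (by positivity)
    _ = _ := by ring

end GlobalEstimate

namespace Polynomial

theorem exists_derivative_eq (p : Polynomial ℝ) : ∃ P : Polynomial ℝ, derivative P = p := by
  induction p using Polynomial.induction_on' with
  | add p q hp hq =>
    obtain ⟨P, rfl⟩ := hp
    obtain ⟨Q, rfl⟩ := hq
    exact ⟨P + Q, derivative_add⟩
  | monomial k a =>
    refine ⟨monomial (k + 1) (a / (k + 1)), ?_⟩
    rw [derivative_monomial]
    congr 1
    push_cast
    field_simp

theorem exists_odd_derivative_eq (k : ℕ) : ∃ P : Polynomial ℝ,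
    derivative P = (1 - X ^ 2) ^ k ∧ ∀ t, P.eval (-t) = -P.eval t := by
  obtain ⟨P, hP⟩ := exists_derivative_eq ((1 - X ^ 2) ^ k)
  refine ⟨C (1 / 2) * (P - P.comp (-X)), ?_, fun t => ?_⟩
  · have h2 : (C (1 / 2 : ℝ)) * 2 = 1 := by
      rw [← C_ofNat, ← C_mul]; norm_num
    rw [derivative_C_mul, derivative_sub, derivative_comp, hP]
    simp only [derivative_neg, derivative_X, pow_comp, sub_comp, one_comp, X_comp, neg_sq,
      neg_mul, one_mul, sub_neg_eq_add]
    rw [← two_mul, ← mul_assoc, h2, one_mul]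
  · simp only [eval_mul, eval_C, eval_sub, eval_comp, eval_neg, eval_X, neg_neg]
    ring

/-- Convex polynomials approximating the absolute value on `[-1, 1]`. -/
theorem exists_convexOn_approx_abs {η : ℝ} (hη : 0 < η) : ∃ q : Polynomial ℝ,
    ConvexOn ℝ (Set.Icc (-1) 1) (fun t => q.eval t) ∧
    (∀ s ∈ Set.Icc (-1 : ℝ) 1, ∀ t ∈ Set.Icc (-1 : ℝ) 1, |q.eval s - q.eval t| ≤ |s - t|) ∧
    ∀ t ∈ Set.Icc (-1 : ℝ) 1, |(q.eval t) - (|t|)| ≤ η := by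
  obtain ⟨m, hm⟩ := exists_nat_gt (1 / η)
  have hm0 : (0 : ℝ) < m := (by positivity : 0 < 1 / η).trans hm
  have hm1 : (1 : ℝ) ≤ m := by exact_mod_cast hm0
  set k := m ^ 2 with hk
  obtain ⟨P, hP, hodd⟩ := exists_odd_derivative_eq k
  have hder : ∀ t, HasDerivAt (fun t => P.eval t) ((1 - t ^ 2) ^ k) t := fun t => by
    have := P.hasDerivAt t
    rw [hP] at this
    simpa using this
  have hP0 : P.eval 0 = 0 := by have := hodd 0; simp at this; linarith
  have hsq : ∀ t ∈ Set.Icc (-1 : ℝ) 1, 0 ≤ 1 - t ^ 2 := fun t ht => by nlinarith [ht.1, ht.2]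
  have hmono : MonotoneOn (fun t => P.eval t) (Set.Icc (-1) 1) := by
    refine monotoneOn_of_deriv_nonneg (convex_Icc _ _) P.continuous.continuousOn
      (fun t _ => (hder t).differentiableAt.differentiableWithinAt) fun t ht => ?_
    rw [(hder t).deriv]
    exact pow_nonneg (hsq t (interior_subset ht)) _
  have hlow : 2 / (3 * m) ≤ P.eval (1 : ℝ) := by
    have h1 : MonotoneOn (fun t : ℝ => P.eval t - (t - k * t ^ 3 / 3)) (Set.Icc 0 1) := by
      have hd : ∀ t : ℝ, HasDerivAt (fun t : ℝ => P.eval t - (t - k * t ^ 3 / 3))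
          ((1 - t ^ 2) ^ k - (1 - k * t ^ 2)) t := fun t => by
        refine (hder t).sub ((hasDerivAt_id t).sub ?_)
        have := (((hasDerivAt_id t).pow 3).const_mul (k : ℝ)).div_const 3
        refine this.congr_deriv ?_
        simp only [id]
        push_cast
        ring
      refine monotoneOn_of_deriv_nonneg (convex_Icc _ _)
        (fun t _ => (hd t).continuousAt.continuousWithinAt)
        (fun t _ => (hd t).differentiableAt.differentiableWithinAt) fun t ht => ?_
      rw [(hd t).deriv]
      have ht' := interior_subset ht
      have := one_add_mul_le_pow (a := -t ^ 2) (by nlinarith [ht'.1, ht'.2]) k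
      rw [show (1 : ℝ) - t ^ 2 = 1 + -t ^ 2 by ring]
      linarith
    have hmi : (m : ℝ)⁻¹ ≤ 1 := inv_le_one_of_one_le₀ hm1
    have hmi0 : 0 ≤ (m : ℝ)⁻¹ := by positivity
    have h2 := h1 (Set.left_mem_Icc.2 zero_le_one) ⟨hmi0, hmi⟩ hmi0
    have h3 := hmono (⟨by linarith, hmi⟩ : (m : ℝ)⁻¹ ∈ Set.Icc (-1 : ℝ) 1)
      (Set.right_mem_Icc.2 (by norm_num)) hmi
    simp only [hP0] at h2 h3
    have h4 : (m : ℝ)⁻¹ - k * (m : ℝ)⁻¹ ^ 3 / 3 = 2 / (3 * m) := by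
      rw [hk]; push_cast; field_simp; ring
    rw [h4] at h2
    linarith
  set b := P.eval (1 : ℝ) with hb
  have hb0 : 0 < b := lt_of_lt_of_le (by positivity) hlow
  set q : Polynomial ℝ := C b⁻¹ * (X * P + C (1 / (2 * ((k : ℝ) + 1))) * (1 - X ^ 2) ^ (k + 1))
    with hq
  have hqe : ∀ t, q.eval t = b⁻¹ * (t * P.eval t + 1 / (2 * ((k : ℝ) + 1)) * (1 - t ^ 2) ^ (k + 1)) :=
    fun t => by simp [hq]
  have hqd : ∀ t, HasDerivAt (fun t => q.eval t) (b⁻¹ * P.eval t) t := fun t => by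
    simp only [hqe]
    have h1 := (hasDerivAt_id t).mul (hder t)
    have h2 := (((hasDerivAt_id t).pow 2).const_sub 1).pow (k + 1)
    have h3 := (h1.add (h2.const_mul (1 / (2 * ((k : ℝ) + 1))))).const_mul b⁻¹
    refine h3.congr_deriv ?_
    simp only [id, Nat.add_sub_cancel, Pi.pow_apply]
    push_cast
    field_simp
    ring
  have hPle : ∀ t ∈ Set.Icc (-1 : ℝ) 1, |P.eval t| ≤ b := fun t ht => by
    rw [abs_le]
    constructor
    · have := hmono (Set.left_mem_Icc.2 (by norm_num)) ht ht.1
      have h := hodd 1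
      simp only at this
      rw [h] at this
      exact this
    · exact hmono ht (Set.right_mem_Icc.2 (by norm_num)) ht.2
  have hdle : ∀ t ∈ Set.Icc (-1 : ℝ) 1, |b⁻¹ * P.eval t| ≤ 1 := fun t ht => by
    rw [abs_mul, abs_of_pos (inv_pos.2 hb0), inv_mul_le_iff₀ hb0, mul_one]
    exact hPle t ht
  have heven : ∀ t, q.eval (-t) = q.eval t := fun t => by
    rw [hqe, hqe, hodd]; ring
  have hq1 : q.eval 1 = 1 := by
    rw [hqe]; simp [← hb, hb0.ne']
  have hq0 : q.eval 0 ≤ η := by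
    rw [hqe]
    simp only [zero_mul, zero_add, ne_eq, OfNat.ofNat_ne_zero, not_false_eq_true, zero_pow,
      sub_zero, one_pow, mul_one]
    have h1 : b⁻¹ ≤ (2 / (3 * m) : ℝ)⁻¹ := inv_anti₀ (by positivity) hlow
    have h2 : 1 < m * η := by rwa [div_lt_iff₀ hη] at hm
    have h3 : (k : ℝ) = (m : ℝ) ^ 2 := by rw [hk]; push_cast; rfl
    have h5 : (2 / (3 * m) : ℝ)⁻¹ = 3 * m / 2 := by rw [inv_div]
    rw [h5] at h1
    calc b⁻¹ * (1 / (2 * ((k : ℝ) + 1))) ≤ 3 * m / 2 * (1 / (2 * ((k : ℝ) + 1))) := by gcongr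
      _ ≤ η := by
        rw [mul_one_div, div_le_iff₀ (by positivity), h3]
        nlinarith
  refine ⟨q, ?_, fun s hs t ht => ?_, fun t ht => ?_⟩
  · refine MonotoneOn.convexOn_of_deriv (convex_Icc _ _) q.continuous.continuousOn
      (fun t _ => (hqd t).differentiableAt.differentiableWithinAt) fun s hs t ht hst => ?_
    rw [(hqd s).deriv, (hqd t).deriv]
    exact mul_le_mul_of_nonneg_left (hmono (interior_subset hs) (interior_subset ht) hst)
      (inv_pos.2 hb0).le
  · have := (convex_Icc (-1 : ℝ) 1).norm_image_sub_le_of_norm_hasDerivWithin_le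
      (f := fun t => q.eval t) (C := 1)
      (fun x _ => (hqd x).hasDerivWithinAt) (fun x hx => hdle x hx) ht hs
    simpa using this
  · have key : ∀ t ∈ Set.Icc (0 : ℝ) 1, |q.eval t - t| ≤ η := fun t ht => by
      have hd : ∀ t : ℝ, HasDerivAt (fun t : ℝ => q.eval t - t) (b⁻¹ * P.eval t - 1) t :=
        fun t => (hqd t).sub (hasDerivAt_id t)
      have ha : AntitoneOn (fun t : ℝ => q.eval t - t) (Set.Icc 0 1) := by
        refine antitoneOn_of_deriv_nonpos (convex_Icc _ _)
          (fun t _ => (hd t).continuousAt.continuousWithinAt)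
          (fun t _ => (hd t).differentiableAt.differentiableWithinAt) fun t ht => ?_
        have ht' := interior_subset ht
        rw [(hd t).deriv]
        linarith [le_abs_self (b⁻¹ * P.eval t), hdle t ⟨by linarith [ht'.1], ht'.2⟩]
      have h1 := ha (Set.left_mem_Icc.2 zero_le_one) ht ht.1
      have h2 := ha ht (Set.right_mem_Icc.2 zero_le_one) ht.2
      simp only [hq1, sub_zero, sub_self] at h1 h2
      rw [abs_le]
      constructor <;> linarith
    rcases le_total 0 t with h | h
    · rw [abs_of_nonneg h]
      exact key t ⟨h, ht.2⟩
    · rw [abs_of_nonpos h, ← heven]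
      exact key (-t) ⟨by linarith, by linarith [ht.1]⟩

end Polynomial

section PolynomialBodies

open scoped InnerProductSpace

variable {n : ℕ}

/-- `h` is, on the ball of radius `2`, a uniform limit of convex polynomials. -/
def PolyApprox (h : Eucl n → ℝ) : Prop :=
  ∀ δ : ℝ, 0 < δ → ∃ f ∈ polyAlg n, ConvexOn ℝ (Metric.closedBall (0 : Eucl n) 2) f ∧
    ∀ v ∈ Metric.closedBall (0 : Eucl n) 2, |f v - h v| ≤ δ

theorem PolyApprox.inner (x : Eucl n) : PolyApprox fun v => ⟪x, v⟫_ℝ := fun δ hδ => by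
  refine ⟨fun v => ⟪v, x⟫_ℝ, inner_mem_polyAlg x, ⟨convex_closedBall _ _, ?_⟩, fun v _ => ?_⟩
  · intro u _ v _ a b _ _ _
    simp only [inner_add_left, real_inner_smul_left, smul_eq_mul, le_refl]
  · simp only [real_inner_comm, sub_self, abs_zero]
    exact hδ.le

theorem polynomial_comp_mem_polyAlg (q : Polynomial ℝ) {f : Eucl n → ℝ} (hf : f ∈ polyAlg n) :
    (fun v => q.eval (f v)) ∈ polyAlg n := by
  have h : (Polynomial.aeval f q : Eucl n → ℝ) ∈ polyAlg n := by
    have := (Polynomial.aeval (⟨f, hf⟩ : polyAlg n) q).2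
    rwa [← Subalgebra.coe_val, ← Polynomial.aeval_algHom_apply] at this
  have h2 : (Polynomial.aeval f q : Eucl n → ℝ) = fun v => q.eval (f v) := by
    ext v
    rw [Polynomial.aeval_fn_apply, Polynomial.coe_aeval_eq_eval]
  rwa [h2] at h

theorem PolyApprox.sup {a b : Eucl n → ℝ} (ha : PolyApprox a) (hb : PolyApprox b) :
    PolyApprox fun v => max (a v) (b v) := fun δ hδ => by
  obtain ⟨f, hf, hfc, hfa⟩ := ha (δ / 2) (by positivity)
  obtain ⟨g, hg, hgc, hgb⟩ := hb (δ / 2) (by positivity)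
  obtain ⟨T₀, hT₀⟩ := (isCompact_closedBall (0 : Eucl n) 2).exists_bound_of_continuousOn
    ((continuous_of_mem_polyAlg hf).sub (continuous_of_mem_polyAlg hg)).continuousOn
  set T := max T₀ 1 with hT
  have hTpos : 0 < T := lt_max_of_lt_right one_pos
  have hbd : ∀ v ∈ Metric.closedBall (0 : Eucl n) 2, |f v - g v| ≤ T := fun v hv =>
    (hT₀ v hv).trans (le_max_left _ _)
  have hIcc : ∀ z : ℝ, |z| ≤ T → z / T ∈ Set.Icc (-1 : ℝ) 1 := fun z hz => by
    rw [← abs_le.trans Set.mem_Icc.symm, abs_div, abs_of_pos hTpos, div_le_one hTpos]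
    exact hz
  obtain ⟨q, hqc, hql, hqa⟩ := Polynomial.exists_convexOn_approx_abs (div_pos hδ hTpos)
  have hmem : (fun v => (1 / 2 : ℝ) * (f v + g v) + (T / 2) * q.eval ((1 / T) * (f v - g v)))
      ∈ polyAlg n := by
    have h1 := polynomial_comp_mem_polyAlg q
      ((polyAlg n).mul_mem (const_mem_polyAlg (1 / T)) ((polyAlg n).sub_mem hf hg))
    exact (polyAlg n).add_mem
      ((polyAlg n).mul_mem (const_mem_polyAlg _) ((polyAlg n).add_mem hf hg))
      ((polyAlg n).mul_mem (const_mem_polyAlg _) h1)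
  refine ⟨_, hmem, ⟨convex_closedBall _ _, ?_⟩, fun v hv => ?_⟩
  · intro u hu v hv s t hs0 ht0 hst
    have hw := convex_closedBall (0 : Eucl n) 2 hu hv hs0 ht0 hst
    have hfw := hfc.2 hu hv hs0 ht0 hst
    have hgw := hgc.2 hu hv hs0 ht0 hst
    have hq := hqc.2 (hIcc _ (hbd u hu)) (hIcc _ (hbd v hv)) hs0 ht0 hst
    have hmid := (convex_Icc (-1 : ℝ) 1) (hIcc _ (hbd u hu)) (hIcc _ (hbd v hv)) hs0 ht0 hst
    have hlip := hql _ (hIcc _ (hbd _ hw)) _ hmid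
    set w := s • u + t • v
    simp only [smul_eq_mul] at hfw hgw hq hlip ⊢
    have e1 : |(f w - g w) / T - (s * ((f u - g u) / T) + t * ((f v - g v) / T))|
        ≤ ((s * f u + t * f v - f w) + (s * g u + t * g v - g w)) / T := by
      rw [show (f w - g w) / T - (s * ((f u - g u) / T) + t * ((f v - g v) / T))
        = ((s * g u + t * g v - g w) - (s * f u + t * f v - f w)) / T by field_simp; ring,
        abs_div, abs_of_pos hTpos]
      gcongr
      rw [abs_le]
      constructor <;> linarith
    have e2 : q.eval ((f w - g w) / T) ≤
        (s * q.eval ((f u - g u) / T) + t * q.eval ((f v - g v) / T)) +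
        ((s * f u + t * f v - f w) + (s * g u + t * g v - g w)) / T := by
      linarith [(le_abs_self _).trans (hlip.trans e1)]
    have e3 := mul_le_mul_of_nonneg_left e2 (by positivity : 0 ≤ T / 2)
    have e4 : T / 2 * ((s * q.eval ((f u - g u) / T) + t * q.eval ((f v - g v) / T)) +
        ((s * f u + t * f v - f w) + (s * g u + t * g v - g w)) / T) =
        s * (T / 2 * q.eval ((f u - g u) / T)) + t * (T / 2 * q.eval ((f v - g v) / T)) +
        ((s * f u + t * f v - f w) + (s * g u + t * g v - g w)) / 2 := by
      field_simp
    simp only [one_div_mul_eq_div]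
    rw [e4] at e3
    linarith
  · have h1 := hqa _ (hIcc _ (hbd v hv))
    rw [abs_div, abs_of_pos hTpos] at h1
    have h2 : |T / 2 * q.eval ((f v - g v) / T) - |f v - g v| / 2| ≤ δ / 2 := by
      rw [show T / 2 * q.eval ((f v - g v) / T) - |f v - g v| / 2
        = T / 2 * (q.eval ((f v - g v) / T) - |f v - g v| / T) by field_simp,
        abs_mul, abs_of_pos (by positivity : 0 < T / 2)]
      calc T / 2 * _ ≤ T / 2 * (δ / T) := by gcongr
        _ = δ / 2 := by field_simp
    have h3 : |max (f v) (g v) - max (a v) (b v)| ≤ δ / 2 :=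
      (abs_max_sub_max_le_max _ _ _ _).trans (max_le (hfa v hv) (hgb v hv))
    have h4 : max (f v) (g v) = 1 / 2 * (f v + g v) + |f v - g v| / 2 := by
      rw [max_def, abs_sub_comm]
      split_ifs with h
      · rw [abs_of_nonneg (by linarith)]; ring
      · rw [abs_of_nonpos (by linarith)]; ring
    simp only [one_div_mul_eq_div] at *
    rw [abs_le] at h2 h3 ⊢
    constructor <;> linarith [h2.1, h2.2, h3.1, h3.2]

theorem PolyApprox.sup' {ι : Type*} {s : Finset ι} (hne : s.Nonempty) {h : ι → Eucl n → ℝ}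
    (hh : ∀ i ∈ s, PolyApprox (h i)) : PolyApprox fun v => s.sup' hne fun i => h i v := by
  induction hne using Finset.Nonempty.cons_induction with
  | singleton a => simpa using hh a (Finset.mem_singleton_self a)
  | cons a s has hne ih =>
    simp only [Finset.sup'_cons hne]
    exact (hh a (Finset.mem_cons_self a s)).sup
      (ih fun i hi => hh i (Finset.mem_cons.2 (Or.inr hi)))

theorem supp_polytope {m : ℕ} (v : Fin (m + 1) → Eucl n) (u : Eucl n) :
    supp (polytope v) u = Finset.univ.sup' Finset.univ_nonempty fun i => ⟪v i, u⟫_ℝ := by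
  refine le_antisymm (supp_le ?_) (Finset.sup'_le _ _ fun i _ => inner_le_supp (mem_polytope v i) u)
  refine polytope_subset (C := {x | ⟪x, u⟫_ℝ ≤ _}) ?_ v fun i =>
    Finset.le_sup' (f := fun i => ⟪v i, u⟫_ℝ) (Finset.mem_univ i)
  exact convex_halfSpace_le ⟨fun x y => inner_add_left x y u,
    fun c x => real_inner_smul_left x u c⟩ _

theorem PolyApprox.exists_body {K : ConvexBody (Eucl n)} (h : PolyApprox (supp K)) {δ : ℝ}
    (hδ : 0 < δ) : ∃ f ∈ polyAlg n, ∃ P : ConvexBody (Eucl n), (hs P = fun u : Sph n => f u) ∧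
      dist P K ≤ 4 * δ := by
  obtain ⟨f, hf, hfc, hfh⟩ := h δ hδ
  have hball : ∀ (c : ℝ) (v : Sph n), 0 ≤ c → c ≤ 2 →
      c • (v : Eucl n) ∈ Metric.closedBall (0 : Eucl n) 2 := fun c v h0 h2 => by
    rw [mem_closedBall_zero_iff, norm_smul, norm_sph, mul_one, Real.norm_of_nonneg h0]
    exact h2
  have hball1 : ∀ v : Sph n, (v : Eucl n) ∈ Metric.closedBall (0 : Eucl n) 2 := fun v => by
    simp
  obtain ⟨P, hP⟩ := exists_body_of_sphere (fun u : Sph n => f u + 3 * δ) (by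
    intro a b v x y r hx hy hr hab
    rcases (add_nonneg hx hy).eq_or_lt with h0 | h0
    · have hx0 : x = 0 := by linarith
      have hy0 : y = 0 := by linarith
      have : ‖r • (v : Eucl n)‖ = 0 := by rw [← hab, hx0, hy0]; simp
      rw [norm_smul, norm_sph, mul_one, norm_eq_zero] at this
      simp [this, hx0, hy0]
    · set σ := x + y with hσ
      have hrσ : r ≤ σ := by
        calc r = ‖r • (v : Eucl n)‖ := by
              rw [norm_smul, norm_sph, mul_one, Real.norm_of_nonneg hr]
          _ ≤ ‖x • (a : Eucl n)‖ + ‖y • (b : Eucl n)‖ := by rw [← hab]; exact norm_add_le _ _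
          _ = σ := by
            rw [norm_smul, norm_smul, norm_sph, norm_sph, Real.norm_of_nonneg hx,
              Real.norm_of_nonneg hy, mul_one, mul_one]
      have hρ1 : r / σ ≤ 1 := (div_le_one h0).2 hrσ
      have hρ0 : 0 ≤ r / σ := by positivity
      have e1 := hfc.2 (hball1 a) (hball1 b) (by positivity : 0 ≤ x / σ)
        (by positivity : 0 ≤ y / σ) (by field_simp; exact hσ.symm)
      obtain ⟨D, hDe⟩ : ∃ D, D = 2 * σ - r := ⟨_, rfl⟩
      have hD : 0 < D := by linarith
      have e2 := hfc.2 (hball (r / σ) v hρ0 (by linarith)) (hball 2 v (by norm_num) le_rfl)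
        (div_nonneg h0.le hD.le : 0 ≤ σ / D)
        (div_nonneg (by linarith) hD.le : 0 ≤ (σ - r) / D)
        (by rw [← add_div, div_eq_one_iff_eq hD.ne']; linarith)
      have p1 : (x / σ) • (a : Eucl n) + (y / σ) • (b : Eucl n) = (r / σ) • (v : Eucl n) := by
        rw [div_eq_inv_mul, div_eq_inv_mul, div_eq_inv_mul, mul_smul, mul_smul, mul_smul,
          ← smul_add, hab]
      have p2 : (σ / D) • (r / σ) • (v : Eucl n) +
          ((σ - r) / D) • (2 : ℝ) • (v : Eucl n) = v := by
        rw [smul_smul, smul_smul, ← add_smul]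
        convert one_smul ℝ (v : Eucl n)
        field_simp
        linarith
      rw [p1] at e1
      rw [p2] at e2
      simp only [smul_eq_mul] at e1 e2
      have e3 : σ * f ((r / σ) • (v : Eucl n)) ≤ x * f a + y * f b := by
        have := mul_le_mul_of_nonneg_left e1 h0.le
        rwa [show σ * (x / σ * f a + y / σ * f b) = x * f a + y * f b by field_simp] at this
      have e4 : D * f v ≤ σ * f ((r / σ) • (v : Eucl n)) +
          (σ - r) * f ((2 : ℝ) • (v : Eucl n)) := by
        have := mul_le_mul_of_nonneg_left e2 hD.le
        rwa [mul_add, ← mul_assoc, ← mul_assoc, mul_div_cancel₀ _ hD.ne',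
          mul_div_cancel₀ _ hD.ne'] at this
      have h1 := hfh _ (hball1 v)
      have h2 := hfh _ (hball 2 v (by norm_num) le_rfl)
      rw [supp_smul (by norm_num)] at h2
      rw [abs_le] at h1 h2
      have e5 : f ((2 : ℝ) • (v : Eucl n)) ≤ 2 * f v + 3 * δ := by linarith [h1.1, h2.2]
      have e6 := mul_le_mul_of_nonneg_left e5 (sub_nonneg.2 hrσ)
      rw [hDe] at e4
      nlinarith [e3, e4, e6])
  refine ⟨fun v => f v + 3 * δ, (polyAlg n).add_mem hf (const_mem_polyAlg _), P, hP,
    dist_le_of_hs (by positivity) fun u => ?_⟩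
  rw [hP]
  have h1 := hfh _ (hball1 u)
  rw [abs_le] at h1 ⊢
  simp only [hs]
  constructor <;> linarith [h1.1, h1.2]

theorem exists_polyAlg_body (K : ConvexBody (Eucl n)) {ε : ℝ} (hε : 0 < ε) :
    ∃ f ∈ polyAlg n, ∃ P : ConvexBody (Eucl n), (hs P = fun u : Sph n => f u) ∧
      dist P K ≤ ε := by
  obtain ⟨m, v, hv, -⟩ := K.exists_polytope (half_pos hε)
  have h : PolyApprox (supp (polytope v)) := by
    have := PolyApprox.sup' (s := Finset.univ) Finset.univ_nonempty (h := fun i u => ⟪v i, u⟫_ℝ)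
      fun i _ => PolyApprox.inner (v i)
    rwa [show supp (polytope v) = _ from funext (supp_polytope v)]
  obtain ⟨f, hf, P, hP, hd⟩ := h.exists_body (by positivity : 0 < ε / 8)
  exact ⟨f, hf, P, hP, (dist_triangle _ _ _).trans (by linarith)⟩

end PolynomialBodies

section FiniteDimensional

variable {n : ℕ} {G : Set (Matrix (Fin n) (Fin n) ℝ)} {γ : Measure (Mat n)}

/-- The `G`-invariant continuous translation-invariant valuations which are polynomial of
degree less than `d`. -/
def valFil (G : Set (Matrix (Fin n) (Fin n) ℝ)) (d : ℕ) :
    Submodule ℝ (ConvexBody (Eucl n) → ℝ) where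
  carrier := {φ | IsVal φ ∧ GInv G φ ∧ IsPolyVal d φ}
  add_mem' := fun {φ ψ} h h' => ⟨h.1.add h'.1, fun A hA K => by
    rw [Pi.add_apply, Pi.add_apply, h.2.1 A hA, h'.2.1 A hA], h.2.2.add h'.2.2⟩
  zero_mem' := ⟨IsVal.zero, fun _ _ _ => rfl, IsPolyVal.zero d⟩
  smul_mem' := fun c φ h => ⟨h.1.smul c, fun A hA K => by
    rw [Pi.smul_apply, Pi.smul_apply, h.2.1 A hA], h.2.2.smul c⟩

theorem symF_sum {V : Type*} [NormedAddCommGroup V] [NormedSpace ℝ V] {J : Type*} {d : ℕ}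
    (s : Finset J) (c : J → ℝ) (φ : J → ConvexBody V → ℝ) (L : Fin d → ConvexBody V) :
    symF d (∑ i ∈ s, c i • φ i) L = ∑ i ∈ s, c i * symF d (φ i) L := by
  classical
  induction s using Finset.induction_on with
  | empty => simpa using symF_smul 0 0 L
  | insert a s ha ih => rw [Finset.sum_insert ha, Finset.sum_insert ha, symF_add, symF_smul, ih]

theorem IsSymbol.sum {J : Type*} [Fintype J] {d : ℕ} (c : J → ℝ)
    {φ : J → ConvexBody (Eucl n) → ℝ}
    {Φ : J → MultilinearMap ℝ (fun _ : Fin d => Sph n → ℝ) ℝ} (h : ∀ i, IsSymbol d (φ i) (Φ i)) :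
    IsSymbol d (∑ i, c i • φ i) (∑ i, c i • Φ i) := fun L => by
  rw [symF_sum]
  simp only [sum_apply, smul_apply, smul_eq_mul, fun i => h i L]

theorem RegBound.sum {J : Type*} [Fintype J] {d : ℕ} {c C : J → ℝ} (hc : ∀ i, |c i| ≤ 1)
    {Φ : J → MultilinearMap ℝ (fun _ : Fin d => Sph n → ℝ) ℝ}
    (h : ∀ i, RegBound (Φ i) (C i)) : RegBound (∑ i, c i • Φ i) (∑ i, C i) := by
  intro s A f hs' hA hf
  simp only [sum_apply, smul_apply, smul_eq_mul, Finset.sum_mul]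
  refine (Finset.abs_sum_le_sum_abs _ _).trans (Finset.sum_le_sum fun i _ => ?_)
  rw [abs_mul]
  calc |c i| * |Φ i f| ≤ 1 * (C i * ∏ j, (5 * A j * s ^ 2)) :=
        mul_le_mul (hc i) (h i s A f hs' hA hf) (abs_nonneg _) zero_le_one
    _ = _ := one_mul _

theorem exists_norm_eq_one_of_card_lt {I J : Type*} [Fintype I] [Fintype J]
    (hIJ : Fintype.card I < Fintype.card J) (T : (J → ℝ) →ₗ[ℝ] (I → ℝ)) :
    ∃ c : J → ℝ, ‖c‖ = 1 ∧ T c = 0 := by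
  have h := T.ker_ne_bot_of_finrank_lt (by simpa using hIJ)
  obtain ⟨c, hc, hc0⟩ := (Submodule.ne_bot_iff _).1 h
  refine ⟨‖c‖⁻¹ • c, ?_, ?_⟩
  · rw [norm_smul, norm_inv, norm_norm, inv_mul_cancel₀ (norm_ne_zero_iff.2 hc0)]
  · rw [_root_.map_smul, LinearMap.mem_ker.1 hc, smul_zero]

theorem dense_polyAlg_bodies :
    Dense {P : ConvexBody (Eucl n) | ∃ f ∈ polyAlg n, hs P = fun u : Sph n => f u} := by
  intro K
  rw [Metric.mem_closure_iff]
  intro ε hε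
  obtain ⟨f, hf, P, hP, hd⟩ := exists_polyAlg_body K (half_pos hε)
  exact ⟨P, ⟨f, hf, hP⟩, by rw [dist_comm]; linarith⟩

theorem exists_sum_mem_valFil (h : IsTransHaar G γ) (e : Sph n) {d : ℕ} {J : Type*} [Fintype J]
    (hJ : Fintype.card (Fin (d + 1) → Fin n → Fin (2 * (d + 1) + n + 1)) < Fintype.card J)
    (φ : J → ConvexBody (Eucl n) → ℝ) (hφ : ∀ i, φ i ∈ valFil G (d + 2)) :
    ∃ c : J → ℝ, c ≠ 0 ∧ ∑ i, c i • φ i ∈ valFil G (d + 1) := by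
  choose Φ hΦ using fun i => exists_symbol (d + 1) (hφ i).1.cont (hφ i).2.2
  choose C hC hb using fun i => (hΦ i).bound_reg (hφ i).1
  have hsum : ∀ c : J → ℝ, ∑ i, c i • φ i ∈ valFil G (d + 2) := fun c =>
    Submodule.sum_mem _ fun i _ => Submodule.smul_mem _ _ (hφ i)
  have hsph : ∀ k : ℕ, ∃ c : J → ℝ, ‖c‖ = 1 ∧
      ∀ α : Fin (d + 1) → Fin n → ℕ, (∀ i j, α i j ≤ 2 * (d + 1) + n) →
        (∑ i, c i • Φ i) (locMono e ((k : ℝ) + 1) α) = 0 := fun k => by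
    obtain ⟨c, hc, h0⟩ := exists_norm_eq_one_of_card_lt hJ (LinearMap.pi fun α =>
      ∑ i, (Φ i (locMono e ((k : ℝ) + 1) fun p j => (α p j : ℕ))) •
        (LinearMap.proj i : (J → ℝ) →ₗ[ℝ] ℝ))
    refine ⟨c, hc, fun α hα => ?_⟩
    have := congrFun h0 fun p j => ⟨α p j, Nat.lt_succ_of_le (hα p j)⟩
    simp only [LinearMap.pi_apply, LinearMap.sum_apply, LinearMap.smul_apply, LinearMap.proj_apply,
      smul_eq_mul, Pi.zero_apply] at this
    simp only [sum_apply, smul_apply, smul_eq_mul]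
    rw [← this]
    exact Finset.sum_congr rfl fun i _ => mul_comm _ _
  choose c hc1 hc0 using hsph
  obtain ⟨a, ha, σ, hσ, hlim⟩ := (isCompact_sphere (0 : J → ℝ) 1).tendsto_subseq
    (x := c) fun k => mem_sphere_zero_iff_norm.2 (hc1 k)
  have ha1 : ‖a‖ = 1 := mem_sphere_zero_iff_norm.1 ha
  refine ⟨a, fun h0 => by simp [h0] at ha1, (hsum a).1, (hsum a).2.1,
    (hsum a).2.2.of_symF_eq_zero fun L => ?_⟩
  have hpoly : ∀ f : Fin (d + 1) → Eucl n → ℝ, (∀ i, f i ∈ polyAlg n) →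
      (∑ i, a i • Φ i) (fun p u => f p u) = 0 := fun f hf => by
    obtain ⟨C', hC', hest⟩ := IsSymbol.exists_global_estimate h f hf e
      (Finset.sum_nonneg fun i (_ : i ∈ Finset.univ) => hC i)
    have hbd : ∀ k : ℕ, |(∑ i, c k i • Φ i) fun p u => f p u| ≤ C' * ((k + 1 : ℕ) : ℝ)⁻¹ :=
      fun k => hest (∑ i, c k i • φ i) _ (k + 1) (IsSymbol.sum (c k) hΦ) (hsum _).1 (hsum _).2.1
        (RegBound.sum (fun i => (norm_le_pi_norm (c k) i).trans (hc1 k).le) hb) (by omega)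
        (by simpa only [Nat.cast_add, Nat.cast_one] using hc0 k)
    have hz : Filter.Tendsto (fun k : ℕ => C' * ((k + 1 : ℕ) : ℝ)⁻¹) Filter.atTop (nhds 0) := by
      have := (tendsto_one_div_add_atTop_nhds_zero_nat (𝕜 := ℝ)).const_mul C'
      simpa using this
    have h1 : Filter.Tendsto (fun k => (∑ i, c (σ k) i • Φ i) fun p u => f p u) Filter.atTop
        (nhds 0) :=
      squeeze_zero_norm (fun k => hbd (σ k)) (hz.comp hσ.tendsto_atTop)
    have h2 : Filter.Tendsto (fun k => (∑ i, c (σ k) i • Φ i) fun p u => f p u) Filter.atTop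
        (nhds ((∑ i, a i • Φ i) fun p u => f p u)) := by
      simp only [sum_apply, smul_apply, smul_eq_mul]
      exact tendsto_finsetSum _ fun i _ => ((tendsto_pi_nhds.1 hlim) i).mul_const _
    exact tendsto_nhds_unique h2 h1
  have hclosed : IsClosed {L | symF (d + 1) (∑ i, a i • φ i) L = 0} :=
    isClosed_eq (continuous_symF (fun _ => ∑ i, a i • φ i) (fun L => L)
      ((hsum a).1.cont.comp continuous_snd) continuous_id) continuous_const
  have hd := dense_pi (Set.univ : Set (Fin (d + 1))) fun _ _ => dense_polyAlg_bodies (n := n)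
  have hsub := hclosed.closure_subset_iff.2 (show Set.univ.pi (fun _ : Fin (d + 1) =>
      {P : ConvexBody (Eucl n) | ∃ f ∈ polyAlg n, hs P = fun u : Sph n => f u}) ⊆
        {L | symF (d + 1) (∑ i, a i • φ i) L = 0} from fun P hP => by
    choose f hf hPf using fun i => hP i trivial
    rw [Set.mem_ofPred_eq, ← IsSymbol.sum a hΦ P, ← hpoly f hf]
    exact congrArg _ (funext hPf))
  exact hsub (hd L)

theorem Submodule.finite_of_exists_sum_mem {E : Type*} [AddCommGroup E] [Module ℝ E]
    {W V : Submodule ℝ E} (hWV : W ≤ V) [Module.Finite ℝ W] (M : ℕ)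
    (h : ∀ φ : Fin (M + 1) → E, (∀ i, φ i ∈ V) → ∃ c : Fin (M + 1) → ℝ, c ≠ 0 ∧
      ∑ i, c i • φ i ∈ W) : Module.Finite ℝ V := by
  have h1 : Module.Finite ℝ (W.submoduleOf V) :=
    Module.Finite.equiv (Submodule.submoduleOfEquivOfLe hWV).symm
  have h2 : Module.Finite ℝ (V ⧸ W.submoduleOf V) := by
    rw [← Module.rank_lt_aleph0_iff]
    refine (_root_.rank_le (n := M) fun s hs' => ?_).trans_lt (Cardinal.natCast_lt_aleph0)
    by_contra! hcard
    obtain ⟨t, hts, htc⟩ := Finset.exists_subset_card_eq (Nat.succ_le_of_lt hcard)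
    have ht : LinearIndependent ℝ fun i : t => (i : V ⧸ W.submoduleOf V) :=
      hs'.comp (Set.inclusion hts) (Set.inclusion_injective hts)
    have ht' := ht.comp _ (t.equivFinOfCardEq htc).symm.injective
    choose g hg using Submodule.mkQ_surjective (W.submoduleOf V)
    obtain ⟨c, hc, hcW⟩ := h (fun i => g ((t.equivFinOfCardEq htc).symm i)) fun i => (g _).2
    refine hc (funext (Fintype.linearIndependent_iff.1 ht' c ?_))
    have : (W.submoduleOf V).mkQ (∑ i, c i • g ((t.equivFinOfCardEq htc).symm i)) = 0 := by
      rw [Submodule.mkQ_apply, Submodule.Quotient.mk_eq_zero]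
      refine Submodule.mem_comap.2 ?_
      simpa using hcW
    rw [← this, _root_.map_sum]
    simp only [_root_.map_smul, hg, Function.comp]
  exact Module.Finite.of_submodule_quotient (W.submoduleOf V)

theorem IsPolyVal.succ {V : Type*} [NormedAddCommGroup V] [NormedSpace ℝ V] :
    ∀ {d : ℕ} {φ : ConvexBody V → ℝ}, IsPolyVal d φ → IsPolyVal (d + 1) φ
  | 0, φ, h => by
    rw [show φ = 0 from h]
    exact IsPolyVal.zero 1
  | d + 1, φ, h => fun L => (h L).succ

theorem finite_valFil (h : IsTransHaar G γ) (e : Sph n) : ∀ d, Module.Finite ℝ (valFil G d)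
  | 0 => by
    have : valFil G 0 = ⊥ := (Submodule.eq_bot_iff _).2 fun φ hφ => hφ.2.2
    rw [this]
    infer_instance
  | 1 => by
    have := finite_valFil h e 0
    refine Submodule.finite_of_exists_sum_mem (W := valFil G 0)
      (fun φ hφ => ⟨hφ.1, hφ.2.1, hφ.2.2.succ⟩) 1 fun φ hφ => ?_
    obtain ⟨c, hc, h0⟩ := exists_norm_eq_one_of_card_lt (I := Fin 1) (J := Fin 2) (by simp)
      (LinearMap.pi fun _ => ∑ i, φ i 0 • (LinearMap.proj i : (Fin 2 → ℝ) →ₗ[ℝ] ℝ))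
    have hm : ∑ i, c i • φ i ∈ valFil G 1 :=
      Submodule.sum_mem _ fun i _ => Submodule.smul_mem _ _ (hφ i)
    refine ⟨c, fun h => by simp [h] at hc, hm.1, hm.2.1, hm.2.2.of_symF_eq_zero fun L => ?_⟩
    rw [symF_sum]
    refine Eq.trans ?_ (congrFun h0 0)
    simp only [symF, LinearMap.pi_apply, LinearMap.sum_apply, LinearMap.smul_apply,
      LinearMap.proj_apply, smul_eq_mul, mul_comm]
  | d + 2 => by
    have := finite_valFil h e (d + 1)
    exact Submodule.finite_of_exists_sum_mem (W := valFil G (d + 1))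
      (fun φ hφ => ⟨hφ.1, hφ.2.1, hφ.2.2.succ⟩) _
      fun φ hφ => exists_sum_mem_valFil h e (by rw [Fintype.card_fin]; exact Nat.lt_succ_self _)
        φ hφ

end FiniteDimensional

section Kinematic

variable {n : ℕ} {G : Set (Matrix (Fin n) (Fin n) ℝ)} {γ : Measure (Mat n)}

/-- The linear map of a matrix as a continuous linear map. -/
def matCLM (A : Matrix (Fin n) (Fin n) ℝ) : Eucl n →L[ℝ] Eucl n :=
  LinearMap.toContinuousLinearMap (Matrix.toEuclideanLin A)

theorem matBody_eq_map_matCLM (A : Matrix (Fin n) (Fin n) ℝ) (K : ConvexBody (Eucl n)) :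
    matBody A K = K.map (matCLM A) := rfl

theorem continuous_matCLM : Continuous fun A : Mat n => matCLM (Matrix.of A) :=
  LinearMap.continuous_of_finiteDimensional
    ((LinearMap.toContinuousLinearMap.toLinearMap ∘ₗ
      (Matrix.toEuclideanLin (𝕜 := ℝ) (m := Fin n) (n := Fin n)).toLinearMap) ∘ₗ
        (Matrix.ofLinearEquiv ℝ).toLinearMap)

theorem continuous_matBody (K : ConvexBody (Eucl n)) :
    Continuous fun A : Mat n => matBody (Matrix.of A) K := by
  obtain ⟨R, hR, hK⟩ := K.exists_inBall
  have h : Continuous fun T : Eucl n →L[ℝ] Eucl n => K.map T := by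
    have key : ∀ S T : Eucl n →L[ℝ] Eucl n, ∀ x ∈ K.map S, ∃ y ∈ K.map T,
        dist x y ≤ R * dist S T := by
      rintro S T _ ⟨x, hx, rfl⟩
      refine ⟨T x, ⟨x, hx, rfl⟩, ?_⟩
      rw [dist_eq_norm, dist_eq_norm, ← sub_apply, mul_comm]
      exact (ContinuousLinearMap.le_opNorm _ _).trans
        (mul_le_mul_of_nonneg_left (hK x hx) (norm_nonneg _))
    refine (LipschitzWith.of_dist_le_mul (K := ⟨R, hR.le⟩) fun S T => ?_).continuous
    refine ConvexBody.dist_le_of _ _ (mul_nonneg hR.le dist_nonneg) (key S T) ?_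
    change ∀ x ∈ K.map T, ∃ y ∈ K.map S, dist x y ≤ R * dist S T
    rw [dist_comm S T]
    exact key T S
  exact h.comp continuous_matCLM

theorem matBody_mul (A B : Matrix (Fin n) (Fin n) ℝ) (K : ConvexBody (Eucl n)) :
    matBody (A * B) K = matBody A (matBody B K) := by
  apply ConvexBody.ext
  change _ '' _ = _ '' (_ '' _)
  rw [Set.image_image]
  exact Set.image_congr fun v _ => toEuclideanLin_mul_apply A B v

theorem matBody_add (A : Matrix (Fin n) (Fin n) ℝ) (K L : ConvexBody (Eucl n)) :
    matBody A (K + L) = matBody A K + matBody A L := by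
  simp only [matBody_eq_map_matCLM, ConvexBody.map_add]

theorem inBall_matBody {A : Matrix (Fin n) (Fin n) ℝ}
    (hA : A ∈ Matrix.orthogonalGroup (Fin n) ℝ) {K : ConvexBody (Eucl n)} {R : ℝ}
    (hK : K.InBall R) : (matBody A K).InBall R := by
  obtain ⟨T, hT, -⟩ := exists_isometry_of_orthogonal hA
  rintro _ ⟨x, hx, rfl⟩
  rw [← hT, T.norm_map]
  exact hK x hx

theorem extendVal_coe (φ : ConvexBody (Eucl n) → ℝ) (K : ConvexBody (Eucl n)) :
    extendVal φ (K : Set (Eucl n)) = φ K := by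
  have h : ∃ B : ConvexBody (Eucl n), (B : Set (Eucl n)) = K := ⟨K, rfl⟩
  rw [extendVal, dif_pos h]
  exact congrArg φ (ConvexBody.ext h.choose_spec)

theorem extendVal_add_image (φ : ConvexBody (Eucl n) → ℝ) (A : Matrix (Fin n) (Fin n) ℝ)
    (K L : ConvexBody (Eucl n)) :
    extendVal φ ((K : Set (Eucl n)) + Matrix.toEuclideanLin A '' (L : Set (Eucl n))) =
      φ (K + matBody A L) :=
  extendVal_coe φ (K + matBody A L)

theorem IsVal.integral {Ω : Type*} [MeasurableSpace Ω] {μ : Measure Ω} [IsFiniteMeasure μ]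
    {φ : Ω → ConvexBody (Eucl n) → ℝ} (hφ : ∀ ω, IsVal (φ ω))
    (hm : ∀ K, AEStronglyMeasurable (fun ω => φ ω K) μ)
    (hb : ∀ R : ℝ, ∃ B, ∀ᵐ ω ∂μ, ∀ K : ConvexBody (Eucl n), K.InBall R → |φ ω K| ≤ B) :
    IsVal fun K => ∫ ω, φ ω K ∂μ where
  val K L M I hM hI := by
    have h_int : ∀ K, Integrable (fun ω => φ ω K) μ := fun K => by
      obtain ⟨R, -, hK⟩ := K.exists_inBall
      obtain ⟨B, hB⟩ := hb R
      exact Integrable.of_bound (hm K) B (hB.mono fun ω h => h K hK)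
    rw [← integral_add (h_int M) (h_int I), ← integral_add (h_int K) (h_int L)]
    exact integral_congr_ae (Filter.Eventually.of_forall fun ω => (hφ ω).val K L M I hM hI)
  cont := by
    refine continuous_iff_continuousAt.2 fun K₀ => ?_
    obtain ⟨R, -, hK₀⟩ := K₀.exists_inBall
    obtain ⟨B, hB⟩ := hb (R + 1)
    refine continuousAt_of_dominated (bound := fun _ => B)
      (Filter.Eventually.of_forall fun K => hm K) ?_ (integrable_const B)
      (Filter.Eventually.of_forall fun ω => (hφ ω).cont.continuousAt)
    filter_upwards [Metric.closedBall_mem_nhds K₀ one_pos] with K hK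
    exact hB.mono fun ω h => h K (ConvexBody.inBall_of_dist hK₀ hK)
  trans K x := by simp only [fun ω => (hφ ω).trans K x]

theorem IsTransHaar.integral_transpose (h : IsTransHaar G γ) {F : Mat n → ℝ} (hF : Continuous F)
    {C : ℝ} (hC : ∀ g : Mat n, Matrix.of g ∈ G → |F g| ≤ C) :
    ∫ g, F (Matrix.of.symm (Matrix.of g).transpose) ∂γ = ∫ g, F g ∂γ := by
  have := h.prob
  have hT : Continuous fun g : Mat n => (Matrix.of.symm (Matrix.of g).transpose : Mat n) := by
    refine continuous_pi fun i => continuous_pi fun j => ?_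
    change Continuous fun g : Mat n => g j i
    fun_prop
  have hmul : Continuous fun p : Mat n × Mat n =>
      (Matrix.of.symm ((Matrix.of p.1).transpose * Matrix.of p.2) : Mat n) := by
    refine continuous_pi fun i => continuous_pi fun j => ?_
    simp only [Matrix.of_symm_apply, Matrix.mul_apply, Matrix.of_apply, Matrix.transpose_apply]
    fun_prop
  have h_int : Integrable (Function.uncurry fun a b : Mat n =>
      F (Matrix.of.symm ((Matrix.of a).transpose * Matrix.of b))) (γ.prod γ) := by
    refine Integrable.of_bound (hF.comp hmul).aestronglyMeasurable C ?_
    filter_upwards [Measure.quasiMeasurePreserving_fst.ae h.ae_mem,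
      Measure.quasiMeasurePreserving_snd.ae h.ae_mem] with p h1 h2
    exact hC _ (h.sub.2.2.1 _ (h.transpose_mem h1) _ h2)
  have hswap := integral_integral_swap h_int
  have h1 : ∀ᵐ a ∂γ, ∫ b, F (Matrix.of.symm ((Matrix.of a).transpose * Matrix.of b)) ∂γ =
      ∫ b, F b ∂γ := h.ae_mem.mono fun a ha =>
    h.integral_mul_left (B := Matrix.of.symm (Matrix.of a).transpose) (h.transpose_mem ha) hF
  have h2 : ∀ᵐ b ∂γ, ∫ a, F (Matrix.of.symm ((Matrix.of a).transpose * Matrix.of b)) ∂γ =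
      ∫ a, F (Matrix.of.symm (Matrix.of a).transpose) ∂γ := h.ae_mem.mono fun b hb => by
    refine Eq.trans ?_ (h.integral_mul_left (B := Matrix.of.symm (Matrix.of b).transpose)
      (F := fun g => F (Matrix.of.symm (Matrix.of g).transpose)) (h.transpose_mem hb)
      (hF.comp hT))
    refine integral_congr_ae (Filter.Eventually.of_forall fun a => ?_)
    simp only [Equiv.apply_symm_apply, Matrix.transpose_mul,
      Matrix.transpose_transpose]
  rw [integral_congr_ae h1, integral_congr_ae h2, integral_const, integral_const] at hswap
  simpa using hswap.symm

theorem IsTransHaar.integral_mul_right (h : IsTransHaar G γ) {B : Matrix (Fin n) (Fin n) ℝ}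
    (hB : B ∈ G) {F : Mat n → ℝ} (hF : Continuous F)
    {C : ℝ} (hC : ∀ g : Mat n, Matrix.of g ∈ G → |F g| ≤ C) :
    ∫ g, F (Matrix.of.symm (Matrix.of g * B)) ∂γ = ∫ g, F g ∂γ := by
  have hT : Continuous fun g : Mat n => (Matrix.of.symm (Matrix.of g).transpose : Mat n) := by
    refine continuous_pi fun i => continuous_pi fun j => ?_
    change Continuous fun g : Mat n => g j i
    fun_prop
  have hR : Continuous fun g : Mat n => (Matrix.of.symm (Matrix.of g * B) : Mat n) := by
    refine continuous_pi fun i => continuous_pi fun j => ?_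
    simp only [Matrix.of_symm_apply, Matrix.mul_apply, Matrix.of_apply]
    fun_prop
  refine (h.integral_transpose (F := fun g => F (Matrix.of.symm (Matrix.of g * B)))
    (hF.comp hR) (C := C) fun g hg => hC _ (h.sub.2.2.1 _ hg _ hB)).symm.trans ?_
  refine Eq.trans ?_ (h.integral_transpose hF hC)
  refine Eq.trans ?_ (h.integral_mul_left (B := Matrix.of.symm B.transpose)
    (F := fun g => F (Matrix.of.symm (Matrix.of g).transpose)) (h.transpose_mem hB) (hF.comp hT))
  refine integral_congr_ae (Filter.Eventually.of_forall fun a => ?_)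
  simp only [Equiv.apply_symm_apply, Matrix.transpose_mul,
    Matrix.transpose_transpose]

variable {φ : ConvexBody (Eucl n) → ℝ}

/-- The bivaluation of the additive kinematic formula. -/
def kinematic (γ : Measure (Mat n)) (φ : ConvexBody (Eucl n) → ℝ)
    (K L : ConvexBody (Eucl n)) : ℝ :=
  ∫ g : Mat n, φ (K + matBody (Matrix.of g) L) ∂γ

theorem continuous_kinematic_integrand (hφ : IsVal φ) (K L : ConvexBody (Eucl n)) :
    Continuous fun g : Mat n => φ (K + matBody (Matrix.of g) L) :=
  hφ.cont.comp (continuous_const.add (continuous_matBody L))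

theorem exists_kinematic_bound (h : IsTransHaar G γ) (hφ : IsVal φ) (R S : ℝ) :
    ∃ B, ∀ A ∈ G, ∀ K L : ConvexBody (Eucl n), K.InBall R → L.InBall S →
      |φ (K + matBody A L)| ≤ B := by
  obtain ⟨C, -, hC⟩ := hφ.exists_growth
  exact ⟨C * (1 + (R + S)) ^ n, fun A hA K L hK hL =>
    hC _ _ (add_nonneg hK.nonneg hL.nonneg) (hK.add (inBall_matBody (h.sub.1 A hA) hL))⟩

theorem IsVal.kinematic_left (h : IsTransHaar G γ) (hφ : IsVal φ) (L : ConvexBody (Eucl n)) :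
    IsVal fun K => kinematic γ φ K L := by
  have := h.prob
  refine IsVal.integral (φ := fun (g : Mat n) K => φ (K + matBody (Matrix.of g) L))
    (fun g => ?_) (fun K => (continuous_kinematic_integrand hφ K L).aestronglyMeasurable)
    fun R => ?_
  · simpa only [add_comm] using hφ.comp_add (matBody (Matrix.of g) L)
  · obtain ⟨S, -, hS⟩ := L.exists_inBall
    obtain ⟨B, hB⟩ := exists_kinematic_bound h hφ R S
    exact ⟨B, h.ae_mem.mono fun g hg K hK => hB _ hg K L hK hS⟩

theorem IsVal.kinematic_right (h : IsTransHaar G γ) (hφ : IsVal φ) (K : ConvexBody (Eucl n)) :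
    IsVal (kinematic γ φ K) := by
  have := h.prob
  refine IsVal.integral (φ := fun (g : Mat n) L => φ (K + matBody (Matrix.of g) L))
    (fun g => hφ.comp_add_map K (matCLM (Matrix.of g)))
    (fun L => (continuous_kinematic_integrand hφ K L).aestronglyMeasurable) fun S => ?_
  obtain ⟨R, -, hR⟩ := K.exists_inBall
  obtain ⟨B, hB⟩ := exists_kinematic_bound h hφ R S
  exact ⟨B, h.ae_mem.mono fun g hg L hL => hB _ hg K L hR hL⟩

theorem GInv.kinematic_left (h : IsTransHaar G γ) (hφ : IsVal φ) (hG : GInv G φ)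
    (L : ConvexBody (Eucl n)) : GInv G fun K => kinematic γ φ K L := fun A hA K => by
  have hA' : A * A.transpose = 1 := (Matrix.mem_orthogonalGroup_iff _ _).1 (h.sub.1 A hA)
  change ∫ g : Mat n, φ (matBody A K + matBody (Matrix.of g) L) ∂γ = kinematic γ φ K L
  rw [kinematic, ← h.integral_mul_left (B := Matrix.of.symm A.transpose) (h.transpose_mem hA)
    (continuous_kinematic_integrand hφ K L)]
  refine integral_congr_ae (Filter.Eventually.of_forall fun g => ?_)
  simp only [Equiv.apply_symm_apply]
  rw [← hG A hA (K + _), matBody_add, ← matBody_mul, ← mul_assoc, hA', one_mul]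

theorem GInv.kinematic_right (h : IsTransHaar G γ) (hφ : IsVal φ)
    (K : ConvexBody (Eucl n)) : GInv G (kinematic γ φ K) := fun A hA L => by
  obtain ⟨R, -, hR⟩ := K.exists_inBall
  obtain ⟨S, -, hS⟩ := L.exists_inBall
  obtain ⟨B, hB⟩ := exists_kinematic_bound h hφ R S
  rw [kinematic, kinematic, ← h.integral_mul_right hA (continuous_kinematic_integrand hφ K L)
    fun g hg => hB _ hg K L hR hS]
  refine integral_congr_ae (Filter.Eventually.of_forall fun g => ?_)
  simp only [Equiv.apply_symm_apply, matBody_mul]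

theorem kinematic_mem_valFil (h : IsTransHaar G γ) (hφ : IsVal φ)
    (K : ConvexBody (Eucl n)) : kinematic γ φ K ∈ valFil G (n + 1) :=
  ⟨hφ.kinematic_right h K, GInv.kinematic_right h hφ K, (hφ.kinematic_right h K).isPolyVal⟩

theorem exists_kinematic_expansion (h : IsTransHaar G γ) (e : Sph n) (hφ : IsVal φ)
    (hG : GInv G φ) : ∃ (N : ℕ) (ψ ρ : Fin N → ConvexBody (Eucl n) → ℝ),
      (∀ i, IsVal (ψ i) ∧ GInv G (ψ i)) ∧ (∀ i, IsVal (ρ i) ∧ GInv G (ρ i)) ∧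
      ∀ K L, kinematic γ φ K L = ∑ i, ψ i K * ρ i L := by
  have := finite_valFil h e (n + 1)
  let b := Module.finBasis ℝ (valFil G (n + 1))
  let F : ConvexBody (Eucl n) → valFil G (n + 1) := fun K => ⟨_, kinematic_mem_valFil h hφ K⟩
  have hFc : Continuous F := Continuous.subtype_mk
    (continuous_pi fun L => (hφ.kinematic_left h L).cont) _
  refine ⟨_, fun i K => b.coord i (F K), fun i => (b i : ConvexBody (Eucl n) → ℝ),
    fun i => ⟨⟨?_, ?_, ?_⟩, ?_⟩, fun i => ⟨(b i).2.1, (b i).2.2.1⟩, fun K L => ?_⟩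
  · intro K L M I hM hI
    have : F M + F I = F K + F L := Subtype.ext (funext fun X =>
      (hφ.kinematic_left h X).val K L M I hM hI)
    simp only [← _root_.map_add, this]
  · exact (LinearMap.continuous_of_finiteDimensional (b.coord i)).comp hFc
  · intro K x
    have : F (K.translate x) = F K := Subtype.ext (funext fun X =>
      (hφ.kinematic_left h X).trans K x)
    simp only [this]
  · intro A hA K
    have : F (matBody A K) = F K := Subtype.ext (funext fun X =>
      GInv.kinematic_left h hφ hG X A hA K)
    simp only [this]
  · have h1 : ((∑ i, b.repr (F K) i • b i : valFil G (n + 1)) : ConvexBody (Eucl n) → ℝ) L =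
        kinematic γ φ K L := by rw [b.sum_repr]
    rw [← h1, Submodule.coe_sum, Finset.sum_apply]
    rfl

end Kinematic

/-- **Existence of global additive kinematic formulas.** Let `G ≤ O(n)` be a closed subgroup
acting transitively on the unit sphere and `γ` the Haar probability measure on `G`. For every
`φ ∈ Val^G` there are finitely many `ψ_1, …, ψ_N, ρ_1, …, ρ_N ∈ Val^G` such that for all
convex bodies `K, L`: `∫_G φ(K + gL) dγ(g) = ∑ᵢ ψᵢ(K) ρᵢ(L)`, where `+` denotes the
Minkowski sum. -/
theorem exists_additive_kinematic_formula (n : ℕ) (hn : 1 ≤ n)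
    (G : Set (Matrix (Fin n) (Fin n) ℝ)) (hG : IsClosedSubgroupO G)
    (htrans : ActsTransitively G)
    (γ : Measure (Mat n)) (hγprob : IsProbabilityMeasure γ)
    (hγsupp : γ {A : Mat n | Matrix.of A ∉ G} = 0)
    (hγinv : ∀ B : Mat n, Matrix.of B ∈ G →
      Measure.map (fun A : Mat n => Matrix.of.symm (Matrix.of B * Matrix.of A)) γ = γ)
    (φ : ConvexBody (Eucl n) → ℝ)
    (hval : IsValuation φ) (hcont : Continuous φ) (htrans' : TransInv φ) (hGinv : GInv G φ) :
    ∃ (N : ℕ) (ψ ρ : Fin N → ConvexBody (Eucl n) → ℝ),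
      (∀ i, IsValuation (ψ i) ∧ Continuous (ψ i) ∧ TransInv (ψ i) ∧ GInv G (ψ i)) ∧
      (∀ i, IsValuation (ρ i) ∧ Continuous (ρ i) ∧ TransInv (ρ i) ∧ GInv G (ρ i)) ∧
      ∀ K L : ConvexBody (Eucl n),
        (∫ g : Mat n, extendVal φ ((K : Set (Eucl n)) +
            Matrix.toEuclideanLin (Matrix.of g) '' (L : Set (Eucl n))) ∂γ)
          = ∑ i, ψ i K * ρ i L := by
  have h : IsTransHaar G γ := ⟨hG, htrans, hγprob, hγsupp, hγinv⟩
  obtain ⟨N, ψ, ρ, hψ, hρ, hK⟩ := exists_kinematic_expansion h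
    (⟨EuclideanSpace.single ⟨0, hn⟩ 1, by simp⟩ : Sph n) ⟨hval, hcont, htrans'⟩ hGinv
  refine ⟨N, ψ, ρ, fun i => ⟨(hψ i).1.val, (hψ i).1.cont, (hψ i).1.trans, (hψ i).2⟩,
    fun i => ⟨(hρ i).1.val, (hρ i).1.cont, (hρ i).1.trans, (hρ i).2⟩, fun K L => ?_⟩
  simp only [extendVal_add_image]
  exact hK K L
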